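/- Let m ≥ 3, n ≥ 1 and N ≥ 1. For every m-admissible pair (q̃,r̃), every index 1 ≤ α ≤ N and every space–time function F, the dual homogeneous estimate ‖∫_ℝ e^{-isΔ_x} F(s) ds‖_{L^2_x} ≲ ‖F‖_{L^{q̃'}_t L^{r̃',2}_{y_α} L^2_{z_α} L^2_{x̂_α}} holds, where q̃', r̃' are the Hölder conjugates of q̃, r̃. -/

import Mathlib

/-!
Setting of Z. Zhao, "On Strichartz estimate for many body Schrödinger equations
in the waveguide setting": the waveguide manifold `ℝ^m × 𝕋^n`, the `N`-body
configuration space `(ℝ^m × 𝕋^n)^N`, the many body Schrödinger operator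
`H_N = Δ_x - ∑_{α<β} V(x_α - x_β)`, its propagator (characterized weakly),
iterated mixed Lebesgue/Lorentz norms, and Koch–Tataru `V^p`-spaces adapted to
the free propagator.
-/

noncomputable section
open MeasureTheory
open scoped ENNReal NNReal

namespace ManyBodyWaveguide

instance : Fact ((0:ℝ) < 1) := ⟨one_pos⟩

/-- The `n`-dimensional torus `𝕋^n`. -/
abbrev Torus (n : ℕ) := Fin n → AddCircle (1 : ℝ)

/-- The waveguide manifold `ℝ^m × 𝕋^n`, a point being `(y, z)`. -/
abbrev Wg (m n : ℕ) := (Fin m → ℝ) × Torus n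

/-- The configuration space `(ℝ^m × 𝕋^n)^N` of `N` particles. -/
abbrev Cfg (m n N : ℕ) := Fin N → Wg m n

/-- `L²_x = L²((ℝ^m × 𝕋^n)^N)`. -/
abbrev L2 (m n N : ℕ) := Lp ℂ 2 (volume : Measure (Cfg m n N))

/-- The unfolded (periodic) configuration space `(ℝ^m × ℝ^n)^N`. -/
abbrev CfgE (m n N : ℕ) := Fin N → ((Fin m → ℝ) × (Fin n → ℝ))

/-- Projection of the unfolded configuration space onto `(ℝ^m × 𝕋^n)^N`. -/
def fold (m n N : ℕ) : CfgE m n N → Cfg m n N :=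
  fun x α => ((x α).1, fun j => (((x α).2 j : ℝ) : AddCircle (1:ℝ)))

/-- The canonical lift of a configuration, using representatives in `[0,1)`. -/
def liftCfg (m n N : ℕ) : Cfg m n N → CfgE m n N :=
  fun x α => ((x α).1, fun j => (AddCircle.equivIco 1 0 ((x α).2 j)).1)

/-- Second directional derivative of `f` at `x` in direction `v`. -/
def secondDeriv {E F : Type*} [NormedAddCommGroup E] [NormedSpace ℝ E]
    [NormedAddCommGroup F] [NormedSpace ℝ F] (f : E → F) (x v : E) : F :=
  fderiv ℝ (fun y => fderiv ℝ f y v) x v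

/-- Coordinate vector in the Euclidean direction `i` of particle `α`. -/
def eY (m n N : ℕ) (α : Fin N) (i : Fin m) : CfgE m n N :=
  Pi.single α (Pi.single i (1:ℝ), 0)

/-- Coordinate vector in the periodic direction `j` of particle `α`. -/
def eZ (m n N : ℕ) (α : Fin N) (j : Fin n) : CfgE m n N :=
  Pi.single α (0, Pi.single j (1:ℝ))

/-- The Laplacian `Δ_x = ∑_α Δ_{x_α}` on the unfolded configuration space. -/
def laplacianE (m n N : ℕ) (f : CfgE m n N → ℂ) (x : CfgE m n N) : ℂ :=
  ∑ α : Fin N, ((∑ i : Fin m, secondDeriv f x (eY m n N α i)) +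
    (∑ j : Fin n, secondDeriv f x (eZ m n N α j)))

/-- The Laplacian `Δ_x` on `(ℝ^m × 𝕋^n)^N`, computed on the periodic unfolding. -/
def lap (m n N : ℕ) (φ : Cfg m n N → ℂ) : Cfg m n N → ℂ :=
  fun x => laplacianE m n N (φ ∘ fold m n N) (liftCfg m n N x)

/-- Test functions on `(ℝ^m × 𝕋^n)^N`: smooth (periodically unfolded) and
compactly supported. -/
def IsTest (m n N : ℕ) (φ : Cfg m n N → ℂ) : Prop :=
  ContDiff ℝ (⊤ : ℕ∞) (φ ∘ fold m n N) ∧ HasCompactSupport φ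

/-- `U` is the propagator `e^{-itH}` of `i∂_t u + H u = 0`, `H = Δ_x - W`, i.e.
a unitary group solving the equation in the weak (distributional) sense. -/
structure IsPropagator (m n N : ℕ) (W : Cfg m n N → ℝ)
    (U : ℝ → L2 m n N →L[ℂ] L2 m n N) : Prop where
  unitary : ∀ (t : ℝ) (f : L2 m n N), ‖U t f‖ = ‖f‖
  init : U 0 = ContinuousLinearMap.id ℂ (L2 m n N)
  group : ∀ s t : ℝ, U (s + t) = (U s).comp (U t)
  weak : ∀ (u0 : L2 m n N) (φ : Cfg m n N → ℂ), IsTest m n N φ → ∀ t : ℝ,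
    HasDerivAt (fun s : ℝ => ∫ x : Cfg m n N, φ x * (U s u0) x)
      (Complex.I * ∫ x : Cfg m n N,
        (lap m n N φ x - (W x : ℂ) * φ x) * (U t u0) x) t

/-- The total interaction potential `∑_{α<β} V(x_α - x_β)`. -/
def pairPot (m n N : ℕ) (V : Wg m n → ℝ) : Cfg m n N → ℝ :=
  fun x => ∑ p ∈ Finset.univ.filter (fun p : Fin N × Fin N => p.1 < p.2),
    V (x p.1 - x p.2)

/-- The `L^p` functional (`p = ∞` included) of an `ℝ≥0∞`-valued function. -/
def eN {α : Type*} [MeasurableSpace α] (p : ℝ≥0∞) (μ : Measure α)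
    (f : α → ℝ≥0∞) : ℝ≥0∞ :=
  if p = ∞ then essSup f μ else (∫⁻ a, f a ^ p.toReal ∂μ) ^ (1 / p.toReal)

/-- The decreasing rearrangement of an `ℝ≥0∞`-valued function. -/
def rearr {α : Type*} [MeasurableSpace α] (μ : Measure α) (f : α → ℝ≥0∞)
    (t : ℝ≥0∞) : ℝ≥0∞ :=
  sInf {lam : ℝ≥0∞ | μ {x | lam < f x} ≤ t}

/-- The Lorentz `L^{r,s}` (quasi-)norm of an `ℝ≥0∞`-valued function. -/
def lorentz {α : Type*} [MeasurableSpace α] (r s : ℝ≥0∞) (μ : Measure α)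
    (f : α → ℝ≥0∞) : ℝ≥0∞ :=
  if s = ∞ then ⨆ t : ℝ≥0∞, t ^ (1 / r.toReal) * rearr μ f t
  else (∫⁻ t in Set.Ioi (0:ℝ),
      (ENNReal.ofReal t ^ (1 / r.toReal) * rearr μ f (ENNReal.ofReal t)) ^ s.toReal /
        ENNReal.ofReal t) ^ (1 / s.toReal)

/-- `‖V‖_{L^{r,∞}_y L^2_z}` of a potential `V` on `ℝ^m × 𝕋^n`. -/
def potNorm (m n : ℕ) (r : ℝ≥0∞) (V : Wg m n → ℝ) : ℝ≥0∞ :=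
  lorentz r ∞ volume (fun y : Fin m → ℝ =>
    eLpNorm (fun z : Torus n => V (y, z)) 2 volume)

/-- The space of the remaining `N-1` particles `x̂_α`. -/
abbrev Hat (m n N : ℕ) (α : Fin N) := {β : Fin N // β ≠ α} → Wg m n

/-- Reassembling a configuration from the `α`-th particle and the others. -/
def glue (m n N : ℕ) (α : Fin N) (w : Wg m n) (h : Hat m n N α) : Cfg m n N :=
  fun β => if hβ : β = α then w else h ⟨β, hβ⟩

/-- The mixed norm `L^q_t L^{r,s}_{y_α} L^2_{z_α} L^2_{x̂_α}` (Lorentz in `y_α`). -/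
def frozenNormL {m n N : ℕ} (q r s : ℝ≥0∞) (α : Fin N)
    (u : ℝ → Cfg m n N → ℂ) : ℝ≥0∞ :=
  eN q volume fun t =>
    lorentz r s volume fun yα : Fin m → ℝ =>
      eN 2 volume fun zα : Torus n =>
        eLpNorm (fun h : Hat m n N α => u t (glue m n N α (yα, zα) h)) 2 volume

/-- The mixed norm `L^q_t L^r_{y_α} L^2_{z_α} L^2_{x̂_α}`. -/
def frozenNorm {m n N : ℕ} (q r : ℝ≥0∞) (α : Fin N)
    (u : ℝ → Cfg m n N → ℂ) : ℝ≥0∞ :=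
  eN q volume fun t =>
    eN r volume fun yα : Fin m → ℝ =>
      eN 2 volume fun zα : Torus n =>
        eLpNorm (fun h : Hat m n N α => u t (glue m n N α (yα, zα) h)) 2 volume

/-- The spatial mixed norm `L^r_{y_α} L^2_{z_α} L^2_{x̂_α}`. -/
def frozenSpatial {m n N : ℕ} (r : ℝ≥0∞) (α : Fin N)
    (u : Cfg m n N → ℂ) : ℝ≥0∞ :=
  eN r volume fun yα : Fin m → ℝ =>
    eN 2 volume fun zα : Torus n =>
      eLpNorm (fun h : Hat m n N α => u (glue m n N α (yα, zα) h)) 2 volume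

/-- The mixed norm `L^q_t L^r_y L^2_z`, `y ∈ ℝ^{mN}` and `z ∈ 𝕋^{nN}` being the
full Euclidean resp. torus variables. -/
def fullNorm {m n N : ℕ} (q r : ℝ≥0∞) (u : ℝ → Cfg m n N → ℂ) : ℝ≥0∞ :=
  eN q volume fun t =>
    eN r volume fun Y : Fin N → Fin m → ℝ =>
      eLpNorm (fun Z : Fin N → Torus n => u t (fun β => (Y β, Z β))) 2 volume

/-- `(q, r)` is a `k`-dimensional (Strichartz) admissible pair. -/
def Admissible (k : ℕ) (q r : ℝ≥0∞) : Prop :=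
  2 ≤ q ∧ 2 ≤ r ∧ 2 / q + (k : ℝ≥0∞) / r = (k : ℝ≥0∞) / 2 ∧
    ¬(q = 2 ∧ r = ∞ ∧ k = 2)

/-- The Koch–Tataru `V^p`-norm of a curve `u : ℝ → L²_x`, adapted to the free
propagator `U0 = e^{itΔ_x}`: the supremum over all finite increasing sequences
`t_0 < ⋯ < t_J` of `(∑_j ‖e^{-it_jΔ}u(t_j) - e^{-it_{j-1}Δ}u(t_{j-1})‖^p)^{1/p}`. -/
def vpNorm {m n N : ℕ} (p : ℝ) (U0 : ℝ → L2 m n N →L[ℂ] L2 m n N)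
    (u : ℝ → L2 m n N) : ℝ≥0∞ :=
  ⨆ (J : ℕ) (t : Fin (J + 1) → ℝ) (_ : StrictMono t),
    (∑ j : Fin J,
      (‖U0 (-(t j.succ)) (u (t j.succ)) -
        U0 (-(t j.castSucc)) (u (t j.castSucc))‖₊ : ℝ≥0∞) ^ p) ^ (1 / p)

/-- The Duhamel (retarded) integral `∫_0^t U(t-s) F(s) ds`, as a space-time
function. -/
def duhamel {m n N : ℕ} (U0 : ℝ → L2 m n N →L[ℂ] L2 m n N)
    (F : ℝ → L2 m n N) : ℝ → Cfg m n N → ℂ :=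
  fun t x => (∫ s in (0:ℝ)..t, U0 (t - s) (F s)) x

end ManyBodyWaveguide

namespace ManyBodyWaveguide

lemma mul_le_sq_add_sq (a b : ℝ≥0∞) : a * b ≤ a ^ 2 + b ^ 2 := by
  rcases le_total a b with h | h
  · calc a * b ≤ b * b := by gcongr
      _ = b ^ 2 := by ring
      _ ≤ _ := le_add_self
  · calc a * b ≤ a * a := by gcongr
      _ = a ^ 2 := by ring
      _ ≤ _ := le_self_add

lemma two_rpow_add (x y : ℝ) : (2:ℝ≥0∞) ^ (x + y) = 2 ^ x * 2 ^ y :=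
  ENNReal.rpow_add x y (by norm_num) (by norm_num)

lemma two_rpow_ne_top (x : ℝ) : (2:ℝ≥0∞) ^ x ≠ ∞ :=
  ENNReal.rpow_ne_top_of_ne_zero (by norm_num) (by norm_num)

lemma two_rpow_ne_zero (x : ℝ) : (2:ℝ≥0∞) ^ x ≠ 0 := by
  simp [ENNReal.rpow_eq_zero_iff]

lemma two_rpow_eq_ofReal (x : ℝ) : (2:ℝ≥0∞) ^ x = ENNReal.ofReal ((2:ℝ) ^ x) := by
  rw [← ENNReal.ofReal_rpow_of_pos (by norm_num)]; norm_num

lemma two_rpow_mono {x y : ℝ} (h : x ≤ y) : (2:ℝ≥0∞) ^ x ≤ 2 ^ y :=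
  ENNReal.rpow_le_rpow_of_exponent_le (by norm_num) h

/-- Uniform bound for two-sided geometric sums. -/
lemma geom_sum_bound (ε : ℝ) (hε : 0 < ε) :
    ∃ C : ℝ≥0∞, C ≠ ∞ ∧ ∀ x : ℝ, ∑' j : ℤ, (2:ℝ≥0∞) ^ (-|ε * j - x|) ≤ C := by
  have hs : Summable (fun j : ℤ => (2:ℝ) ^ (-(ε * |(j:ℝ)|))) := by
    have h0 : Summable (fun n : ℕ => ((2:ℝ) ^ (-ε)) ^ n) :=
      summable_geometric_of_lt_one (by positivity)
        (Real.rpow_lt_one_of_one_lt_of_neg (by norm_num) (by linarith))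
    have h1 : (fun n : ℕ => ((2:ℝ) ^ (-ε)) ^ n) = fun n : ℕ => (2:ℝ) ^ (-(ε * |(n:ℝ)|)) := by
      ext n
      rw [← Real.rpow_natCast, ← Real.rpow_mul (by norm_num)]
      congr 1
      rw [abs_of_nonneg (by positivity)]; ring
    rw [h1] at h0
    apply Summable.of_nat_of_neg
    · simpa using h0
    · simpa using h0
  refine ⟨2 ^ ε * ∑' j : ℤ, (2:ℝ≥0∞) ^ (-(ε * |(j:ℝ)|)), ?_, ?_⟩
  · apply ENNReal.mul_ne_top (two_rpow_ne_top _)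
    simp_rw [two_rpow_eq_ofReal]
    rw [← ENNReal.ofReal_tsum_of_nonneg (fun _ => by positivity) hs]
    exact ENNReal.ofReal_ne_top
  · intro x
    set a : ℤ := ⌊x / ε⌋ with ha
    rw [← (Equiv.addRight a).tsum_eq (fun j : ℤ => (2:ℝ≥0∞) ^ (-|ε * j - x|)),
      ← ENNReal.tsum_mul_left]
    apply ENNReal.tsum_le_tsum
    intro j
    rw [← two_rpow_add]
    apply two_rpow_mono
    have h1 : (a:ℝ) ≤ x / ε := Int.floor_le _
    have h2 : x / ε < a + 1 := Int.lt_floor_add_one _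
    rw [le_div_iff₀ hε] at h1
    rw [div_lt_iff₀ hε] at h2
    simp only [Equiv.coe_addRight, Int.cast_add]
    have h3 : ε * |(j:ℝ)| = |ε * j| := by rw [abs_mul, abs_of_pos hε]
    have h4 : |ε * (j:ℝ)| ≤ |ε * (j + a) - x| + |x - ε * a| := by
      have := abs_add_le (ε * ((j:ℝ) + a) - x) (x - ε * a)
      have e : ε * ((j:ℝ) + a) - x + (x - ε * a) = ε * j := by ring
      rwa [e] at this
    have h5 : |x - ε * a| ≤ ε := by rw [abs_le]; constructor <;> nlinarith
    linarith

lemma lintegral_rpow_Ioo (b x : ℝ) (hb : b < 1) (hx : 0 ≤ x) :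
    ∫⁻ t in Set.Ioo (0:ℝ) x, ENNReal.ofReal (t ^ (-b)) = ENNReal.ofReal (x ^ (1 - b) / (1 - b)) := by
  have hi : IntervalIntegrable (fun t : ℝ => t ^ (-b)) volume 0 x :=
    intervalIntegral.intervalIntegrable_rpow' (by linarith)
  rw [intervalIntegrable_iff_integrableOn_Ioo_of_le hx] at hi
  rw [← ofReal_integral_eq_lintegral_ofReal hi]
  · rw [← integral_Ioc_eq_integral_Ioo, ← intervalIntegral.integral_of_le hx,
      integral_rpow (Or.inl (by linarith))]
    rw [Real.zero_rpow (by linarith)]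
    congr 2 <;> ring_nf
  · filter_upwards [ae_restrict_mem measurableSet_Ioo] with t ht
    exact Real.rpow_nonneg ht.1.le _

lemma lintegral_even (f : ℝ → ℝ≥0∞) (R : ℝ) (hR : 0 ≤ R) :
    ∫⁻ t in Set.Ioo (-R) R, f |t| ≤ 2 * ∫⁻ t in Set.Ioo 0 R, f t := by
  have hsub : Set.Ioo (-R) R ⊆ Set.Ioo (-R) 0 ∪ ({0} ∪ Set.Ioo 0 R) := by
    intro t ht
    rcases lt_trichotomy t 0 with h | h | h
    · left; exact ⟨ht.1, h⟩
    · right; left; exact h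
    · right; right; exact ⟨h, ht.2⟩
  have h1 : ∫⁻ t in Set.Ioo 0 R, f |t| = ∫⁻ t in Set.Ioo 0 R, f t :=
    setLIntegral_congr_fun measurableSet_Ioo (fun t ht => by simp [abs_of_pos ht.1])
  have h2 : ∫⁻ t in Set.Ioo (-R) 0, f |t| = ∫⁻ t in Set.Ioo 0 R, f t := by
    rw [← h1]
    have := (Measure.measurePreserving_neg (volume : Measure ℝ)).setLIntegral_comp_emb
      (MeasurableEquiv.neg ℝ).measurableEmbedding (fun t => f |t|) (Set.Ioo 0 R)
    have e := (Measure.measurePreserving_neg (volume : Measure ℝ)).setLIntegral_comp_preimage_emb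
      (MeasurableEquiv.neg ℝ).measurableEmbedding (fun t => f |t|) (Set.Ioo 0 R)
    simpa using e
  calc _ ≤ ∫⁻ t in Set.Ioo (-R) 0 ∪ ({0} ∪ Set.Ioo 0 R), f |t| := lintegral_mono_set hsub
    _ ≤ _ := lintegral_union_le _ _ _
    _ ≤ (∫⁻ t in Set.Ioo (-R) 0, f |t|) + ((∫⁻ t in {0}, f |t|) + ∫⁻ t in Set.Ioo 0 R, f |t|) := by
      gcongr; exact lintegral_union_le _ _ _
    _ = _ := by
      have h3 : ∫⁻ t in ({0} : Set ℝ), f |t| = 0 := setLIntegral_measure_zero _ _ (by simp)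
      rw [h1, h2, h3]; ring

/-- Riesz kernel integrated over a set of measure at most `R`. -/
lemma riesz_set_bound (γ : ℝ) (h0 : 0 < γ) (h1 : γ < 1) (R : ℝ) (hR : 0 < R) (E : Set ℝ)
    (hE : MeasurableSet E) (hEm : volume E ≤ ENNReal.ofReal R) (t : ℝ) :
    ∫⁻ s in E, ENNReal.ofReal |t - s| ^ (-γ) ≤
      ENNReal.ofReal ((2 / (1 - γ) + 1) * R ^ (1 - γ)) := by
  have hA : ∫⁻ s in Set.Ioo (t - R) (t + R), ENNReal.ofReal |t - s| ^ (-γ) ≤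
      2 * ENNReal.ofReal (R ^ (1 - γ) / (1 - γ)) := by
    rw [← lintegral_rpow_Ioo γ R h1 hR.le]
    have e := (Measure.measurePreserving_sub_left (volume : Measure ℝ) t).setLIntegral_comp_preimage_emb
      (MeasurableEquiv.subLeft t).measurableEmbedding (fun u => ENNReal.ofReal |u| ^ (-γ))
      (Set.Ioo (-R) R)
    have e2 : (fun x => t - x) ⁻¹' Set.Ioo (-R) R = Set.Ioo (t - R) (t + R) := by
      ext x; simp only [Set.mem_preimage, Set.mem_Ioo]; constructor <;> rintro ⟨_, _⟩ <;> constructor <;> linarith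
    rw [e2] at e
    rw [e]
    refine (lintegral_even (fun u => ENNReal.ofReal u ^ (-γ)) R hR.le).trans ?_
    gcongr 2 * ?_
    apply le_of_eq
    apply setLIntegral_congr_fun measurableSet_Ioo
    intro u hu
    simp only
    rw [ENNReal.ofReal_rpow_of_pos hu.1]
  have hB : ∫⁻ s in E \ Set.Ioo (t - R) (t + R), ENNReal.ofReal |t - s| ^ (-γ) ≤
      ENNReal.ofReal (R ^ (1 - γ)) := by
    calc _ ≤ ∫⁻ s in E \ Set.Ioo (t - R) (t + R), ENNReal.ofReal R ^ (-γ) := by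
          apply setLIntegral_mono' (hE.diff measurableSet_Ioo)
          intro s hs
          rw [ENNReal.rpow_neg, ENNReal.rpow_neg]
          apply ENNReal.inv_le_inv.mpr
          apply ENNReal.rpow_le_rpow _ h0.le
          apply ENNReal.ofReal_le_ofReal
          have := hs.2
          simp only [Set.mem_Ioo, not_and, not_lt] at this
          by_contra hcon
          push Not at hcon
          rw [abs_lt] at hcon
          have := this (by linarith)
          linarith
      _ = ENNReal.ofReal R ^ (-γ) * volume (E \ Set.Ioo (t - R) (t + R)) := by
          rw [lintegral_const, Measure.restrict_apply_univ]
      _ ≤ ENNReal.ofReal R ^ (-γ) * ENNReal.ofReal R := by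
          gcongr
          exact (measure_mono Set.sdiff_subset).trans hEm
      _ = _ := by
          rw [ENNReal.ofReal_rpow_of_pos hR, ← ENNReal.ofReal_mul (by positivity)]
          congr 1
          rw [← Real.rpow_add_one hR.ne']; ring_nf
  calc _ ≤ ∫⁻ s in Set.Ioo (t - R) (t + R) ∪ (E \ Set.Ioo (t - R) (t + R)),
        ENNReal.ofReal |t - s| ^ (-γ) := lintegral_mono_set (by
          intro x hx; by_cases h : x ∈ Set.Ioo (t - R) (t + R)
          · exact Or.inl h
          · exact Or.inr ⟨hx, h⟩)
    _ ≤ _ := lintegral_union_le _ _ _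
    _ ≤ 2 * ENNReal.ofReal (R ^ (1 - γ) / (1 - γ)) + ENNReal.ofReal (R ^ (1 - γ)) := add_le_add hA hB
    _ = _ := by
      rw [show (2:ℝ≥0∞) = ENNReal.ofReal 2 by norm_num, ← ENNReal.ofReal_mul (by norm_num),
        ← ENNReal.ofReal_add]
      · congr 1; ring
      · have : 0 < 1 - γ := by linarith
        positivity
      · positivity

end ManyBodyWaveguide

namespace ManyBodyWaveguide

/-- Layer cake for the minimum. -/
lemma min_layer (a : ℝ≥0∞) (x : ℝ) (ha : a ≤ ENNReal.ofReal x) :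
    a ≤ ∫⁻ l in Set.Ioo (0:ℝ) x, Set.indicator {l : ℝ | ENNReal.ofReal l < a} 1 l := by
  have haf : a ≠ ∞ := ne_top_of_le_ne_top ENNReal.ofReal_ne_top ha
  have hm : MeasurableSet {l : ℝ | ENNReal.ofReal l < a} :=
    measurableSet_lt (by fun_prop) measurable_const
  rw [lintegral_indicator_one hm, Measure.restrict_apply hm]
  calc a = volume (Set.Ioo 0 a.toReal) := by simp [haf]
    _ ≤ _ := by
      apply measure_mono
      intro l hl
      have h1 : ENNReal.ofReal l < a := by
        rw [ENNReal.ofReal_lt_iff_lt_toReal hl.1.le haf]; exact hl.2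
      refine ⟨h1, hl.1, ?_⟩
      have := h1.trans_le ha
      exact (ENNReal.ofReal_lt_ofReal_iff_of_nonneg hl.1.le).1 this

/-- Hardy–Littlewood–Sobolev (diagonal, one dimensional). -/
lemma hls (γ : ℝ) (h0 : 0 < γ) (h1 : γ < 1) (p : ℝ) (hp : p = 2 / (2 - γ)) :
    ∃ C : ℝ≥0∞, C ≠ ∞ ∧ ∀ f : ℝ → ℝ≥0∞, Measurable f →
      ∫⁻ t, ∫⁻ s, f s * f t * ENNReal.ofReal |t - s| ^ (-γ) ≤ C * (∫⁻ t, f t ^ p) ^ (2 / p) := by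
  have hp1 : 1 < p := by rw [hp, lt_div_iff₀] <;> linarith
  have hpp : p * (2 - γ) = 2 := by rw [hp]; field_simp [show (2 - γ) ≠ 0 by linarith]
  have h2p : 2 / p = 1 + (1 - γ) := by
    rw [div_eq_iff (by positivity)]; linarith
  set b := p * (1 - γ) with hb
  have hb1 : b < 1 := by nlinarith
  have hbp : 1 - b = p - 1 := by rw [hb]; linarith
  set c : ℝ := 2 / (1 - γ) + 1
  have hc : 0 < c := by have : 0 < 1 - γ := by linarith
                        positivity
  set C0 : ℝ := c / (1 - b)
  refine ⟨2 * ENNReal.ofReal C0, ENNReal.mul_ne_top (by simp) ENNReal.ofReal_ne_top, ?_⟩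
  intro f hf
  set M := ∫⁻ t, f t ^ p with hM
  have hk : Measurable (fun x : ℝ × ℝ => ENNReal.ofReal |x.1 - x.2| ^ (-γ)) := by fun_prop
  have hfk : Measurable (fun x : ℝ × ℝ => f x.2 * f x.1 * ENNReal.ofReal |x.1 - x.2| ^ (-γ)) := by
    fun_prop
  by_cases hM0 : M = 0
  · have : ∀ᵐ t, f t = 0 := by
      rw [hM, lintegral_eq_zero_iff (by fun_prop)] at hM0
      filter_upwards [hM0] with t ht
      simpa [ENNReal.rpow_eq_zero_iff, hp1.le, not_lt, (by linarith : 0 < p), (by linarith : ¬ p < 0)] using ht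
    have h : ∫⁻ t, ∫⁻ s, f s * f t * ENNReal.ofReal |t - s| ^ (-γ) = 0 := by
      rw [lintegral_eq_zero_iff (hfk.lintegral_prod_right')]
      filter_upwards [this] with t ht
      simp [ht]
    rw [h]; exact zero_le
  by_cases hMt : M = ∞
  · rw [hMt, ENNReal.top_rpow_of_pos (by positivity), ENNReal.mul_top]
    · exact le_top
    · simp only [ne_eq, mul_eq_zero, ENNReal.ofReal_eq_zero, not_or, not_le]
      refine ⟨by norm_num, div_pos hc (by linarith)⟩
  set μ := M.toReal with hμ
  have hμ0 : 0 < μ := ENNReal.toReal_pos hM0 hMt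
  have hMμ : M = ENNReal.ofReal μ := (ENNReal.ofReal_toReal hMt).symm
  -- Chebyshev
  have hcheb : ∀ l : ℝ, 0 < l → volume {s | ENNReal.ofReal l < f s} ≤ ENNReal.ofReal (l ^ (-p) * μ) := by
    intro l hl
    have h1 := mul_meas_ge_le_lintegral (μ := volume) (f := fun t => f t ^ p) (by fun_prop) (ENNReal.ofReal l ^ p)
    have h2 : volume {s | ENNReal.ofReal l < f s} ≤ volume {s | ENNReal.ofReal l ^ p ≤ f s ^ p} := by
      apply measure_mono; intro s hs
      exact ENNReal.rpow_le_rpow (le_of_lt hs) (by linarith)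
    have h3 : ENNReal.ofReal l ^ p ≠ 0 := by
      simp [ENNReal.rpow_eq_zero_iff, hl, hl.le]
    have h4 : ENNReal.ofReal l ^ p ≠ ∞ := by
      simp [ENNReal.rpow_eq_top_iff, hl]
    calc _ ≤ _ := h2
      _ ≤ M / ENNReal.ofReal l ^ p := by
        rw [ENNReal.le_div_iff_mul_le (Or.inl h3) (Or.inl h4), mul_comm]; exact h1
      _ = _ := by
        rw [hMμ, ENNReal.ofReal_rpow_of_pos hl, ← ENNReal.ofReal_div_of_pos (by positivity),
          Real.rpow_neg hl.le]
        congr 1; field_simp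
  -- inner estimate
  have hinner : ∀ t, ∫⁻ s, (min (f s) (f t)) * ENNReal.ofReal |t - s| ^ (-γ) ≤
      ENNReal.ofReal (C0 * μ ^ (1 - γ)) * f t ^ (p - 1) := by
    intro t
    by_cases hft : f t = ∞
    · rw [hft, ENNReal.top_rpow_of_pos (by linarith), ENNReal.mul_top]
      · exact le_top
      · simp only [ne_eq, ENNReal.ofReal_eq_zero, not_le]
        exact mul_pos (div_pos hc (by linarith)) (by positivity)
    set x := (f t).toReal with hx
    have hx0 : 0 ≤ x := ENNReal.toReal_nonneg
    have hfx : f t = ENNReal.ofReal x := (ENNReal.ofReal_toReal hft).symm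
    have hms : MeasurableSet {q : ℝ × ℝ | ENNReal.ofReal q.2 < f q.1} :=
      measurableSet_lt (by fun_prop) (by fun_prop)
    calc ∫⁻ s, (min (f s) (f t)) * ENNReal.ofReal |t - s| ^ (-γ)
        ≤ ∫⁻ s, (∫⁻ l in Set.Ioo (0:ℝ) x, Set.indicator {l : ℝ | ENNReal.ofReal l < f s} 1 l) *
            ENNReal.ofReal |t - s| ^ (-γ) := by
          apply lintegral_mono; intro s
          dsimp only
          gcongr
          refine (min_layer (min (f s) (f t)) x (by rw [← hfx]; exact min_le_right _ _)).trans ?_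
          apply lintegral_mono
          apply Set.indicator_le_indicator_of_subset
          · intro l hl; exact lt_of_lt_of_le (show ENNReal.ofReal l < min (f s) (f t) from hl) (min_le_left _ _)
          · intro _; exact zero_le
      _ = ∫⁻ s, ∫⁻ l in Set.Ioo (0:ℝ) x, Set.indicator {q : ℝ × ℝ | ENNReal.ofReal q.2 < f q.1} 1 (s, l) *
            ENNReal.ofReal |t - s| ^ (-γ) := by
          apply lintegral_congr; intro s
          rw [lintegral_mul_const]
          · rfl
          · exact (measurable_const.indicator hms).comp (by fun_prop : Measurable (fun l : ℝ => (s, l)))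
      _ = ∫⁻ l in Set.Ioo (0:ℝ) x, ∫⁻ s, Set.indicator {q : ℝ × ℝ | ENNReal.ofReal q.2 < f q.1} 1 (s, l) *
            ENNReal.ofReal |t - s| ^ (-γ) := by
          rw [lintegral_lintegral_swap]
          apply Measurable.aemeasurable
          apply Measurable.mul
          · exact (measurable_const.indicator hms)
          · exact hk.comp (by fun_prop : Measurable (fun q : ℝ × ℝ => (t, q.1)))
      _ = ∫⁻ l in Set.Ioo (0:ℝ) x, ∫⁻ s in {s | ENNReal.ofReal l < f s}, ENNReal.ofReal |t - s| ^ (-γ) := by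
          apply lintegral_congr; intro l
          rw [← lintegral_indicator (measurableSet_lt measurable_const hf)]
          apply lintegral_congr; intro s
          simp only [Set.indicator, Set.mem_ofPred_eq]
          split_ifs <;> simp
      _ ≤ ∫⁻ l in Set.Ioo (0:ℝ) x, ENNReal.ofReal (c * μ ^ (1 - γ)) * ENNReal.ofReal (l ^ (-b)) := by
          apply setLIntegral_mono' measurableSet_Ioo
          intro l hl
          have hl0 : 0 < l := hl.1
          refine (riesz_set_bound γ h0 h1 (l ^ (-p) * μ) (by positivity) _
            (measurableSet_lt measurable_const hf) (hcheb l hl.1) t).trans (le_of_eq ?_)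
          rw [← ENNReal.ofReal_mul (by positivity)]
          congr 1
          rw [Real.mul_rpow (by positivity) hμ0.le, ← Real.rpow_mul hl.1.le, hb]
          rw [show -p * (1 - γ) = -(p * (1 - γ)) by ring]; ring
      _ = _ := by
          rw [lintegral_const_mul _ (by fun_prop), lintegral_rpow_Ioo b x hb1 hx0, hfx,
            ENNReal.ofReal_rpow_of_nonneg hx0 (by linarith), ← ENNReal.ofReal_mul (by positivity),
            ← ENNReal.ofReal_mul (by have : 0 < 1 - b := by linarith
                                     positivity)]
          congr 1
          rw [hbp]; simp only [C0, hbp]; ring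
  have hle : ∀ s t, f s * f t ≤ min (f s) (f t) * f t + min (f t) (f s) * f s := by
    intro s t
    rcases le_total (f s) (f t) with h | h
    · rw [min_eq_left h]; exact le_self_add
    · rw [min_eq_left h, mul_comm (f s)]; exact le_add_self
  have hG : Measurable (fun x : ℝ × ℝ => min (f x.2) (f x.1) * f x.1 * ENNReal.ofReal |x.1 - x.2| ^ (-γ)) := by
    fun_prop
  have hG2 : Measurable (fun x : ℝ × ℝ => min (f x.1) (f x.2) * f x.2 * ENNReal.ofReal |x.1 - x.2| ^ (-γ)) := by
    fun_prop
  have hpart : ∫⁻ t, ∫⁻ s, min (f s) (f t) * f t * ENNReal.ofReal |t - s| ^ (-γ) ≤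
      ENNReal.ofReal C0 * M ^ (2 / p) := by
    calc _ = ∫⁻ t, f t * ∫⁻ s, min (f s) (f t) * ENNReal.ofReal |t - s| ^ (-γ) := by
          apply lintegral_congr; intro t
          rw [← lintegral_const_mul _ (by fun_prop)]
          apply lintegral_congr; intro s; ring
      _ ≤ ∫⁻ t, f t * (ENNReal.ofReal (C0 * μ ^ (1 - γ)) * f t ^ (p - 1)) := by
          gcongr with t; exact hinner t
      _ = ∫⁻ t, ENNReal.ofReal (C0 * μ ^ (1 - γ)) * f t ^ p := by
          apply lintegral_congr; intro t
          have : f t ^ p = f t * f t ^ (p - 1) := by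
            conv_rhs => rw [← ENNReal.rpow_one (f t), ← ENNReal.rpow_mul, one_mul]
            rw [← ENNReal.rpow_add_of_nonneg _ _ (by norm_num) (by linarith)]
            congr 1; ring
          rw [this]; ring
      _ = _ := by
          rw [lintegral_const_mul _ (by fun_prop), ← hM, h2p, hMμ,
            ENNReal.ofReal_rpow_of_pos hμ0, ← ENNReal.ofReal_mul, ← ENNReal.ofReal_mul]
          · congr 1
            rw [Real.rpow_add hμ0, Real.rpow_one]; ring
          · exact div_nonneg hc.le (by linarith)
          · exact mul_nonneg (div_nonneg hc.le (by linarith)) (by positivity)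
  calc _ ≤ ∫⁻ t, ∫⁻ s, (min (f s) (f t) * f t * ENNReal.ofReal |t - s| ^ (-γ) +
          min (f t) (f s) * f s * ENNReal.ofReal |t - s| ^ (-γ)) := by
        gcongr with t s
        rw [← add_mul]; gcongr; exact hle s t
    _ = (∫⁻ t, ∫⁻ s, min (f s) (f t) * f t * ENNReal.ofReal |t - s| ^ (-γ)) +
        ∫⁻ t, ∫⁻ s, min (f t) (f s) * f s * ENNReal.ofReal |t - s| ^ (-γ) := by
        rw [← lintegral_add_left (hG.lintegral_prod_right')]
        apply lintegral_congr; intro t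
        rw [lintegral_add_left]
        exact hG.comp (by fun_prop : Measurable (fun s : ℝ => (t, s)))
    _ = (∫⁻ t, ∫⁻ s, min (f s) (f t) * f t * ENNReal.ofReal |t - s| ^ (-γ)) +
        ∫⁻ t, ∫⁻ s, min (f s) (f t) * f t * ENNReal.ofReal |t - s| ^ (-γ) := by
        congr 1
        rw [lintegral_lintegral_swap hG2.aemeasurable]
        apply lintegral_congr; intro t; apply lintegral_congr; intro s
        rw [abs_sub_comm]
    _ ≤ _ := by
        rw [mul_assoc, two_mul]; exact add_le_add hpart hpart

end ManyBodyWaveguide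

namespace ManyBodyWaveguide

/-- The basic kernel `min(1, |τ|^{-m/2} 2^{j/2})`. -/
def kap (m : ℝ) (τ j : ℝ) : ℝ≥0∞ := min 1 (ENNReal.ofReal |τ| ^ (-(m / 2)) * 2 ^ (j / 2))

lemma kap_meas (m j : ℝ) : Measurable (fun τ => kap m τ j) := by
  unfold kap; fun_prop

lemma kap_le_one (m τ j : ℝ) : kap m τ j ≤ 1 := min_le_left _ _

lemma kap_neg (m τ j : ℝ) : kap m (-τ) j = kap m τ j := by simp [kap]

lemma kap_sub_comm (m s t j : ℝ) : kap m (s - t) j = kap m (t - s) j := by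
  rw [← kap_neg, neg_sub]

/-- `L¹` norm of the kernel. -/
lemma kap_lintegral (m : ℝ) (hm : 3 ≤ m) (l : ℝ) :
    ∫⁻ τ, kap m τ (2 * l) ≤ 6 * 2 ^ (2 * l / m) := by
  set R : ℝ := (2:ℝ) ^ (2 * l / m) with hR
  have hR0 : 0 < R := by positivity
  have hm2 : 0 < m / 2 - 1 := by linarith
  have hhalf : ∫⁻ τ in Set.Ioi R, kap m τ (2 * l) ≤ 2 * ENNReal.ofReal R := by
    have hIntg := integrableOn_Ioi_rpow_of_lt (a := -(m/2)) (by linarith) hR0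
    calc _ ≤ ∫⁻ τ in Set.Ioi R, ENNReal.ofReal (τ ^ (-(m/2))) * ENNReal.ofReal ((2:ℝ) ^ l) := by
          apply setLIntegral_mono' measurableSet_Ioi
          intro τ hτ
          have hτ0 : 0 < τ := hR0.trans hτ
          refine (min_le_right _ _).trans (le_of_eq ?_)
          rw [abs_of_pos hτ0, ENNReal.ofReal_rpow_of_pos hτ0, two_rpow_eq_ofReal]
          congr 4; ring
      _ = ENNReal.ofReal (R / (m/2 - 1)) := by
          rw [lintegral_mul_const _ (by fun_prop), ← ofReal_integral_eq_lintegral_ofReal hIntg,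
            integral_Ioi_rpow_of_lt (by linarith) hR0, ← ENNReal.ofReal_mul]
          · congr 1
            have e : R ^ (-(m/2) + 1) = R * ((2:ℝ) ^ l)⁻¹ := by
              rw [Real.rpow_add hR0, Real.rpow_one, mul_comm, hR, ← Real.rpow_mul (by norm_num),
                ← Real.rpow_neg (by norm_num)]
              congr 2; field_simp
            rw [e]
            have : (2:ℝ)^l ≠ 0 := by positivity
            have h3 : -(m/2) + 1 ≠ 0 := by linarith
            have h4 : m/2 - 1 ≠ 0 := by linarith
            rw [show -(m/2) + 1 = -(m/2 - 1) by ring, neg_div_neg_eq]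
            field_simp
          · rw [neg_div, ← div_neg]; apply div_nonneg (by positivity) (by linarith)
          · filter_upwards [ae_restrict_mem measurableSet_Ioi] with τ hτ
            exact Real.rpow_nonneg (hR0.trans hτ).le _
      _ ≤ ENNReal.ofReal (2 * R) := by
          apply ENNReal.ofReal_le_ofReal
          rw [div_le_iff₀ hm2]; nlinarith
      _ = _ := by rw [ENNReal.ofReal_mul (by norm_num)]; norm_num
  have hneg : ∫⁻ τ in Set.Iio (-R), kap m τ (2 * l) = ∫⁻ τ in Set.Ioi R, kap m τ (2 * l) := by
    have e := (Measure.measurePreserving_neg (volume : Measure ℝ)).setLIntegral_comp_preimage_emb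
      (MeasurableEquiv.neg ℝ).measurableEmbedding (fun t => kap m t (2 * l)) (Set.Ioi R)
    simpa [kap_neg] using e
  have hmid : ∫⁻ τ in Set.Icc (-R) R, kap m τ (2 * l) ≤ 2 * ENNReal.ofReal R := by
    calc _ ≤ ∫⁻ τ in Set.Icc (-R) R, 1 := by gcongr; exact kap_le_one _ _ _
      _ = _ := by
        rw [lintegral_const, Measure.restrict_apply_univ, Real.volume_Icc, one_mul,
          show R - -R = 2 * R by ring, ENNReal.ofReal_mul (by norm_num)]; norm_num
  calc ∫⁻ τ, kap m τ (2 * l) = ∫⁻ τ in Set.Iio (-R) ∪ (Set.Icc (-R) R ∪ Set.Ioi R), kap m τ (2 * l) := by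
        have : Set.Iio (-R) ∪ (Set.Icc (-R) R ∪ Set.Ioi R) = Set.univ := by
          ext x; simp only [Set.mem_union, Set.mem_Iio, Set.mem_Icc, Set.mem_Ioi, Set.mem_univ, iff_true]
          by_cases h1 : x < -R
          · exact Or.inl h1
          · by_cases h2 : R < x
            · exact Or.inr (Or.inr h2)
            · exact Or.inr (Or.inl ⟨by linarith, by linarith⟩)
        rw [this, Measure.restrict_univ]
    _ ≤ _ := lintegral_union_le _ _ _
    _ ≤ (∫⁻ τ in Set.Iio (-R), kap m τ (2 * l)) + ((∫⁻ τ in Set.Icc (-R) R, kap m τ (2 * l)) +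
          ∫⁻ τ in Set.Ioi R, kap m τ (2 * l)) := by gcongr; exact lintegral_union_le _ _ _
    _ ≤ 2 * ENNReal.ofReal R + (2 * ENNReal.ofReal R + 2 * ENNReal.ofReal R) := by
        rw [hneg]; gcongr
    _ = _ := by rw [two_rpow_eq_ofReal]; ring

/-- Sum of the kernel in the non-endpoint case. -/
lemma kap_sum (m : ℝ) (hm : 3 ≤ m) (δ : ℝ) (h0 : 0 < δ) (h1 : δ < 1 / 2) :
    ∃ C : ℝ≥0∞, C ≠ ∞ ∧ ∀ τ : ℝ, τ ≠ 0 → ∀ x : ℝ,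
      ∑' j : ℤ, (2:ℝ≥0∞) ^ (-(j + x) * δ) * kap m τ (j + x) ≤ C * ENNReal.ofReal |τ| ^ (-(m * δ)) := by
  set ε := min δ (1/2 - δ)
  have hε : 0 < ε := lt_min h0 (by linarith)
  obtain ⟨C, hC, hCb⟩ := geom_sum_bound ε hε
  refine ⟨C, hC, fun τ hτ x => ?_⟩
  have hτ0 : 0 < |τ| := abs_pos.2 hτ
  set y := Real.logb 2 |τ| with hy
  have hτy : ENNReal.ofReal |τ| = 2 ^ y := by
    rw [two_rpow_eq_ofReal, hy, Real.rpow_logb (by norm_num) (by norm_num) hτ0]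
  rw [mul_comm]
  refine le_trans ?_ (mul_le_mul_right (hCb (ε * (m * y - x))) _)
  rw [← ENNReal.tsum_mul_left]
  apply ENNReal.tsum_le_tsum
  intro j
  unfold kap
  rw [hτy, ← ENNReal.rpow_mul, ← ENNReal.rpow_mul, ← two_rpow_add, ← two_rpow_add]
  have e1 : ε * (j:ℝ) - ε * (m * y - x) = ε * (j + x - m * y) := by ring
  rw [e1, abs_mul, abs_of_pos hε]
  set u := (j:ℝ) + x - m * y with hu
  have he1 : ε ≤ δ := min_le_left _ _
  have he2 : ε ≤ 1/2 - δ := min_le_right _ _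
  rcases le_total 0 u with h | h
  · calc _ ≤ (2:ℝ≥0∞) ^ (-(j + x) * δ) * 1 := by gcongr; exact min_le_left _ _
      _ = (2:ℝ≥0∞) ^ (-(j + x) * δ) := mul_one _
      _ ≤ _ := by
        apply two_rpow_mono
        rw [abs_of_nonneg h]
        have : (j:ℝ) + x = u + m * y := by rw [hu]; ring
        rw [this]; nlinarith
  · calc _ ≤ (2:ℝ≥0∞) ^ (-(j + x) * δ) * 2 ^ (y * (-(m/2)) + (j + x) / 2) := by
          gcongr; exact min_le_right _ _
      _ ≤ _ := by
        rw [← two_rpow_add]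
        apply two_rpow_mono
        rw [abs_of_nonpos h]
        have : (j:ℝ) + x = u + m * y := by rw [hu]; ring
        rw [this]; nlinarith

variable {E : Type*} [NormedAddCommGroup E] [InnerProductSpace ℂ E] [CompleteSpace E]

/-- `‖∫ H‖² ≤ ∫∫ |⟨H(s),H(t)⟩|`. -/
lemma sq_norm_integral_le {α : Type*} [MeasurableSpace α] (μ : Measure α)
    (H : α → E) (hH : Integrable H μ) :
    ‖∫ t, H t ∂μ‖ₑ ^ 2 ≤ ∫⁻ t, ∫⁻ s, ‖inner ℂ (H s) (H t)‖ₑ ∂μ ∂μ := by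
  set v := ∫ t, H t ∂μ with hv
  have h1 : ‖v‖ₑ ^ 2 = ‖inner ℂ v v‖ₑ := by
    rw [← ofReal_norm_eq_enorm, ← ofReal_norm_eq_enorm, inner_self_eq_norm_sq_to_K,
      ← ENNReal.ofReal_pow (norm_nonneg _)]
    simp
  rw [h1]
  have h2 : inner ℂ v v = ∫ t, inner ℂ v (H t) ∂μ := by
    conv_lhs => rw [hv]
    rw [← integral_inner hH]
  rw [h2]
  refine (enorm_integral_le_lintegral_enorm _).trans ?_
  apply lintegral_mono
  intro t
  have h3 : ‖inner ℂ v (H t)‖ₑ = ‖inner ℂ (H t) v‖ₑ := by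
    rw [← ofReal_norm_eq_enorm, ← ofReal_norm_eq_enorm, norm_inner_symm]
  have h4 : inner ℂ (H t) v = ∫ s, inner ℂ (H t) (H s) ∂μ := by
    rw [hv, ← integral_inner hH]
  simp only
  rw [h3, h4]
  refine (enorm_integral_le_lintegral_enorm _).trans ?_
  apply lintegral_mono
  intro s
  simp only
  rw [← ofReal_norm_eq_enorm, ← ofReal_norm_eq_enorm, norm_inner_symm]

end ManyBodyWaveguide

namespace ManyBodyWaveguide

/-- Schur test for a Hankel matrix on a finite index set. -/
lemma schur_hankel (M : ℤ → ℝ≥0∞) (S : ℝ≥0∞) (hS : ∀ x : ℤ, ∑' j : ℤ, M (j + x) ≤ S)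
    (K : Finset ℤ) (A B : ℤ → ℝ≥0∞) :
    ∑ k ∈ K, ∑ l ∈ K, M (k + l) * (A k * B l) ≤
      S * ((∑ k ∈ K, A k ^ 2) ^ (1/2:ℝ) * (∑ k ∈ K, B k ^ 2) ^ (1/2:ℝ)) := by
  have key := ENNReal.inner_le_Lp_mul_Lq (K ×ˢ K)
    (fun x => M (x.1 + x.2) ^ (1/2:ℝ) * A x.1) (fun x => M (x.1 + x.2) ^ (1/2:ℝ) * B x.2)
    Real.HolderConjugate.two_two
  have hM : ∀ j, M j ^ (1/2:ℝ) * M j ^ (1/2:ℝ) = M j := by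
    intro j
    rw [← ENNReal.rpow_add_of_nonneg _ _ (by norm_num) (by norm_num)]; norm_num
  have e0 : ∑ k ∈ K, ∑ l ∈ K, M (k + l) * (A k * B l) =
      ∑ x ∈ K ×ˢ K, (M (x.1 + x.2) ^ (1/2:ℝ) * A x.1) * (M (x.1 + x.2) ^ (1/2:ℝ) * B x.2) := by
    rw [Finset.sum_product]
    refine Finset.sum_congr rfl fun k _ => Finset.sum_congr rfl fun l _ => ?_
    simp only
    rw [mul_mul_mul_comm, hM]
  have hrow : ∀ x : ℤ, ∑ l ∈ K, M (l + x) ≤ S := fun x =>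
    (ENNReal.sum_le_tsum K).trans (hS x)
  have e1 : ∑ x ∈ K ×ˢ K, (M (x.1 + x.2) ^ (1/2:ℝ) * A x.1) ^ (2:ℝ) ≤ S * ∑ k ∈ K, A k ^ 2 := by
    rw [Finset.sum_product, Finset.mul_sum]
    apply Finset.sum_le_sum
    intro k _
    calc _ = ∑ l ∈ K, M (l + k) * A k ^ 2 := by
          refine Finset.sum_congr rfl fun l _ => ?_
          simp only
          rw [ENNReal.rpow_two, mul_pow, sq (M _ ^ _), hM, add_comm]
      _ ≤ _ := by rw [← Finset.sum_mul]; gcongr; exact hrow k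
  have e2 : ∑ x ∈ K ×ˢ K, (M (x.1 + x.2) ^ (1/2:ℝ) * B x.2) ^ (2:ℝ) ≤ S * ∑ k ∈ K, B k ^ 2 := by
    rw [Finset.sum_product_right, Finset.mul_sum]
    apply Finset.sum_le_sum
    intro k _
    calc _ = ∑ l ∈ K, M (l + k) * B k ^ 2 := by
          refine Finset.sum_congr rfl fun l _ => ?_
          simp only
          rw [ENNReal.rpow_two, mul_pow, sq (M _ ^ _), hM]
      _ ≤ _ := by rw [← Finset.sum_mul]; gcongr; exact hrow k
  rw [e0]
  calc _ ≤ _ := key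
    _ ≤ (S * ∑ k ∈ K, A k ^ 2) ^ (1/2:ℝ) * (S * ∑ k ∈ K, B k ^ 2) ^ (1/2:ℝ) := by gcongr
    _ = (S ^ (1/2:ℝ) * S ^ (1/2:ℝ)) * ((∑ k ∈ K, A k ^ 2) ^ (1/2:ℝ) * (∑ k ∈ K, B k ^ 2) ^ (1/2:ℝ)) := by
        rw [ENNReal.mul_rpow_of_nonneg _ _ (by norm_num), ENNReal.mul_rpow_of_nonneg _ _ (by norm_num)]
        ring
    _ = _ := by
        rw [← ENNReal.rpow_add_of_nonneg _ _ (by norm_num) (by norm_num)]; norm_num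

variable {E : Type*} [NormedAddCommGroup E] [InnerProductSpace ℂ E] [CompleteSpace E]

lemma enorm_inner_sum_le (K : Finset ℤ) (u v : ℤ → E) :
    ‖inner ℂ (∑ k ∈ K, u k) (∑ l ∈ K, v l)‖ₑ ≤ ∑ k ∈ K, ∑ l ∈ K, ‖inner ℂ (u k) (v l)‖ₑ := by
  rw [sum_inner]
  refine (enorm_sum_le _ _).trans (Finset.sum_le_sum fun k _ => ?_)
  rw [inner_sum]
  exact enorm_sum_le _ _

/-- The non-endpoint abstract Strichartz estimate. -/
lemma strich_nonend (m : ℝ) (hm : 3 ≤ m) (δ : ℝ) (h0 : 0 < δ) (h1 : m * δ < 1)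
    (D : ℝ≥0∞) (hD : D ≠ ∞) :
    ∃ C : ℝ≥0∞, C ≠ ∞ ∧ ∀ (K : Finset ℤ) (H : ℤ → ℝ → E) (w : ℤ → ℝ → ℝ≥0∞),
      (∀ k, Integrable (H k)) → (∀ k, Measurable (w k)) →
      (∀ k l s t, ‖inner ℂ (H k s) (H l t)‖ₑ ≤ D * kap m (t - s) (k + l) * (w k s * w l t)) →
      ‖∑ k ∈ K, ∫ s, H k s‖ₑ ^ 2 ≤
        C * (∫⁻ t, (∑ k ∈ K, ((2:ℝ≥0∞) ^ (k * δ) * w k t) ^ 2) ^ ((2 / (2 - m * δ)) / 2)) ^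
          (2 / (2 / (2 - m * δ))) := by
  have hδ : δ < 1/2 := by nlinarith
  obtain ⟨C1, hC1, hb1⟩ := kap_sum m hm δ h0 hδ
  obtain ⟨C2, hC2, hb2⟩ := hls (m * δ) (by positivity) h1 (2 / (2 - m * δ)) rfl
  refine ⟨D * C1 * C2, by finiteness, fun K H w hH hw hHw => ?_⟩
  set A : ℤ → ℝ → ℝ≥0∞ := fun k t => (2:ℝ≥0∞) ^ (k * δ) * w k t with hA
  set f : ℝ → ℝ≥0∞ := fun t => (∑ k ∈ K, A k t ^ 2) ^ (1/2:ℝ) with hf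
  have hfm : Measurable f := by
    apply Measurable.pow_const
    exact Finset.measurable_sum _ fun k _ => ((hw k).const_mul _).pow_const _
  rw [← integral_finsetSum _ (fun k _ => hH k)]
  refine (sq_norm_integral_le _ _ (integrable_finsetSum _ fun k _ => hH k)).trans ?_
  have hpt : ∀ s t, s ≠ t → ‖inner ℂ (∑ k ∈ K, H k s) (∑ k ∈ K, H k t)‖ₑ ≤
      D * C1 * (f s * f t * ENNReal.ofReal |t - s| ^ (-(m * δ))) := by
    intro s t hst
    have hts : t - s ≠ 0 := sub_ne_zero.2 hst.symm
    refine (enorm_inner_sum_le _ _ _).trans ?_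
    have := schur_hankel (fun j => (2:ℝ≥0∞) ^ (-(j:ℝ) * δ) * kap m (t - s) j)
      (C1 * ENNReal.ofReal |t - s| ^ (-(m * δ)))
      (fun x => by simpa using hb1 _ hts x) K (fun k => A k s) (fun k => A k t)
    calc _ ≤ ∑ k ∈ K, ∑ l ∈ K, D * ((2:ℝ≥0∞) ^ (-((k + l : ℤ):ℝ) * δ) * kap m (t - s) ((k + l : ℤ):ℝ)
              * (A k s * A l t)) := by
          refine Finset.sum_le_sum fun k _ => Finset.sum_le_sum fun l _ => ?_
          refine (hHw k l s t).trans (le_of_eq ?_)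
          have : (2:ℝ≥0∞) ^ (-((k + l : ℤ):ℝ) * δ) * ((2:ℝ≥0∞) ^ ((k:ℝ) * δ) * (2:ℝ≥0∞) ^ ((l:ℝ) * δ)) = 1 := by
            rw [← two_rpow_add, ← two_rpow_add]; push_cast; ring_nf; simp
          calc _ = D * kap m (t - s) (k + l) * (w k s * w l t) * 1 := (mul_one _).symm
            _ = _ := by rw [← this]; push_cast; simp only [hA]; ring
      _ ≤ D * ((C1 * ENNReal.ofReal |t - s| ^ (-(m * δ))) * (f s * f t)) := by
          simp_rw [← Finset.mul_sum]
          gcongr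
      _ = _ := by ring
  have hae : ∀ t : ℝ, ∀ᵐ s : ℝ, s ≠ t := fun t => by
    simp [ae_iff]
  calc _ ≤ ∫⁻ t, ∫⁻ s, D * C1 * (f s * f t * ENNReal.ofReal |t - s| ^ (-(m * δ))) := by
        apply lintegral_mono
        intro t
        apply lintegral_mono_ae
        filter_upwards [hae t] with s hs using hpt s t hs
    _ = D * C1 * ∫⁻ t, ∫⁻ s, (f s * f t * ENNReal.ofReal |t - s| ^ (-(m * δ))) := by
        rw [← lintegral_const_mul' _ _ (by finiteness)]
        congr 1; ext t
        rw [← lintegral_const_mul' _ _ (by finiteness)]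
    _ ≤ D * C1 * (C2 * (∫⁻ t, f t ^ (2 / (2 - m * δ))) ^ (2 / (2 / (2 - m * δ)))) := by
        gcongr
        exact hb2 f hfm
    _ = _ := by
        rw [← mul_assoc]
        congr 3; ext t
        simp only [hf]
        rw [← ENNReal.rpow_mul]; congr 1; ring

end ManyBodyWaveguide

namespace ManyBodyWaveguide

/-- Dyadic strip around the diagonal. -/
def Dset (j : ℤ) : Set (ℝ × ℝ) :=
  {z | (2:ℝ) ^ (j:ℝ) ≤ |z.2 - z.1| ∧ |z.2 - z.1| < 2 ^ ((j:ℝ) + 1)}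

def Dsec (j : ℤ) (s : ℝ) : Set ℝ :=
  {t | (2:ℝ) ^ (j:ℝ) ≤ |t - s| ∧ |t - s| < 2 ^ ((j:ℝ) + 1)}

lemma mem_Dset (j : ℤ) (z : ℝ × ℝ) : z ∈ Dset j ↔
  (2:ℝ) ^ (j:ℝ) ≤ |z.2 - z.1| ∧ |z.2 - z.1| < 2 ^ ((j:ℝ) + 1) := Iff.rfl

lemma mem_Dsec (j : ℤ) (s t : ℝ) : t ∈ Dsec j s ↔
  (2:ℝ) ^ (j:ℝ) ≤ |t - s| ∧ |t - s| < 2 ^ ((j:ℝ) + 1) := Iff.rfl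

lemma Dset_meas (j : ℤ) : MeasurableSet (Dset j) := by
  have h1 : Measurable (fun z : ℝ × ℝ => |z.2 - z.1|) := by fun_prop
  exact (measurableSet_le measurable_const h1).inter (measurableSet_lt h1 measurable_const)

lemma Dsec_meas (j : ℤ) (s : ℝ) : MeasurableSet (Dsec j s) := by
  have h1 : Measurable (fun z : ℝ => |z - s|) := by fun_prop
  exact (measurableSet_le measurable_const h1).inter (measurableSet_lt h1 measurable_const)

lemma Dsec_vol (j : ℤ) (s : ℝ) : volume (Dsec j s) ≤ 4 * 2 ^ (j:ℝ) := by
  have : Dsec j s ⊆ Metric.closedBall s (2 ^ ((j:ℝ) + 1)) := by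
    intro t ht
    rw [Metric.mem_closedBall, Real.dist_eq]
    exact ((mem_Dsec _ _ _).1 ht).2.le
  refine (measure_mono this).trans (le_of_eq ?_)
  rw [Real.volume_closedBall, ENNReal.ofReal_mul (by norm_num), ← two_rpow_eq_ofReal, two_rpow_add]
  norm_num
  ring

lemma Dset_swap (j : ℤ) (z : ℝ × ℝ) : z.swap ∈ Dset j ↔ z ∈ Dset j := by
  simp only [mem_Dset, Prod.fst_swap, Prod.snd_swap]
  rw [abs_sub_comm]

lemma Dset_disj : Pairwise (Function.onFun Disjoint Dset) := by
  have key : ∀ i j : ℤ, i < j → Disjoint (Dset i) (Dset j) := by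
    intro i j hij
    rw [Set.disjoint_left]
    intro z hi hj
    have h1 := ((mem_Dset _ _).1 hi).2
    have h2 := ((mem_Dset _ _).1 hj).1
    have h3 : (2:ℝ) ^ ((i:ℝ) + 1) ≤ 2 ^ (j:ℝ) := by
      apply Real.rpow_le_rpow_of_exponent_le (by norm_num)
      exact_mod_cast hij
    linarith
  intro i j hij
  rcases lt_or_gt_of_ne hij with h | h
  · exact key i j h
  · exact (key j i h).symm

lemma Dset_union : ∀ᵐ z : ℝ × ℝ, z ∈ ⋃ j, Dset j := by
  rw [Measure.volume_eq_prod]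
  have hm : MeasurableSet (⋃ j, Dset j) := MeasurableSet.iUnion Dset_meas
  rw [Measure.ae_prod_mem_iff_ae_ae_mem hm]
  filter_upwards with s
  have : ∀ᵐ t : ℝ, t ≠ s := by simp [ae_iff]
  filter_upwards [this] with t ht
  obtain ⟨j, hj⟩ := exists_mem_Ico_zpow (x := |t - s|) (y := (2:ℝ)) (abs_pos.2 (sub_ne_zero.2 ht)) (by norm_num)
  rw [Set.mem_iUnion]
  refine ⟨j, (mem_Dset _ _).2 ⟨?_, ?_⟩⟩
  · rw [Real.rpow_intCast]; exact hj.1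
  · have := hj.2
    rw [← Real.rpow_intCast] at this; push_cast at this; exact this

lemma Dset_lintegral (j : ℤ) (g : ℝ × ℝ → ℝ≥0∞) (hg : Measurable g) :
    ∫⁻ z in Dset j, g z = ∫⁻ s, ∫⁻ t in Dsec j s, g (s, t) := by
  rw [← lintegral_indicator (Dset_meas j), Measure.volume_eq_prod,
    lintegral_prod _ (hg.indicator (Dset_meas j)).aemeasurable]
  congr 1; ext s
  rw [← lintegral_indicator (Dsec_meas j s)]
  rfl

lemma Dset_lintegral_fst (j : ℤ) (f : ℝ → ℝ≥0∞) (hf : Measurable f) :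
    ∫⁻ z in Dset j, f z.1 ≤ 4 * 2 ^ (j:ℝ) * ∫⁻ s, f s := by
  rw [Dset_lintegral j _ (by fun_prop), ← lintegral_const_mul _ hf]
  apply lintegral_mono
  intro s
  simp only [lintegral_const, Measure.restrict_apply_univ]
  rw [mul_comm]; gcongr; exact Dsec_vol j s

lemma Dset_lintegral_snd (j : ℤ) (f : ℝ → ℝ≥0∞) (hf : Measurable f) :
    ∫⁻ z in Dset j, f z.2 ≤ 4 * 2 ^ (j:ℝ) * ∫⁻ s, f s := by
  refine le_trans (le_of_eq ?_) (Dset_lintegral_fst j f hf)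
  rw [← lintegral_indicator (Dset_meas j), ← lintegral_indicator (Dset_meas j),
    Measure.volume_eq_prod, ← lintegral_prod_swap]
  congr 1; ext z
  by_cases h : z ∈ Dset j
  · rw [Set.indicator_of_mem h, Set.indicator_of_mem ((Dset_swap j z).2 h)]; rfl
  · rw [Set.indicator_of_notMem h, Set.indicator_of_notMem (fun h' => h ((Dset_swap j z).1 h'))]

variable {E : Type*} [NormedAddCommGroup E] [InnerProductSpace ℂ E] [CompleteSpace E]

lemma theta_integrable (H G : ℝ → E) (hH : Integrable H) (hG : Integrable G) :
    Integrable (fun z : ℝ × ℝ => inner ℂ (H z.1) (G z.2)) := by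
  rw [Measure.volume_eq_prod]
  have h := hH.norm.mul_prod hG.norm
  refine h.mono ?_ ?_
  · exact (hH.1.comp_fst).inner (hG.1.comp_snd)
  · filter_upwards with z
    refine (norm_inner_le_norm _ _).trans ?_
    rw [norm_mul, norm_norm, norm_norm]

lemma Dset_integral (j : ℤ) (H G : ℝ → E) (hH : Integrable H) (hG : Integrable G) :
    ∫ z in Dset j, inner ℂ (H z.1) (G z.2) = ∫ s, inner ℂ (H s) (∫ t in Dsec j s, G t) := by
  rw [← integral_indicator (Dset_meas j), Measure.volume_eq_prod, integral_prod]
  · congr 1; ext s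
    rw [← integral_inner hG.integrableOn, ← integral_indicator (Dsec_meas j s)]
    rfl
  · rw [← Measure.volume_eq_prod]
    exact (theta_integrable H G hH hG).indicator (Dset_meas j)

lemma Dset_integral_swap (j : ℤ) (H G : ℝ → E) :
    ‖∫ z in Dset j, inner ℂ (H z.1) (G z.2)‖ₑ = ‖∫ z in Dset j, inner ℂ (G z.1) (H z.2)‖ₑ := by
  have : ∫ z in Dset j, inner ℂ (H z.1) (G z.2) =
      (starRingEnd ℂ) (∫ z in Dset j, inner ℂ (G z.1) (H z.2)) := by
    rw [← integral_conj, ← integral_indicator (Dset_meas j), ← integral_indicator (Dset_meas j),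
      Measure.volume_eq_prod, ← integral_prod_swap]
    congr 1; ext z
    by_cases h : z ∈ Dset j
    · rw [Set.indicator_of_mem h, Set.indicator_of_mem ((Dset_swap j z).2 h)]
      simp
    · rw [Set.indicator_of_notMem h, Set.indicator_of_notMem (fun h' => h ((Dset_swap j z).1 h'))]
  rw [this, ← ofReal_norm, ← ofReal_norm, RCLike.norm_conj]

end ManyBodyWaveguide

namespace ManyBodyWaveguide

variable {E : Type*} [NormedAddCommGroup E] [InnerProductSpace ℂ E] [CompleteSpace E]

lemma rpow_neg_le_of_le {a b : ℝ≥0∞} (h : a ≤ b) {x : ℝ} (hx : 0 ≤ x) : b ^ (-x) ≤ a ^ (-x) := by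
  rw [ENNReal.rpow_neg, ENNReal.rpow_neg]
  exact ENNReal.inv_le_inv.2 (ENNReal.rpow_le_rpow h hx)

lemma kap_le_on (m : ℝ) (hm : 3 ≤ m) (j : ℤ) (τ : ℝ) (x : ℝ) (h : (2:ℝ) ^ (j:ℝ) ≤ |τ|) :
    kap m τ x ≤ 2 ^ (-(j * (m/2)) + x / 2) := by
  refine (min_le_right _ _).trans ?_
  rw [two_rpow_add]
  gcongr
  calc ENNReal.ofReal |τ| ^ (-(m/2)) ≤ ((2:ℝ≥0∞) ^ (j:ℝ)) ^ (-(m/2)) := by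
        apply rpow_neg_le_of_le _ (by linarith)
        rw [two_rpow_eq_ofReal]
        exact ENNReal.ofReal_le_ofReal h
    _ = _ := by rw [← ENNReal.rpow_mul]; congr 1; ring

/-- The dispersive bound for a dyadic block. -/
lemma T_disp (m : ℝ) (hm : 3 ≤ m) (D : ℝ≥0∞) (hD : D ≠ ∞) (j : ℤ) (x y : ℝ) (H G : ℝ → E)
    (v w : ℝ → ℝ≥0∞) (hv : Measurable v) (hw : Measurable w)
    (hb : ∀ s t, ‖inner ℂ (H s) (G t)‖ₑ ≤ D * kap m (t - s) (x + y) * (v s * w t)) :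
    ‖∫ z in Dset j, inner ℂ (H z.1) (G z.2)‖ₑ ≤
      4 * D * 2 ^ ((m/2 - 1) * (x / m + y / m - j)) *
        ((∫⁻ s, (2 ^ (x / m) * v s) ^ 2) + ∫⁻ s, (2 ^ (y / m) * w s) ^ 2) := by
  refine (enorm_integral_le_lintegral_enorm _).trans ?_
  set a : ℝ → ℝ≥0∞ := fun s => (2 ^ (x / m) * v s) ^ 2
  set b : ℝ → ℝ≥0∞ := fun s => (2 ^ (y / m) * w s) ^ 2
  have ha : Measurable a := by fun_prop
  have hb' : Measurable b := by fun_prop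
  set c : ℝ≥0∞ := D * 2 ^ (-(j * (m/2)) + (x + y) / 2 - x / m - y / m)
  have hm0 : m ≠ 0 := by linarith
  calc _ ≤ ∫⁻ z in Dset j, c * (a z.1 + b z.2) := by
        apply setLIntegral_mono' (Dset_meas j)
        intro z hz
        refine (hb _ _).trans ?_
        calc _ ≤ D * 2 ^ (-(j * (m/2)) + (x + y) / 2) * (v z.1 * w z.2) := by
              gcongr
              exact kap_le_on m hm j _ _ ((mem_Dset _ _).1 hz).1
          _ = c * ((2 ^ (x / m) * v z.1) * (2 ^ (y / m) * w z.2)) := by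
              have : (2:ℝ≥0∞) ^ (-(j * (m/2)) + (x + y) / 2) =
                2 ^ (-(j * (m/2)) + (x + y) / 2 - x / m - y / m) * 2 ^ (x / m) * 2 ^ (y / m) := by
                rw [← two_rpow_add, ← two_rpow_add]; congr 1; ring
              simp only [c]
              rw [this]; ring
          _ ≤ _ := by gcongr; exact mul_le_sq_add_sq _ _
    _ = c * ((∫⁻ z in Dset j, a z.1) + ∫⁻ z in Dset j, b z.2) := by
        rw [lintegral_const_mul _ (by fun_prop), lintegral_add_left (by fun_prop)]
    _ ≤ c * (4 * 2 ^ (j:ℝ) * (∫⁻ s, a s) + 4 * 2 ^ (j:ℝ) * (∫⁻ s, b s)) := by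
        gcongr
        · exact Dset_lintegral_fst j a ha
        · exact Dset_lintegral_snd j b hb'
    _ = _ := by
        have : (2:ℝ≥0∞) ^ ((m/2 - 1) * (x / m + y / m - j)) =
            2 ^ (-(j * (m/2)) + (x + y) / 2 - x / m - y / m) * 2 ^ (j:ℝ) := by
          rw [← two_rpow_add]; congr 1; field_simp; ring
        rw [this]; simp only [c]; ring

/-- Local `L²` bound. -/
lemma loc_bound (m : ℝ) (hm : 3 ≤ m) (D : ℝ≥0∞) (hD : D ≠ ∞) (j : ℤ) (y : ℝ) (G : ℝ → E)
    (hG : Integrable G) (w : ℝ → ℝ≥0∞) (hw : Measurable w)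
    (hb : ∀ s t, ‖inner ℂ (G s) (G t)‖ₑ ≤ D * kap m (t - s) (2 * y) * (w s * w t))
    (e : ℝ) (he : e = 0 ∨ e = y / m - j / 2) (s : ℝ) :
    ‖∫ t in Dsec j s, G t‖ₑ ^ 2 ≤
      12 * D * 2 ^ (-(2 * e)) * ∫⁻ t in Dsec j s, (2 ^ (y / m) * w t) ^ 2 := by
  refine (sq_norm_integral_le _ _ hG.integrableOn).trans ?_
  set I := Dsec j s
  have hrow : ∀ t, ∫⁻ u in I, kap m (t - u) (2 * y) ≤ 6 * 2 ^ (2 * y / m - 2 * e) := by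
    intro t
    rcases he with rfl | rfl
    · rw [mul_zero, sub_zero]
      refine (setLIntegral_le_lintegral _ _).trans (le_trans (le_of_eq ?_) (kap_lintegral m hm y))
      exact lintegral_sub_left_eq_self (fun u => kap m u (2 * y)) t
    · calc _ ≤ ∫⁻ u in I, 1 := by gcongr; exact kap_le_one _ _ _
        _ ≤ 4 * 2 ^ (j:ℝ) := by simpa using Dsec_vol j s
        _ ≤ _ := by
          rw [show 2 * y / m - 2 * (y / m - j / 2) = (j:ℝ) by ring]
          gcongr; norm_num
  have hrow' : ∀ t, ∫⁻ u in I, kap m (u - t) (2 * y) ≤ 6 * 2 ^ (2 * y / m - 2 * e) := by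
    intro t
    simp_rw [kap_sub_comm m _ t]
    exact hrow t
  have kmeas : Measurable (fun z : ℝ × ℝ => kap m (z.1 - z.2) (2 * y)) :=
    (kap_meas m (2 * y)).comp (by fun_prop)
  have kmt : ∀ t, Measurable (fun u : ℝ => kap m (t - u) (2 * y)) := fun t =>
    (kap_meas m (2 * y)).comp (by fun_prop)
  calc _ ≤ ∫⁻ t in I, ∫⁻ u in I, D * (kap m (t - u) (2 * y) * w t ^ 2 + kap m (t - u) (2 * y) * w u ^ 2) := by
        gcongr with t u
        refine (hb _ _).trans ?_
        rw [mul_assoc, ← mul_add]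
        gcongr
        rw [add_comm]
        exact mul_le_sq_add_sq _ _
    _ = D * ((∫⁻ t in I, (∫⁻ u in I, kap m (t - u) (2 * y)) * w t ^ 2) +
          ∫⁻ t in I, ∫⁻ u in I, kap m (t - u) (2 * y) * w u ^ 2) := by
        rw [← lintegral_add_left, ← lintegral_const_mul']
        · congr 1; ext t
          rw [lintegral_const_mul' _ _ hD, lintegral_add_left ((kmt t).mul_const _), lintegral_mul_const _ (kmt t)]
        · exact hD
        · apply Measurable.mul _ (hw.pow_const 2)
          exact kmeas.lintegral_prod_right'
    _ = D * ((∫⁻ t in I, (∫⁻ u in I, kap m (t - u) (2 * y)) * w t ^ 2) +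
          ∫⁻ u in I, (∫⁻ t in I, kap m (t - u) (2 * y)) * w u ^ 2) := by
        congr 2
        rw [lintegral_lintegral_swap]
        · congr 1; ext u
          rw [lintegral_mul_const]
          exact (kap_meas m (2 * y)).comp (by fun_prop)
        · exact (kmeas.mul ((hw.comp measurable_snd).pow_const 2)).aemeasurable
    _ ≤ D * ((∫⁻ t in I, 6 * 2 ^ (2 * y / m - 2 * e) * w t ^ 2) +
          ∫⁻ u in I, 6 * 2 ^ (2 * y / m - 2 * e) * w u ^ 2) := by
        gcongr with t u
        · exact hrow t
        · exact hrow' u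
    _ = _ := by
        have e1 : ∀ t, (2 ^ (y / m) * w t) ^ 2 = (2:ℝ≥0∞) ^ (2 * y / m) * w t ^ 2 := by
          intro t
          rw [mul_pow, sq ((2:ℝ≥0∞) ^ _), ← two_rpow_add]; congr 2; ring
        simp_rw [e1]
        rw [lintegral_const_mul _ (by fun_prop), lintegral_const_mul _ (by fun_prop), sub_eq_add_neg, two_rpow_add]
        ring

/-- The energy bound for a dyadic block. -/
lemma T_energy (m : ℝ) (hm : 3 ≤ m) (D : ℝ≥0∞) (hD : D ≠ ∞) (hD1 : 1 ≤ D) (j : ℤ) (x y : ℝ) (H G : ℝ → E)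
    (hH : Integrable H) (hG : Integrable G)
    (v w : ℝ → ℝ≥0∞) (hv : Measurable v) (hw : Measurable w) (hHv : ∀ s, ‖H s‖ₑ ≤ v s)
    (hb : ∀ s t, ‖inner ℂ (G s) (G t)‖ₑ ≤ D * kap m (t - s) (2 * y) * (w s * w t))
    (e : ℝ) (he : e = 0 ∨ e = y / m - j / 2) :
    ‖∫ z in Dset j, inner ℂ (H z.1) (G z.2)‖ₑ ≤
      48 * D * 2 ^ (-(x / m - j / 2) - e) *
        ((∫⁻ s, (2 ^ (x / m) * v s) ^ 2) + ∫⁻ s, (2 ^ (y / m) * w s) ^ 2) := by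
  rw [Dset_integral j H G hH hG]
  refine (enorm_integral_le_lintegral_enorm _).trans ?_
  set a : ℝ → ℝ≥0∞ := fun s => (2 ^ (x / m) * v s) ^ 2
  set b : ℝ → ℝ≥0∞ := fun s => (2 ^ (y / m) * w s) ^ 2
  have ha : Measurable a := by fun_prop
  have hbm : Measurable b := by fun_prop
  set c : ℝ≥0∞ := 2 ^ (-(x / m - j / 2) - e)
  calc _ ≤ ∫⁻ s, c * (a s + 12 * D * 2 ^ (-(j:ℝ)) * ∫⁻ t in Dsec j s, b t) := by
        apply lintegral_mono
        intro s
        simp only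
        have h1 : ‖inner ℂ (H s) (∫ t in Dsec j s, G t)‖ₑ ≤ v s * ‖∫ t in Dsec j s, G t‖ₑ := by
          refine le_trans ?_ (mul_le_mul_left (hHv s) _)
          rw [← ofReal_norm, ← ofReal_norm, ← ofReal_norm, ← ENNReal.ofReal_mul (norm_nonneg _)]
          exact ENNReal.ofReal_le_ofReal (norm_inner_le_norm _ _)
        refine h1.trans ?_
        have h2 := loc_bound m hm D hD j y G hG w hw hb e he s
        set X := ‖∫ t in Dsec j s, G t‖ₑ
        calc v s * X = c * ((2 ^ (x / m) * v s) * (2 ^ (e - j / 2) * X)) := by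
              have : c * (2 ^ (x / m) * 2 ^ (e - j / 2)) = 1 := by
                simp only [c]
                rw [← two_rpow_add, ← two_rpow_add]; ring_nf; simp
              calc v s * X = 1 * (v s * X) := (one_mul _).symm
                _ = _ := by rw [← this]; ring
          _ ≤ c * (a s + (2 ^ (e - j / 2) * X) ^ 2) := by
              gcongr; exact mul_le_sq_add_sq _ _
          _ ≤ _ := by
              gcongr
              rw [mul_pow]
              refine (mul_le_mul_right h2 _).trans (le_of_eq ?_)
              have : ((2:ℝ≥0∞) ^ (e - j / 2)) ^ 2 * 2 ^ (-(2 * e)) = 2 ^ (-(j:ℝ)) := by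
                rw [sq, ← two_rpow_add, ← two_rpow_add]; congr 1; ring
              rw [← this]; ring
    _ = c * ((∫⁻ s, a s) + 12 * D * 2 ^ (-(j:ℝ)) * ∫⁻ z in Dset j, b z.2) := by
        rw [lintegral_const_mul' _ _ (two_rpow_ne_top _), lintegral_add_left ha, lintegral_const_mul',
          Dset_lintegral j (fun z => b z.2) (by fun_prop)]
        have := two_rpow_ne_top (-(j:ℝ))
        finiteness
    _ ≤ c * ((∫⁻ s, a s) + 12 * D * 2 ^ (-(j:ℝ)) * (4 * 2 ^ (j:ℝ) * ∫⁻ s, b s)) := by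
        gcongr; exact Dset_lintegral_snd j b hbm
    _ = c * ((∫⁻ s, a s) + 48 * D * ∫⁻ s, b s) := by
        have : (2:ℝ≥0∞) ^ (-(j:ℝ)) * 2 ^ (j:ℝ) = 1 := by rw [← two_rpow_add]; simp
        congr 2
        calc _ = 48 * D * ((2:ℝ≥0∞) ^ (-(j:ℝ)) * 2 ^ (j:ℝ)) * ∫⁻ s, b s := by ring
          _ = _ := by rw [this, mul_one]
    _ ≤ c * (48 * D * (∫⁻ s, a s) + 48 * D * ∫⁻ s, b s) := by
        gcongr
        refine le_mul_of_one_le_left' ?_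
        calc (1:ℝ≥0∞) ≤ 48 * 1 := by norm_num
          _ ≤ _ := by gcongr
    _ = _ := by ring

end ManyBodyWaveguide

namespace ManyBodyWaveguide

variable {E : Type*} [NormedAddCommGroup E] [InnerProductSpace ℂ E] [CompleteSpace E]

lemma exponent_cases (m : ℝ) (hm : 3 ≤ m) (P L : ℝ) :
    (m/2 - 1) * (P + L) ≤ -(|P| + |L|) / 6 ∨ -P ≤ -(|P| + |L|) / 6 ∨ -P - L ≤ -(|P| + |L|) / 6 ∨
      -L ≤ -(|P| + |L|) / 6 := by
  rcases le_total 0 P with hP | hP <;> rcases le_total 0 L with hL | hL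
  · right; right; left
    rw [abs_of_nonneg hP, abs_of_nonneg hL]; linarith
  · rw [abs_of_nonneg hP, abs_of_nonpos hL]
    by_cases h : -L ≤ 5 * P
    · right; left; linarith
    · left; push Not at h
      nlinarith
  · rw [abs_of_nonpos hP, abs_of_nonneg hL]
    by_cases h : -P ≤ 5 * L
    · right; right; right; linarith
    · left; push Not at h
      nlinarith
  · left
    rw [abs_of_nonpos hP, abs_of_nonpos hL]
    nlinarith

lemma T_all (m : ℝ) (hm : 3 ≤ m) (D : ℝ≥0∞) (hD : D ≠ ∞) (hD1 : 1 ≤ D) (j : ℤ) (x y : ℝ) (H G : ℝ → E)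
    (hH : Integrable H) (hG : Integrable G)
    (v w : ℝ → ℝ≥0∞) (hv : Measurable v) (hw : Measurable w) (hHv : ∀ s, ‖H s‖ₑ ≤ v s)
    (hGw : ∀ s, ‖G s‖ₑ ≤ w s)
    (hb : ∀ s t, ‖inner ℂ (H s) (G t)‖ₑ ≤ D * kap m (t - s) (x + y) * (v s * w t))
    (hbG : ∀ s t, ‖inner ℂ (G s) (G t)‖ₑ ≤ D * kap m (t - s) (2 * y) * (w s * w t))
    (hbH : ∀ s t, ‖inner ℂ (H s) (H t)‖ₑ ≤ D * kap m (t - s) (2 * x) * (v s * v t)) :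
    ‖∫ z in Dset j, inner ℂ (H z.1) (G z.2)‖ₑ ≤
      48 * D * 2 ^ (-(|x / m - j / 2| + |y / m - j / 2|) / 6) *
        ((∫⁻ s, (2 ^ (x / m) * v s) ^ 2) + ∫⁻ s, (2 ^ (y / m) * w s) ^ 2) := by
  rcases exponent_cases m hm (x / m - j / 2) (y / m - j / 2) with h | h | h | h
  · refine (T_disp m hm D hD j x y H G v w hv hw hb).trans ?_
    gcongr
    · norm_num
    · norm_num
    · refine le_trans (le_of_eq ?_) h; ring
  · refine (T_energy m hm D hD hD1 j x y H G hH hG v w hv hw hHv hbG 0 (Or.inl rfl)).trans ?_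
    gcongr
    · norm_num
    · linarith
  · refine (T_energy m hm D hD hD1 j x y H G hH hG v w hv hw hHv hbG _ (Or.inr rfl)).trans ?_
    gcongr
    norm_num
  · rw [Dset_integral_swap]
    refine (T_energy m hm D hD hD1 j y x G H hG hH w v hw hv hGw hbH 0 (Or.inl rfl)).trans ?_
    rw [add_comm (∫⁻ s, (2 ^ (x / m) * v s) ^ 2)]
    gcongr
    · norm_num
    · linarith

lemma inner_integral_le_tsum (H G : ℝ → E) (hH : Integrable H) (hG : Integrable G) :
    ‖inner ℂ (∫ s, H s) (∫ s, G s)‖ₑ ≤ ∑' j : ℤ, ‖∫ z in Dset j, inner ℂ (H z.1) (G z.2)‖ₑ := by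
  have h1 : inner ℂ (∫ s, H s) (∫ s, G s) = ∫ z : ℝ × ℝ, inner ℂ (H z.1) (G z.2) := by
    rw [Measure.volume_eq_prod, integral_prod _ (theta_integrable H G hH hG)]
    simp_rw [integral_inner hG]
    rw [← inner_conj_symm, ← integral_inner hH, ← integral_conj]
    simp
  have h2 : ∫ z : ℝ × ℝ, inner ℂ (H z.1) (G z.2) = ∫ z in ⋃ j, Dset j, inner ℂ (H z.1) (G z.2) := by
    rw [Measure.restrict_eq_self_of_ae_mem Dset_union]
  have h3 := hasSum_integral_iUnion Dset_meas Dset_disj (theta_integrable H G hH hG).integrableOn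
  rw [h1, h2, ← h3.tsum_eq]
  exact enorm_tsum_le_tsum_enorm

/-- The endpoint abstract Strichartz estimate. -/
lemma strich_end (m : ℝ) (hm : 3 ≤ m) (D : ℝ≥0∞) (hD : D ≠ ∞) (hD1 : 1 ≤ D) :
    ∃ C : ℝ≥0∞, C ≠ ∞ ∧ ∀ (K : Finset ℤ) (H : ℤ → ℝ → E) (w : ℤ → ℝ → ℝ≥0∞),
      (∀ k, Integrable (H k)) → (∀ k, Measurable (w k)) → (∀ k s, ‖H k s‖ₑ ≤ w k s) →
      (∀ k l s t, ‖inner ℂ (H k s) (H l t)‖ₑ ≤ D * kap m (t - s) (k + l) * (w k s * w l t)) →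
      ‖∑ k ∈ K, ∫ s, H k s‖ₑ ^ 2 ≤
        C * ∫⁻ t, ∑ k ∈ K, ((2:ℝ≥0∞) ^ (k / m) * w k t) ^ 2 := by
  have hm0 : 0 < m := by linarith
  obtain ⟨C1, hC1, hb1⟩ := geom_sum_bound (1 / (6 * m)) (by positivity)
  obtain ⟨C2, hC2, hb2⟩ := geom_sum_bound (1 / 12) (by positivity)
  refine ⟨96 * D * C1 * C2, by finiteness, fun K H w hH hw hHw hHH => ?_⟩
  set a : ℤ → ℝ≥0∞ := fun k => ∫⁻ t, ((2:ℝ≥0∞) ^ (k / m) * w k t) ^ 2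
  rw [lintegral_finsetSum _ (fun k _ => ((hw k).const_mul _).pow_const _)]
  set v := ∑ k ∈ K, ∫ s, H k s
  have hv : ‖v‖ₑ ^ 2 = ‖inner ℂ v v‖ₑ := by
    rw [← ofReal_norm, ← ofReal_norm, inner_self_eq_norm_sq_to_K,
      ← ENNReal.ofReal_pow (norm_nonneg _)]
    simp
  rw [hv]
  refine (enorm_inner_sum_le _ _ _).trans ?_
  set g : ℤ → ℤ → ℝ≥0∞ := fun j k => 2 ^ (-|(k:ℝ) / m - j / 2| / 6)
  have hg : ∀ j k l : ℤ, (2:ℝ≥0∞) ^ (-(|(k:ℝ) / m - j / 2| + |(l:ℝ) / m - j / 2|) / 6) = g j k * g j l := by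
    intro j k l
    simp only [g]
    rw [← two_rpow_add]; congr 1; ring
  have hsum : ∀ k : ℤ, ∑ l ∈ K, ∑' j : ℤ, g j k * g j l ≤ C1 * C2 := by
    intro k
    rw [← Summable.tsum_finsetSum (fun _ _ => ENNReal.summable)]
    simp_rw [← Finset.mul_sum]
    have hl : ∀ j : ℤ, ∑ l ∈ K, g j l ≤ C1 := by
      intro j
      refine (ENNReal.sum_le_tsum K).trans (le_trans (le_of_eq ?_) (hb1 (j / 12)))
      congr 1; ext l
      simp only [g]
      congr 1
      rw [show 1 / (6 * m) * (l:ℝ) - j / 12 = (l / m - j / 2) / 6 by field_simp; ring, abs_div]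
      norm_num; ring
    calc _ ≤ ∑' j : ℤ, g j k * C1 := ENNReal.tsum_le_tsum fun j => by gcongr; exact hl j
      _ = (∑' j : ℤ, g j k) * C1 := ENNReal.tsum_mul_right
      _ ≤ C2 * C1 := by
        gcongr
        refine (le_trans (le_of_eq ?_) (hb2 (k / (6 * m))))
        congr 1; ext l
        simp only [g]
        congr 1
        rw [show 1 / 12 * (l:ℝ) - k / (6 * m) = -((k / m - l / 2) / 6) by field_simp; ring, abs_neg, abs_div]
        norm_num; ring
      _ = _ := mul_comm _ _
  calc _ ≤ ∑ k ∈ K, ∑ l ∈ K, ∑' j : ℤ, 48 * D * (g j k * g j l) * (a k + a l) := by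
        refine Finset.sum_le_sum fun k _ => Finset.sum_le_sum fun l _ => ?_
        refine (inner_integral_le_tsum _ _ (hH k) (hH l)).trans (ENNReal.tsum_le_tsum fun j => ?_)
        rw [← hg]
        apply T_all m hm D hD hD1 j k l (H k) (H l) (hH k) (hH l) (w k) (w l) (hw k) (hw l) (hHw k) (hHw l) (hHH k l)
        · intro s t; rw [two_mul]; exact hHH l l s t
        · intro s t; rw [two_mul]; exact hHH k k s t
    _ = 48 * D * ((∑ k ∈ K, a k * ∑ l ∈ K, ∑' j : ℤ, g j k * g j l) +
          ∑ l ∈ K, a l * ∑ k ∈ K, ∑' j : ℤ, g j l * g j k) := by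
        have e1 : ∀ k l : ℤ, ∑' j : ℤ, 48 * D * (g j k * g j l) * (a k + a l) =
            48 * D * (a k * (∑' j : ℤ, g j k * g j l)) + 48 * D * (a l * ∑' j : ℤ, g j l * g j k) := by
          intro k l
          rw [ENNReal.tsum_mul_right, ENNReal.tsum_mul_left]
          simp_rw [mul_comm (g _ l)]
          ring
        simp_rw [e1, Finset.sum_add_distrib]
        rw [mul_add]
        congr 1
        · simp_rw [Finset.mul_sum]
        · rw [Finset.sum_comm]; simp_rw [Finset.mul_sum]
    _ ≤ 48 * D * ((∑ k ∈ K, a k * (C1 * C2)) + ∑ l ∈ K, a l * (C1 * C2)) := by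
        gcongr with k _ l _
        · exact hsum k
        · exact hsum l
    _ = _ := by rw [← Finset.sum_mul]; simp only [a]; ring

end ManyBodyWaveguide

namespace ManyBodyWaveguide

variable {m n N : ℕ}

/-- Sum of squares of the Euclidean coordinates. -/
def Sq (x : Cfg m n N) : ℝ := ∑ β, ∑ i, (x β).1 i ^ 2

def gau (κ : ℝ) (x : Cfg m n N) : ℝ := Real.exp (-κ * Sq x)

/-- The torus character. -/
def ph (k : Fin N → Fin n → ℤ) (x : Cfg m n N) : ℂ := ∏ β, ∏ j, fourier (k β j) ((x β).2 j)

/-- The generalized Gaussian. -/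
def Efun (b : ℂ) (e : Fin N → Fin m → ℂ) (k : Fin N → Fin n → ℤ) (x : Cfg m n N) : ℂ :=
  Complex.exp (∑ β, ∑ i, (-b * ((x β).1 i : ℂ) ^ 2 + e β i * ((x β).1 i : ℂ))) * ph k x

def k2 (k : Fin N → Fin n → ℤ) : ℂ := ∑ β, ∑ j, (4 * Real.pi ^ 2 * (k β j : ℂ) ^ 2)

/-- The Laplace factor of the generalized Gaussian. -/
def Efac (b : ℂ) (e : Fin N → Fin m → ℂ) (k : Fin N → Fin n → ℤ) (x : Cfg m n N) : ℂ :=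
  (∑ β, ∑ i, ((-2 * b * ((x β).1 i : ℂ) + e β i) ^ 2 - 2 * b)) - k2 k

lemma Sq_nonneg (x : Cfg m n N) : 0 ≤ Sq x := by unfold Sq; positivity

lemma Sq_cont : Continuous (Sq : Cfg m n N → ℝ) := by unfold Sq; fun_prop

lemma gau_cont (κ : ℝ) : Continuous (gau κ : Cfg m n N → ℝ) := by
  unfold gau; exact Real.continuous_exp.comp (continuous_const.mul Sq_cont)

lemma gau_pos (κ : ℝ) (x : Cfg m n N) : 0 < gau κ x := Real.exp_pos _

lemma gau_mul (κ l : ℝ) (x : Cfg m n N) : gau κ x * gau l x = gau (κ + l) x := by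
  unfold gau; rw [← Real.exp_add]; ring_nf

lemma ph_cont (k : Fin N → Fin n → ℤ) : Continuous (ph k : Cfg m n N → ℂ) := by
  unfold ph; fun_prop

lemma ph_norm (k : Fin N → Fin n → ℤ) (x : Cfg m n N) : ‖ph k x‖ = 1 := by
  unfold ph
  rw [norm_prod]
  refine Finset.prod_eq_one fun β _ => ?_
  rw [norm_prod]
  refine Finset.prod_eq_one fun j _ => ?_
  rw [fourier_apply]
  exact Circle.norm_coe _

lemma Efun_cont (b : ℂ) (e : Fin N → Fin m → ℂ) (k : Fin N → Fin n → ℤ) : Continuous (Efun b e k) := by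
  unfold Efun
  refine Continuous.mul ?_ (ph_cont k)
  fun_prop

lemma Efac_cont (b : ℂ) (e : Fin N → Fin m → ℂ) (k : Fin N → Fin n → ℤ) : Continuous (Efac b e k) := by
  unfold Efac
  fun_prop

lemma gau_integrable (κ : ℝ) (hκ : 0 < κ) : Integrable (gau κ : Cfg m n N → ℝ) := by
  have h1 : Integrable (fun y : Fin m → ℝ => ∏ i, Real.exp (-κ * y i ^ 2)) :=
    Integrable.fintype_prod (fun i => integrable_exp_neg_mul_sq hκ)
  have h2 : Integrable (fun w : Wg m n => (∏ i, Real.exp (-κ * w.1 i ^ 2)) * (1:ℝ)) := by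
    rw [Measure.volume_eq_prod]
    exact h1.mul_prod (g := fun _ : Torus n => (1:ℝ)) (integrable_const 1)
  have h3 : Integrable (fun x : Cfg m n N => ∏ β, ((∏ i, Real.exp (-κ * (x β).1 i ^ 2)) * (1:ℝ))) :=
    Integrable.fintype_prod (fun β => h2)
  refine h3.congr (Filter.Eventually.of_forall fun x => ?_)
  simp only [gau, Sq, mul_one]
  rw [Finset.mul_sum, Real.exp_sum]
  refine Finset.prod_congr rfl fun β _ => ?_
  rw [Finset.mul_sum, Real.exp_sum]

lemma gau_memLp (κ : ℝ) (hκ : 0 < κ) : MemLp (gau κ : Cfg m n N → ℝ) 2 := by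
  rw [memLp_two_iff_integrable_sq (gau_cont κ).aestronglyMeasurable]
  refine (gau_integrable (2 * κ) (by linarith)).congr (Filter.Eventually.of_forall fun x => ?_)
  simp only
  rw [sq, gau_mul, two_mul]

lemma memLp_of_gau {f : Cfg m n N → ℂ} (hf : AEStronglyMeasurable f) (C κ : ℝ) (hκ : 0 < κ)
    (h : ∀ x, ‖f x‖ ≤ C * gau κ x) : MemLp f 2 := by
  refine ((gau_memLp κ hκ).const_mul C).mono hf (Filter.Eventually.of_forall fun x => ?_)
  exact (h x).trans (le_abs_self _)

lemma Efun_bound (b : ℂ) (e : Fin N → Fin m → ℂ) (k : Fin N → Fin n → ℤ) (r M : ℝ) (hr : 0 < r)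
    (hb : r ≤ b.re) (he : ∀ β i, ‖e β i‖ ≤ M) (x : Cfg m n N) :
    ‖Efun b e k x‖ ≤ Real.exp (N * (m * (M ^ 2 / (2 * r)))) * gau (r / 2) x := by
  unfold Efun gau Sq
  rw [norm_mul, ph_norm, mul_one, Complex.norm_exp, ← Real.exp_add]
  apply Real.exp_le_exp.2
  rw [Complex.re_sum, Finset.mul_sum]
  have : (N:ℝ) * (m * (M ^ 2 / (2 * r))) = ∑ β : Fin N, ∑ i : Fin m, M ^ 2 / (2 * r) := by simp
  rw [this, ← Finset.sum_add_distrib]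
  refine Finset.sum_le_sum fun β _ => ?_
  rw [Complex.re_sum, Finset.mul_sum, ← Finset.sum_add_distrib]
  refine Finset.sum_le_sum fun i _ => ?_
  set y := (x β).1 i
  have h1 : (-b * (y:ℂ) ^ 2 + e β i * (y:ℂ)).re = -b.re * y ^ 2 + (e β i).re * y := by
    rw [← Complex.ofReal_pow]
    simp only [Complex.add_re, Complex.mul_re, Complex.neg_re, Complex.ofReal_re, Complex.ofReal_im]
    ring
  rw [h1]
  have h2 : |(e β i).re| ≤ M := (Complex.abs_re_le_norm _).trans (he β i)
  have h3 : (e β i).re * y ≤ M * |y| := by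
    calc _ ≤ |(e β i).re * y| := le_abs_self _
      _ = |(e β i).re| * |y| := abs_mul _ _
      _ ≤ _ := by gcongr
  have h4 : M * |y| ≤ M ^ 2 / (2 * r) + r / 2 * y ^ 2 := by
    have : M ^ 2 / (2 * r) + r / 2 * y ^ 2 - M * |y| = (M - r * |y|) ^ 2 / (2 * r) := by
      rw [← sq_abs y]; field_simp; ring
    have h5 : 0 ≤ (M - r * |y|) ^ 2 / (2 * r) := by positivity
    linarith
  nlinarith [sq_nonneg y]

lemma one_add_le_gau (r : ℝ) (hr : 0 < r) (x : Cfg m n N) :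
    (1 + Sq x) * gau r x ≤ (1 + 2 / r) * gau (r / 2) x := by
  have h := Real.add_one_le_exp (r / 2 * Sq x)
  have h1 : 1 + Sq x ≤ (1 + 2 / r) * Real.exp (r / 2 * Sq x) := by
    have h2 := Sq_nonneg x
    calc 1 + Sq x ≤ (1 + 2 / r) * (r / 2 * Sq x + 1) := by
          have : (1 + 2 / r) * (r / 2 * Sq x + 1) = 1 + Sq x + (r / 2 * Sq x + 2 / r) := by
            field_simp; ring
          rw [this]
          have : 0 ≤ r / 2 * Sq x + 2 / r := by positivity
          linarith
      _ ≤ _ := by gcongr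
  calc _ ≤ (1 + 2 / r) * Real.exp (r / 2 * Sq x) * gau r x := by
        gcongr; exact (gau_pos _ _).le
    _ = _ := by
      unfold gau
      rw [mul_assoc, ← Real.exp_add]; ring_nf

/-- A constant controlling the first and second logarithmic derivatives. -/
def facC (m n N : ℕ) (M : ℝ) (k : Fin N → Fin n → ℤ) : ℝ :=
  8 * M ^ 2 + N * (m * (2 * M ^ 2 + 2 * M)) + ‖k2 k‖

lemma facC_nonneg (M : ℝ) (hM : 0 ≤ M) (k : Fin N → Fin n → ℤ) : 0 ≤ facC m n N M k := by
  unfold facC; positivity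

lemma term_bound (b e : ℂ) (M : ℝ) (hb : ‖b‖ ≤ M) (he : ‖e‖ ≤ M) (y : ℝ) :
    ‖(-2 * b * (y:ℂ) + e) ^ 2 - 2 * b‖ ≤ 8 * M ^ 2 * y ^ 2 + (2 * M ^ 2 + 2 * M) := by
  have hM : 0 ≤ M := (norm_nonneg _).trans hb
  have h1 : ‖-2 * b * (y:ℂ) + e‖ ≤ 2 * M * |y| + M := by
    refine (norm_add_le _ _).trans ?_
    have : ‖-2 * b * (y:ℂ)‖ = 2 * ‖b‖ * |y| := by simp
    rw [this]; gcongr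
  calc _ ≤ ‖-2 * b * (y:ℂ) + e‖ ^ 2 + 2 * ‖b‖ := by
        refine (norm_sub_le _ _).trans ?_
        rw [norm_pow, norm_mul]; simp
    _ ≤ (2 * M * |y| + M) ^ 2 + 2 * M := by gcongr
    _ ≤ _ := by
      rw [← sq_abs y]
      nlinarith [sq_nonneg (2 * M * |y| - M)]

lemma Efac_bound (b : ℂ) (e : Fin N → Fin m → ℂ) (k : Fin N → Fin n → ℤ) (M : ℝ)
    (hb : ‖b‖ ≤ M) (he : ∀ β i, ‖e β i‖ ≤ M) (x : Cfg m n N) :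
    ‖Efac b e k x‖ ≤ facC m n N M k * (1 + Sq x) := by
  have hM : 0 ≤ M := (norm_nonneg _).trans hb
  unfold Efac facC
  have h1 : ‖∑ β, ∑ i, ((-2 * b * ((x β).1 i : ℂ) + e β i) ^ 2 - 2 * b)‖ ≤
      8 * M ^ 2 * Sq x + N * (m * (2 * M ^ 2 + 2 * M)) := by
    have : 8 * M ^ 2 * Sq x + N * (m * (2 * M ^ 2 + 2 * M)) =
      ∑ β, ∑ i, (8 * M ^ 2 * (x β).1 i ^ 2 + (2 * M ^ 2 + 2 * M)) := by
      unfold Sq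
      simp only [Finset.sum_add_distrib, Finset.mul_sum]; simp; ring
    rw [this]
    refine (norm_sum_le _ _).trans (Finset.sum_le_sum fun β _ => ?_)
    refine (norm_sum_le _ _).trans (Finset.sum_le_sum fun i _ => ?_)
    exact term_bound b _ M hb (he β i) _
  refine (norm_sub_le _ _).trans ?_
  have hS := Sq_nonneg x
  have hP : 0 ≤ (N:ℝ) * (m * (2 * M ^ 2 + 2 * M)) := by positivity
  have hk := norm_nonneg (k2 k)
  have h3 : (8 * M ^ 2 + N * (m * (2 * M ^ 2 + 2 * M)) + ‖k2 k‖) * (1 + Sq x) =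
    8 * M ^ 2 * Sq x + N * (m * (2 * M ^ 2 + 2 * M)) + ‖k2 k‖ + (8 * M ^ 2 +
      (N * (m * (2 * M ^ 2 + 2 * M)) + ‖k2 k‖) * Sq x) := by ring
  rw [h3]
  have : 0 ≤ 8 * M ^ 2 + (N * (m * (2 * M ^ 2 + 2 * M)) + ‖k2 k‖) * Sq x := by positivity
  linarith

lemma EfacE_bound (k : Fin N → Fin n → ℤ) (r M : ℝ) (hr : 0 < r) :
    ∃ C : ℝ, 0 ≤ C ∧ ∀ (b : ℂ) (e : Fin N → Fin m → ℂ), r ≤ b.re → ‖b‖ ≤ M → (∀ β i, ‖e β i‖ ≤ M) →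
      ∀ x : Cfg m n N, (1 + Sq x) * ‖Efun b e k x‖ ≤ C * gau (r / 4) x ∧
        ‖Efac b e k x * Efun b e k x‖ ≤ C * gau (r / 4) x := by
  by_cases hM : 0 ≤ M
  swap
  · refine ⟨0, le_rfl, fun b e _ hb => ?_⟩
    exact absurd ((norm_nonneg _).trans hb) hM
  set C0 := Real.exp (N * (m * (M ^ 2 / (2 * r)))) * (1 + 2 / (r / 2))
  have hC0 : 0 ≤ C0 := by positivity
  have hf := facC_nonneg (m := m) M hM k
  refine ⟨(facC m n N M k + 1) * C0, by positivity, fun b e hbr hb he x => ?_⟩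
  have h0 : (1 + Sq x) * ‖Efun b e k x‖ ≤ C0 * gau (r / 4) x := by
    have hS := Sq_nonneg x
    calc _ ≤ (1 + Sq x) * (Real.exp (N * (m * (M ^ 2 / (2 * r)))) * gau (r / 2) x) := by
          gcongr; exact Efun_bound b e k r M hr hbr he x
      _ = Real.exp (N * (m * (M ^ 2 / (2 * r)))) * ((1 + Sq x) * gau (r / 2) x) := by ring
      _ ≤ Real.exp (N * (m * (M ^ 2 / (2 * r)))) * ((1 + 2 / (r / 2)) * gau (r / 2 / 2) x) := by
          exact mul_le_mul_of_nonneg_left (one_add_le_gau (r / 2) (by positivity) x) (Real.exp_pos _).le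
      _ = _ := by rw [show r / 2 / 2 = r / 4 by ring]; ring
  have hg := gau_pos (r / 4) x
  constructor
  · refine h0.trans ?_
    have : 0 ≤ facC m n N M k * C0 * gau (r / 4) x := by positivity
    nlinarith
  · rw [norm_mul]
    calc _ ≤ facC m n N M k * (1 + Sq x) * ‖Efun b e k x‖ := by
          gcongr; exact Efac_bound b e k M hb he x
      _ = facC m n N M k * ((1 + Sq x) * ‖Efun b e k x‖) := by ring
      _ ≤ facC m n N M k * (C0 * gau (r / 4) x) := by gcongr
      _ ≤ _ := by
        have : 0 ≤ C0 * gau (r / 4) x := by positivity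
        nlinarith

end ManyBodyWaveguide

namespace ManyBodyWaveguide

/-- Dominated convergence in `L²`. -/
lemma L2_dct {X ι : Type*} [MeasurableSpace X] {μ : Measure X} {l : Filter ι} [l.IsCountablyGenerated]
    (f : ι → X → ℂ) (f0 : X → ℂ) (g : X → ℝ) (hf : ∀ i, MemLp (f i) 2 μ) (hf0 : MemLp f0 2 μ)
    (hg : MemLp g 2 μ) (hb : ∀ᶠ i in l, ∀ᵐ x ∂μ, ‖f i x‖ ≤ g x) (hb0 : ∀ᵐ x ∂μ, ‖f0 x‖ ≤ g x)
    (hlim : ∀ᵐ x ∂μ, Filter.Tendsto (fun i => f i x) l (nhds (f0 x))) :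
    Filter.Tendsto (fun i => (hf i).toLp) l (nhds hf0.toLp) := by
  rw [Lp.tendsto_Lp_iff_tendsto_eLpNorm'']
  have h1 : ∀ i, eLpNorm (f i - f0) 2 μ = (∫⁻ x, ‖f i x - f0 x‖ₑ ^ (2:ℝ) ∂μ) ^ (1/2:ℝ) := by
    intro i
    rw [eLpNorm_eq_lintegral_rpow_enorm_toReal (by norm_num) (by norm_num)]
    simp
  simp_rw [h1]
  have h2 : Filter.Tendsto (fun i => ∫⁻ x, ‖f i x - f0 x‖ₑ ^ (2:ℝ) ∂μ) l (nhds (∫⁻ x, 0 ∂μ)) := by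
    refine tendsto_lintegral_filter_of_dominated_convergence' (fun x => (‖2 * g x‖ₑ) ^ (2:ℝ)) ?_ ?_ ?_ ?_
    · filter_upwards with i
      exact (((hf i).1.sub hf0.1).enorm).pow_const _
    · filter_upwards [hb] with i hi
      filter_upwards [hi, hb0] with x hx hx0
      gcongr
      rw [enorm_le_iff_norm_le]
      refine (norm_sub_le _ _).trans (le_trans ?_ (le_abs_self _))
      linarith
    · have := (hg.const_mul 2).2
      have h3 := lintegral_rpow_enorm_lt_top_of_eLpNorm_lt_top (p := 2) (by norm_num) (by norm_num) this
      simpa using h3.ne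
    · filter_upwards [hlim] with x hx
      have h4 : Filter.Tendsto (fun i => f i x - f0 x) l (nhds 0) := by
        simpa using hx.sub_const (f0 x)
      have h5 : Filter.Tendsto (fun i => ‖f i x - f0 x‖ₑ) l (nhds 0) := by
        simpa using h4.enorm
      have h6 := (ENNReal.continuous_rpow_const (y := (2:ℝ))).tendsto 0
      simpa [Function.comp_def] using h6.comp h5
  have h7 := ((ENNReal.continuous_rpow_const (y := (1/2:ℝ))).tendsto _).comp h2
  simpa [Function.comp_def] using h7

section pairing
variable {X : Type*} [MeasurableSpace X] {μ : Measure X}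

lemma Lp_norm_star (g : Lp ℂ 2 μ) : ‖star g‖ = ‖g‖ := by
  rw [Lp.norm_def, Lp.norm_def]
  congr 1
  apply eLpNorm_congr_norm_ae
  filter_upwards [Lp.coeFn_star g] with x hx
  rw [hx]; simp

lemma Lp_star_sub (g h : Lp ℂ 2 μ) : star (g - h) = star g - star h := by
  apply Lp.ext
  filter_upwards [Lp.coeFn_star (g - h), Lp.coeFn_sub g h, Lp.coeFn_sub (star g) (star h),
    Lp.coeFn_star g, Lp.coeFn_star h] with x h1 h2 h3 h4 h5
  rw [h1, h3, Pi.star_apply, h2, Pi.sub_apply, Pi.sub_apply, h4, h5]; simp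

lemma Lp_star_add (g h : Lp ℂ 2 μ) : star (g + h) = star g + star h := by
  apply Lp.ext
  filter_upwards [Lp.coeFn_star (g + h), Lp.coeFn_add g h, Lp.coeFn_add (star g) (star h),
    Lp.coeFn_star g, Lp.coeFn_star h] with x h1 h2 h3 h4 h5
  rw [h1, h3, Pi.star_apply, h2, Pi.add_apply, Pi.add_apply, h4, h5]; simp

/-- The bilinear pairing `∫ g v`. -/
def pr (g v : Lp ℂ 2 μ) : ℂ := inner ℂ (star g) v

lemma pr_eq (g v : Lp ℂ 2 μ) : pr g v = ∫ x, g x * v x ∂μ := by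
  unfold pr
  rw [L2.inner_def]
  apply integral_congr_ae
  filter_upwards [Lp.coeFn_star g] with x hx
  rw [hx]
  simp [mul_comm]

lemma pr_le (g v : Lp ℂ 2 μ) : ‖pr g v‖ ≤ ‖g‖ * ‖v‖ := by
  unfold pr
  refine (norm_inner_le_norm _ _).trans ?_
  rw [Lp_norm_star]

lemma pr_toLp {f : X → ℂ} (hf : MemLp f 2 μ) (v : Lp ℂ 2 μ) :
    pr hf.toLp v = ∫ x, f x * v x ∂μ := by
  rw [pr_eq]
  apply integral_congr_ae
  filter_upwards [hf.coeFn_toLp] with x hx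
  rw [hx]

lemma pr_sub_left (g h v : Lp ℂ 2 μ) : pr (g - h) v = pr g v - pr h v := by
  unfold pr; rw [Lp_star_sub, inner_sub_left]

lemma pr_add_left (g h v : Lp ℂ 2 μ) : pr (g + h) v = pr g v + pr h v := by
  unfold pr; rw [Lp_star_add, inner_add_left]

lemma pr_smul_left (c : ℂ) (g v : Lp ℂ 2 μ) : pr (c • g) v = c * pr g v := by
  rw [pr_eq, pr_eq, ← integral_const_mul]
  apply integral_congr_ae
  filter_upwards [Lp.coeFn_smul c g] with x hx
  rw [hx]; simp [mul_assoc]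

lemma pr_sub_right (g u v : Lp ℂ 2 μ) : pr g (u - v) = pr g u - pr g v := by
  unfold pr; rw [inner_sub_right]

lemma norm_le_of_pr (g : Lp ℂ 2 μ) (C : ℝ) (hC : 0 ≤ C) (h : ∀ v, ‖pr g v‖ ≤ C * ‖v‖) : ‖g‖ ≤ C := by
  have h1 := h (star g)
  unfold pr at h1
  rw [Lp_norm_star, inner_self_eq_norm_sq_to_K, Lp_norm_star] at h1
  have h2 : ‖(((‖g‖ : ℝ) : ℂ)) ^ 2‖ = ‖g‖ * ‖g‖ := by simp [sq]
  by_contra hc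
  push Not at hc
  have h3 : 0 < ‖g‖ := lt_of_le_of_lt hC hc
  have h4 : ‖g‖ * ‖g‖ ≤ C * ‖g‖ := by rw [← h2]; exact h1
  nlinarith

lemma inner_eq_pr (g v : Lp ℂ 2 μ) : inner ℂ g v = pr (star g) v := by
  unfold pr; rw [star_star]

end pairing

lemma secondDeriv_line {V : Type*} [NormedAddCommGroup V] [NormedSpace ℝ V] (f : V → ℂ)
    (hf : ContDiff ℝ 2 f) (x v : V) (g g' : ℝ → ℂ) (g'' : ℂ) (hg : ∀ ε : ℝ, f (x + ε • v) = g ε)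
    (h1 : ∀ ε, HasDerivAt g (g' ε) ε) (h2 : HasDerivAt g' g'' 0) : secondDeriv f x v = g'' := by
  have hline : ∀ ε : ℝ, HasDerivAt (fun ε : ℝ => x + ε • v) v ε := by
    intro ε
    simpa using ((hasDerivAt_id ε).smul_const v).const_add x
  have hd : ∀ y, DifferentiableAt ℝ f y := fun y => hf.differentiable (by norm_num) y
  have e1 : ∀ ε : ℝ, fderiv ℝ f (x + ε • v) v = g' ε := by
    intro ε
    have := (hd (x + ε • v)).hasFDerivAt.comp_hasDerivAt ε (hline ε)
    have h3 : HasDerivAt g (fderiv ℝ f (x + ε • v) v) ε := by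
      refine this.congr_of_eventuallyEq (Filter.Eventually.of_forall fun ε => (hg ε).symm)
    exact h3.unique (h1 ε)
  unfold secondDeriv
  have hd2 : DifferentiableAt ℝ (fun y => fderiv ℝ f y v) x := by
    have : ContDiff ℝ 1 (fderiv ℝ f) := hf.fderiv_right (by norm_num)
    exact ((this.differentiable (by norm_num)) x).clm_apply (differentiableAt_const v)
  have hl0 := hline 0
  have hx : x = x + (0:ℝ) • v := by simp
  have h4 : HasFDerivAt (fun y => fderiv ℝ f y v) (fderiv ℝ (fun y => fderiv ℝ f y v) x) (x + (0:ℝ) • v) := by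
    rw [← hx]; exact hd2.hasFDerivAt
  have h5 := h4.comp_hasDerivAt 0 hl0
  have h6 : HasDerivAt g' (fderiv ℝ (fun y => fderiv ℝ f y v) x v) 0 := by
    refine h5.congr_of_eventuallyEq (Filter.Eventually.of_forall fun ε => (e1 ε).symm)
  exact h6.unique h2

lemma exists_cutoff : ∃ (ψ : ℝ → ℝ) (P : ℝ), ContDiff ℝ (⊤ : ℕ∞) ψ ∧ ψ 0 = 1 ∧ (∀ y, 0 ≤ ψ y) ∧
    (∀ y, ψ y ≤ 1) ∧ (∀ y, 2 ≤ |y| → ψ y = 0) ∧ 0 ≤ P ∧ (∀ y, |deriv ψ y| ≤ P) ∧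
    (∀ y, |deriv (deriv ψ) y| ≤ P) := by
  let b : ContDiffBump (0:ℝ) := ⟨1, 2, by norm_num, by norm_num⟩
  have hc : ContDiff ℝ (⊤ : ℕ∞) (b : ℝ → ℝ) := b.contDiff
  have hc1 : Continuous (deriv b) := hc.continuous_deriv (by norm_cast)
  have hcd1 : ContDiff ℝ 1 (deriv b) := by
    have : ContDiff ℝ (1 + 1) (b : ℝ → ℝ) := hc.of_le (by norm_cast)
    exact (contDiff_succ_iff_deriv.1 this).2.2
  have hc2 : Continuous (deriv (deriv b)) := hcd1.continuous_deriv (by norm_num)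
  have hs : HasCompactSupport (b : ℝ → ℝ) := b.hasCompactSupport
  obtain ⟨P1, hP1⟩ := hs.deriv.exists_bound_of_continuous hc1
  obtain ⟨P2, hP2⟩ := hs.deriv.deriv.exists_bound_of_continuous hc2
  refine ⟨b, max P1 P2, hc, ?_, fun y => b.nonneg, fun y => b.le_one, ?_, ?_, ?_, ?_⟩
  · exact b.one_of_mem_closedBall (by simp [b])
  · intro y hy
    apply b.zero_of_le_dist
    simpa [b] using hy
  · exact ((norm_nonneg _).trans (hP1 0)).trans (le_max_left _ _)
  · intro y; exact (hP1 y).trans (le_max_left _ _)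
  · intro y; exact (hP2 y).trans (le_max_right _ _)

end ManyBodyWaveguide

namespace ManyBodyWaveguide

variable {m n N : ℕ}

def cut (ψ : ℝ → ℝ) (R : ℝ) (x : Cfg m n N) : ℝ := ∏ p : Fin N × Fin m, ψ ((x p.1).1 p.2 / R)

def cutOff (ψ : ℝ → ℝ) (R : ℝ) (x : Cfg m n N) (q : Fin N × Fin m) : ℝ :=
  ∏ p ∈ Finset.univ.erase q, ψ ((x p.1).1 p.2 / R)

lemma fold_lift (x : Cfg m n N) : fold m n N (liftCfg m n N x) = x := by
  funext β
  refine Prod.ext rfl ?_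
  funext j
  exact (AddCircle.equivIco 1 0).symm_apply_apply ((x β).2 j)

lemma eY_coord (x : CfgE m n N) (ε : ℝ) (β0 : Fin N) (i0 : Fin m) (β : Fin N) (i : Fin m) :
    ((x + ε • eY m n N β0 i0) β).1 i = (x β).1 i + if (β, i) = (β0, i0) then ε else 0 := by
  unfold eY
  by_cases h : β = β0
  · subst h
    by_cases hi : i = i0
    · subst hi; simp
    · simp [hi]
  · simp [h]

lemma eY_coord2 (x : CfgE m n N) (ε : ℝ) (β0 : Fin N) (i0 : Fin m) (β : Fin N) (j : Fin n) :
    ((x + ε • eY m n N β0 i0) β).2 j = (x β).2 j := by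
  unfold eY
  by_cases h : β = β0
  · subst h; simp
  · simp [h]

lemma eZ_coord (x : CfgE m n N) (ε : ℝ) (β0 : Fin N) (i0 : Fin n) (β : Fin N) (i : Fin m) :
    ((x + ε • eZ m n N β0 i0) β).1 i = (x β).1 i := by
  unfold eZ
  by_cases h : β = β0
  · subst h; simp
  · simp [h]

lemma eZ_coord2 (x : CfgE m n N) (ε : ℝ) (β0 : Fin N) (i0 : Fin n) (β : Fin N) (i : Fin n) :
    ((x + ε • eZ m n N β0 i0) β).2 i = (x β).2 i + if (β, i) = (β0, i0) then ε else 0 := by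
  unfold eZ
  by_cases h : β = β0
  · subst h
    by_cases hi : i = i0
    · subst hi; simp
    · simp [hi]
  · simp [h]

lemma ph_fold (k : Fin N → Fin n → ℤ) (x : CfgE m n N) :
    ph k (fold m n N x) = Complex.exp (∑ p : Fin N × Fin n, 2 * Real.pi * Complex.I * k p.1 p.2 * ((x p.1).2 p.2 : ℂ)) := by
  unfold ph fold
  rw [Complex.exp_sum, Fintype.prod_prod_type]
  refine Finset.prod_congr rfl fun β _ => Finset.prod_congr rfl fun j _ => ?_
  simp only
  rw [fourier_coe_apply]
  simp

lemma Efun_fold (b : ℂ) (e : Fin N → Fin m → ℂ) (k : Fin N → Fin n → ℤ) (x : CfgE m n N) :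
    Efun b e k (fold m n N x) =
      Complex.exp (∑ p : Fin N × Fin m, (-b * ((x p.1).1 p.2 : ℂ) ^ 2 + e p.1 p.2 * ((x p.1).1 p.2 : ℂ))) *
      Complex.exp (∑ p : Fin N × Fin n, 2 * Real.pi * Complex.I * k p.1 p.2 * ((x p.1).2 p.2 : ℂ)) := by
  unfold Efun
  rw [ph_fold]
  congr 2
  rw [Fintype.sum_prod_type]
  rfl

lemma Efun_eY (b : ℂ) (e : Fin N → Fin m → ℂ) (k : Fin N → Fin n → ℤ) (x : CfgE m n N) (ε : ℝ)
    (β0 : Fin N) (i0 : Fin m) :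
    Efun b e k (fold m n N (x + ε • eY m n N β0 i0)) = Efun b e k (fold m n N x) *
      Complex.exp ((-2 * b * ((x β0).1 i0 : ℂ) + e β0 i0) * ε - b * (ε:ℂ) ^ 2) := by
  rw [Efun_fold, Efun_fold]
  simp_rw [eY_coord2, eY_coord]
  have : ∀ p : Fin N × Fin m,
      -b * (((x p.1).1 p.2 + if (p.1, p.2) = (β0, i0) then ε else 0 : ℝ) : ℂ) ^ 2 +
        e p.1 p.2 * (((x p.1).1 p.2 + if (p.1, p.2) = (β0, i0) then ε else 0 : ℝ) : ℂ) =
      (-b * ((x p.1).1 p.2 : ℂ) ^ 2 + e p.1 p.2 * ((x p.1).1 p.2 : ℂ)) +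
        if p = (β0, i0) then (-2 * b * ((x p.1).1 p.2 : ℂ) + e p.1 p.2) * ε - b * (ε:ℂ) ^ 2 else 0 := by
    intro p
    by_cases h : p = (β0, i0)
    · subst h; simp; ring
    · simp [h]
  simp_rw [this, Finset.sum_add_distrib]
  rw [Finset.sum_ite_eq', if_pos (Finset.mem_univ _), Complex.exp_add]
  ring

lemma Efun_eZ (b : ℂ) (e : Fin N → Fin m → ℂ) (k : Fin N → Fin n → ℤ) (x : CfgE m n N) (ε : ℝ)
    (β0 : Fin N) (i0 : Fin n) :
    Efun b e k (fold m n N (x + ε • eZ m n N β0 i0)) = Efun b e k (fold m n N x) *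
      Complex.exp ((2 * Real.pi * Complex.I * k β0 i0) * ε) := by
  rw [Efun_fold, Efun_fold]
  simp_rw [eZ_coord2, eZ_coord]
  have : ∀ p : Fin N × Fin n,
      2 * Real.pi * Complex.I * k p.1 p.2 * (((x p.1).2 p.2 + if (p.1, p.2) = (β0, i0) then ε else 0 : ℝ) : ℂ) =
      2 * Real.pi * Complex.I * k p.1 p.2 * ((x p.1).2 p.2 : ℂ) +
        if p = (β0, i0) then (2 * Real.pi * Complex.I * k p.1 p.2) * (ε:ℂ) else 0 := by
    intro p
    by_cases h : p = (β0, i0)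
    · subst h; simp; ring
    · simp [h]
  have h2 := Finset.sum_congr (rfl : (Finset.univ : Finset (Fin N × Fin n)) = _) (fun p _ => this p)
  rw [Finset.sum_add_distrib (s := (Finset.univ : Finset (Fin N × Fin n))), Finset.sum_ite_eq',
    if_pos (Finset.mem_univ _)] at h2
  rw [h2, Complex.exp_add (∑ p : Fin N × Fin n, _)]
  ring

lemma cut_eY (ψ : ℝ → ℝ) (R : ℝ) (x : CfgE m n N) (ε : ℝ) (β0 : Fin N) (i0 : Fin m) :
    cut ψ R (fold m n N (x + ε • eY m n N β0 i0)) =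
      ψ (((x β0).1 i0 + ε) / R) * cutOff ψ R (fold m n N x) (β0, i0) := by
  unfold cut cutOff
  rw [← Finset.mul_prod_erase _ _ (Finset.mem_univ (β0, i0))]
  congr 1
  · show ψ (((x + ε • eY m n N β0 i0) β0).1 i0 / R) = _
    rw [eY_coord]; simp
  · refine Finset.prod_congr rfl fun p hp => ?_
    show ψ (((x + ε • eY m n N β0 i0) p.1).1 p.2 / R) = ψ ((x p.1).1 p.2 / R)
    rw [eY_coord, if_neg (Finset.ne_of_mem_erase hp), add_zero]

lemma cut_eZ (ψ : ℝ → ℝ) (R : ℝ) (x : CfgE m n N) (ε : ℝ) (β0 : Fin N) (i0 : Fin n) :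
    cut ψ R (fold m n N (x + ε • eZ m n N β0 i0)) = cut ψ R (fold m n N x) := by
  unfold cut
  refine Finset.prod_congr rfl fun p _ => ?_
  show ψ (((x + ε • eZ m n N β0 i0) p.1).1 p.2 / R) = ψ ((x p.1).1 p.2 / R)
  rw [eZ_coord]

lemma cut_split (ψ : ℝ → ℝ) (R : ℝ) (x : Cfg m n N) (q : Fin N × Fin m) :
    cut ψ R x = ψ ((x q.1).1 q.2 / R) * cutOff ψ R x q := by
  unfold cut cutOff
  rw [← Finset.mul_prod_erase _ _ (Finset.mem_univ q)]

/-- The truncated Gaussian. -/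
def phi (ψ : ℝ → ℝ) (R : ℝ) (b : ℂ) (e : Fin N → Fin m → ℂ) (k : Fin N → Fin n → ℤ) (x : Cfg m n N) : ℂ :=
  (cut ψ R x : ℂ) * Efun b e k x

lemma phi_smooth (ψ : ℝ → ℝ) (hψ : ContDiff ℝ (⊤ : ℕ∞) ψ) (R : ℝ) (b : ℂ) (e : Fin N → Fin m → ℂ)
    (k : Fin N → Fin n → ℤ) : ContDiff ℝ (⊤ : ℕ∞) (phi ψ R b e k ∘ fold m n N) := by
  have h1 : phi ψ R b e k ∘ fold m n N = fun x => ((∏ p : Fin N × Fin m, ψ ((x p.1).1 p.2 / R) : ℝ) : ℂ) *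
      (Complex.exp (∑ p : Fin N × Fin m, (-b * ((x p.1).1 p.2 : ℂ) ^ 2 + e p.1 p.2 * ((x p.1).1 p.2 : ℂ))) *
      Complex.exp (∑ p : Fin N × Fin n, 2 * Real.pi * Complex.I * k p.1 p.2 * ((x p.1).2 p.2 : ℂ))) := by
    funext x
    simp only [Function.comp, phi]
    rw [Efun_fold]; rfl
  rw [h1]
  have hof : ContDiff ℝ (⊤ : ℕ∞) (fun r : ℝ => (r : ℂ)) := Complex.ofRealCLM.contDiff
  have hY : ∀ p : Fin N × Fin m, ContDiff ℝ (⊤ : ℕ∞) (fun x : CfgE m n N => (x p.1).1 p.2) := by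
    intro p; fun_prop
  have hZ : ∀ p : Fin N × Fin n, ContDiff ℝ (⊤ : ℕ∞) (fun x : CfgE m n N => (x p.1).2 p.2) := by
    intro p; fun_prop
  refine ContDiff.mul ?_ (ContDiff.mul ?_ ?_)
  · apply hof.comp
    apply contDiff_prod
    intro p _
    exact hψ.comp ((hY p).div_const R)
  · apply ContDiff.cexp
    apply ContDiff.sum
    intro p _
    have := hof.comp (hY p)
    simp only [Function.comp_def] at this
    exact (contDiff_const.mul (this.pow 2)).add (contDiff_const.mul this)
  · apply ContDiff.cexp
    apply ContDiff.sum
    intro p _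
    have := hof.comp (hZ p)
    exact contDiff_const.mul this

lemma phi_test (ψ : ℝ → ℝ) (hψ : ContDiff ℝ (⊤ : ℕ∞) ψ) (hψ2 : ∀ y, 2 ≤ |y| → ψ y = 0) (R : ℝ) (hR : 0 < R)
    (b : ℂ) (e : Fin N → Fin m → ℂ) (k : Fin N → Fin n → ℤ) : IsTest m n N (phi ψ R b e k) := by
  refine ⟨phi_smooth ψ hψ R b e k, ?_⟩
  have hK : IsCompact (Set.pi Set.univ (fun _ : Fin N =>
      (Set.pi Set.univ (fun _ : Fin m => Set.Icc (-(2*R)) (2*R))) ×ˢ (Set.univ : Set (Torus n)))) := by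
    apply isCompact_univ_pi
    intro β
    exact (isCompact_univ_pi fun i => isCompact_Icc).prod isCompact_univ
  refine HasCompactSupport.intro hK ?_
  intro x hx
  have : ∃ p : Fin N × Fin m, 2 ≤ |(x p.1).1 p.2 / R| := by
    by_contra hcon
    push Not at hcon
    apply hx
    intro β _
    refine ⟨?_, trivial⟩
    intro i _
    have h1 := hcon (β, i)
    rw [abs_div, abs_of_pos hR, div_lt_iff₀ hR] at h1
    exact abs_le.1 h1.le
  obtain ⟨p, hp⟩ := this
  unfold phi cut
  rw [Finset.prod_eq_zero (Finset.mem_univ p) (hψ2 _ hp)]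
  simp

/-- Coordinate second derivative factor. -/
def Xfac (ψ : ℝ → ℝ) (R : ℝ) (A B : ℂ) (y c : ℝ) : ℂ :=
  ((c * (deriv (deriv ψ) (y / R) / R ^ 2) : ℝ) : ℂ) + 2 * A * ((c * (deriv ψ (y / R) / R) : ℝ) : ℂ) +
    (A ^ 2 - 2 * B) * ((ψ (y / R) * c : ℝ) : ℂ)

lemma line_deriv (ψ : ℝ → ℝ) (hψ : ContDiff ℝ (⊤ : ℕ∞) ψ) (R : ℝ) (A B E0 : ℂ) (y c : ℝ)
    (f : CfgE m n N → ℂ) (hf : ContDiff ℝ 2 f) (x v : CfgE m n N)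
    (hg : ∀ ε : ℝ, f (x + ε • v) = ((ψ ((y + ε) / R) * c : ℝ) : ℂ) * (E0 * Complex.exp (A * ε - B * (ε:ℂ) ^ 2))) :
    secondDeriv f x v = E0 * Xfac ψ R A B y c := by
  have hd1 : ∀ z, HasDerivAt ψ (deriv ψ z) z := fun z =>
    (hψ.differentiable (by norm_num) z).hasDerivAt
  have hcd1 : ContDiff ℝ 1 (deriv ψ) := by
    have : ContDiff ℝ (1 + 1) ψ := hψ.of_le (by norm_cast)
    exact (contDiff_succ_iff_deriv.1 this).2.2
  have hd2 : ∀ z, HasDerivAt (deriv ψ) (deriv (deriv ψ) z) z := fun z =>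
    (hcd1.differentiable (by norm_num) z).hasDerivAt
  have hin : ∀ ε : ℝ, HasDerivAt (fun ε : ℝ => (y + ε) / R) (1 / R) ε := fun ε => by
    simpa using ((hasDerivAt_id ε).const_add y).div_const R
  have hX1 : ∀ ε : ℝ, HasDerivAt (fun ε : ℝ => ((ψ ((y + ε) / R) * c : ℝ) : ℂ))
      ((deriv ψ ((y + ε) / R) * (1 / R) * c : ℝ) : ℂ) ε := fun ε => by
    exact (((hd1 _).comp ε (hin ε)).mul_const c).ofReal_comp
  have hX2 : HasDerivAt (fun ε : ℝ => ((deriv ψ ((y + ε) / R) * (1 / R) * c : ℝ) : ℂ))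
      ((deriv (deriv ψ) ((y + 0) / R) * (1 / R) * (1 / R) * c : ℝ) : ℂ) 0 := by
    exact ((((hd2 _).comp 0 (hin 0)).mul_const (1 / R)).mul_const c).ofReal_comp
  have hP : ∀ ε : ℝ, HasDerivAt (fun ε : ℝ => A * (ε:ℂ) - B * (ε:ℂ) ^ 2) (A - 2 * B * ε) ε := fun ε => by
    have h0 : HasDerivAt (fun ε : ℝ => (ε : ℂ)) 1 ε := by
      simpa using (hasDerivAt_id ε).ofReal_comp
    have h1 := (h0.const_mul A).sub ((h0.pow 2).const_mul B)
    refine h1.congr_deriv ?_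
    simp; ring
  have hE : ∀ ε : ℝ, HasDerivAt (fun ε : ℝ => E0 * Complex.exp (A * (ε:ℂ) - B * (ε:ℂ) ^ 2))
      (E0 * (Complex.exp (A * (ε:ℂ) - B * (ε:ℂ) ^ 2) * (A - 2 * B * ε))) ε := fun ε =>
    ((hP ε).cexp).const_mul E0
  have hA : HasDerivAt (fun ε : ℝ => A - 2 * B * (ε:ℂ)) (- (2 * B)) 0 := by
    have h0 : HasDerivAt (fun ε : ℝ => (ε : ℂ)) 1 0 := by
      simpa using (hasDerivAt_id (0:ℝ)).ofReal_comp
    simpa using (h0.const_mul (2 * B)).const_sub A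
  have hE2 : HasDerivAt (fun ε : ℝ => E0 * (Complex.exp (A * (ε:ℂ) - B * (ε:ℂ) ^ 2) * (A - 2 * B * ε)))
      (E0 * (Complex.exp (A * ((0:ℝ):ℂ) - B * ((0:ℝ):ℂ) ^ 2) * (A - 2 * B * ((0:ℝ):ℂ)) * (A - 2 * B * ((0:ℝ):ℂ)) +
        Complex.exp (A * ((0:ℝ):ℂ) - B * ((0:ℝ):ℂ) ^ 2) * (-(2 * B)))) 0 :=
    ((((hP 0).cexp).mul hA)).const_mul E0
  have hfin := ((hX2.mul (hE 0)).add ((hX1 0).mul hE2))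
  rw [secondDeriv_line f hf x v _ _ _ hg (fun ε => (hX1 ε).mul (hE ε)) hfin]
  unfold Xfac
  simp
  ring

lemma lap_phi (ψ : ℝ → ℝ) (hψ : ContDiff ℝ (⊤ : ℕ∞) ψ) (R : ℝ)
    (b : ℂ) (e : Fin N → Fin m → ℂ) (k : Fin N → Fin n → ℤ) (x : Cfg m n N) :
    lap m n N (phi ψ R b e k) x = Efun b e k x *
      ((∑ β, ∑ i, Xfac ψ R (-2 * b * ((x β).1 i : ℂ) + e β i) b ((x β).1 i) (cutOff ψ R x (β, i))) -
        k2 k * (cut ψ R x : ℂ)) := by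
  have hs : ContDiff ℝ 2 (phi ψ R b e k ∘ fold m n N) := (phi_smooth ψ hψ R b e k).of_le (by norm_cast)
  unfold lap laplacianE
  set X := liftCfg m n N x with hX
  have hx : fold m n N X = x := fold_lift x
  have hY : ∀ β i, secondDeriv (phi ψ R b e k ∘ fold m n N) X (eY m n N β i) =
      Efun b e k x * Xfac ψ R (-2 * b * ((x β).1 i : ℂ) + e β i) b ((x β).1 i) (cutOff ψ R x (β, i)) := by
    intro β i
    apply line_deriv ψ hψ R _ _ _ _ _ _ hs
    intro ε
    simp only [Function.comp, phi]
    rw [cut_eY, Efun_eY, hx]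
    rfl
  have hZ : ∀ β j, secondDeriv (phi ψ R b e k ∘ fold m n N) X (eZ m n N β j) =
      Efun b e k x * (-(4 * Real.pi ^ 2 * (k β j : ℂ) ^ 2) * (cut ψ R x : ℂ)) := by
    intro β j
    rw [line_deriv (fun _ => 1) contDiff_const R (2 * Real.pi * Complex.I * k β j) 0 (Efun b e k x) 0 (cut ψ R x)
      _ hs X (eZ m n N β j)]
    · unfold Xfac
      simp
      linear_combination (Efun b e k x * 4 * Real.pi ^ 2 * (k β j : ℂ) ^ 2 * (cut ψ R x : ℂ)) * Complex.I_sq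
    · intro ε
      simp only [Function.comp, phi]
      rw [cut_eZ, Efun_eZ, hx]
      simp
  simp_rw [hY, hZ]
  unfold k2
  simp_rw [Finset.sum_add_distrib, ← Finset.mul_sum]
  rw [← mul_add]
  congr 1
  rw [sub_eq_add_neg]
  congr 1
  simp only [neg_mul, Finset.sum_neg_distrib, ← Finset.mul_sum, ← Finset.sum_mul]

end ManyBodyWaveguide

namespace ManyBodyWaveguide

variable {m n N : ℕ}

lemma exists_M (b : ℂ) (e : Fin N → Fin m → ℂ) : ∃ M : ℝ, 0 ≤ M ∧ ‖b‖ ≤ M ∧ ∀ β i, ‖e β i‖ ≤ M := by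
  refine ⟨‖b‖ + ∑ β, ∑ i, ‖e β i‖, by positivity, by
    have : 0 ≤ ∑ β, ∑ i, ‖e β i‖ := by positivity
    linarith, fun β i => ?_⟩
  have h1 : ‖e β i‖ ≤ ∑ i, ‖e β i‖ :=
    Finset.single_le_sum (f := fun i => ‖e β i‖) (fun _ _ => norm_nonneg _) (Finset.mem_univ i)
  have h2 : ∑ i, ‖e β i‖ ≤ ∑ β, ∑ i, ‖e β i‖ :=
    Finset.single_le_sum (f := fun β => ∑ i, ‖e β i‖) (fun _ _ => by positivity) (Finset.mem_univ β)
  have := norm_nonneg b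
  linarith

lemma Efun_memLp (b : ℂ) (hb : 0 < b.re) (e : Fin N → Fin m → ℂ) (k : Fin N → Fin n → ℤ) :
    MemLp (Efun b e k) 2 := by
  obtain ⟨M, hM, h1, h2⟩ := exists_M b e
  exact memLp_of_gau (Efun_cont b e k).aestronglyMeasurable _ _ (half_pos hb)
    (Efun_bound b e k b.re M hb le_rfl h2)

lemma EfacE_memLp (b : ℂ) (hb : 0 < b.re) (e : Fin N → Fin m → ℂ) (k : Fin N → Fin n → ℤ) :
    MemLp (fun x => Efac b e k x * Efun b e k x) 2 := by
  obtain ⟨M, hM, h1, h2⟩ := exists_M b e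
  obtain ⟨C, hC, h3⟩ := EfacE_bound (m := m) k b.re M hb
  exact memLp_of_gau ((Efac_cont b e k).mul (Efun_cont b e k)).aestronglyMeasurable _ _ (by linarith : 0 < b.re / 4)
    (fun x => (h3 b e le_rfl h1 h2 x).2)

lemma cutOff_abs (ψ : ℝ → ℝ) (h0 : ∀ y, 0 ≤ ψ y) (h1 : ∀ y, ψ y ≤ 1) (R : ℝ) (x : Cfg m n N)
    (q : Fin N × Fin m) : 0 ≤ cutOff ψ R x q ∧ cutOff ψ R x q ≤ 1 := by
  unfold cutOff
  exact ⟨Finset.prod_nonneg fun _ _ => h0 _, Finset.prod_le_one (fun _ _ => h0 _) (fun _ _ => h1 _)⟩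

lemma cut_abs (ψ : ℝ → ℝ) (h0 : ∀ y, 0 ≤ ψ y) (h1 : ∀ y, ψ y ≤ 1) (R : ℝ) (x : Cfg m n N) :
    0 ≤ cut ψ R x ∧ cut ψ R x ≤ 1 := by
  unfold cut
  exact ⟨Finset.prod_nonneg fun _ _ => h0 _, Finset.prod_le_one (fun _ _ => h0 _) (fun _ _ => h1 _)⟩

lemma Xfac_bound (ψ : ℝ → ℝ) (P : ℝ) (h0 : ∀ y, 0 ≤ ψ y) (h1 : ∀ y, ψ y ≤ 1) (hP : 0 ≤ P)
    (hP1 : ∀ y, |deriv ψ y| ≤ P) (hP2 : ∀ y, |deriv (deriv ψ) y| ≤ P) (R : ℝ) (hR : 1 ≤ R)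
    (A B : ℂ) (y c : ℝ) (hc0 : 0 ≤ c) (hc1 : c ≤ 1) :
    ‖Xfac ψ R A B y c‖ ≤ P * (2 + 2 * ‖B‖) + (P + 1) * ‖A ^ 2 - 2 * B‖ := by
  have hR0 : 0 < R := by linarith
  have hc : |c| ≤ 1 := by rw [abs_of_nonneg hc0]; exact hc1
  have e1 : |c * (deriv (deriv ψ) (y / R) / R ^ 2)| ≤ P := by
    rw [abs_mul, abs_div, abs_of_pos (by positivity : (0:ℝ) < R ^ 2)]
    calc |c| * (|deriv (deriv ψ) (y / R)| / R ^ 2) ≤ 1 * (P / 1) := by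
          gcongr
          · exact hP2 _
          · nlinarith
      _ = P := by ring
  have e2 : |c * (deriv ψ (y / R) / R)| ≤ P := by
    rw [abs_mul, abs_div, abs_of_pos hR0]
    calc |c| * (|deriv ψ (y / R)| / R) ≤ 1 * (P / 1) := by
          gcongr
          exact hP1 _
      _ = P := by ring
  have e3 : |ψ (y / R) * c| ≤ 1 := by
    rw [abs_mul, abs_of_nonneg (h0 _), abs_of_nonneg hc0]
    exact mul_le_one₀ (h1 _) hc0 hc1
  have e4 : 2 * ‖A‖ ≤ 1 + 2 * ‖B‖ + ‖A ^ 2 - 2 * B‖ := by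
    have : ‖A ^ 2‖ ≤ ‖A ^ 2 - 2 * B‖ + ‖2 * B‖ := by
      have h := norm_add_le (A ^ 2 - 2 * B) (2 * B)
      rwa [sub_add_cancel] at h
    rw [norm_pow, norm_mul] at this
    simp at this
    nlinarith [sq_nonneg (‖A‖ - 1)]
  unfold Xfac
  refine (norm_add₃_le).trans ?_
  rw [norm_mul, norm_mul, norm_mul, Complex.norm_real, Complex.norm_real, Complex.norm_real]
  simp only [Real.norm_eq_abs, Complex.norm_ofNat]
  have f1 : 2 * ‖A‖ * |c * (deriv ψ (y / R) / R)| ≤ (1 + 2 * ‖B‖ + ‖A ^ 2 - 2 * B‖) * P := by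
    gcongr
  have f2 : ‖A ^ 2 - 2 * B‖ * |ψ (y / R) * c| ≤ ‖A ^ 2 - 2 * B‖ * 1 := by gcongr
  linarith

lemma lap_bound (ψ : ℝ → ℝ) (hψ : ContDiff ℝ (⊤ : ℕ∞) ψ) (P : ℝ) (h0 : ∀ y, 0 ≤ ψ y) (h1 : ∀ y, ψ y ≤ 1) (hP : 0 ≤ P)
    (hP1 : ∀ y, |deriv ψ y| ≤ P) (hP2 : ∀ y, |deriv (deriv ψ) y| ≤ P)
    (b : ℂ) (hb : 0 < b.re) (e : Fin N → Fin m → ℂ) (k : Fin N → Fin n → ℤ) :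
    ∃ C : ℝ, ∀ R : ℝ, 1 ≤ R → ∀ x, ‖lap m n N (phi ψ R b e k) x‖ ≤ C * gau (b.re / 4) x := by
  obtain ⟨M, hM, hb1, he⟩ := exists_M b e
  obtain ⟨C, hC, h3⟩ := EfacE_bound (m := m) k b.re M hb
  set Q : ℝ := N * (m * (P * (2 + 2 * M) + (P + 1) * (2 * M ^ 2 + 2 * M))) + (P + 1) * (8 * M ^ 2) + ‖k2 k‖ with hQ
  have hQ0 : 0 ≤ Q := by positivity
  refine ⟨Q * C, fun R hR x => ?_⟩
  rw [lap_phi ψ hψ, norm_mul]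
  have hin : ‖(∑ β, ∑ i, Xfac ψ R (-2 * b * ((x β).1 i : ℂ) + e β i) b ((x β).1 i) (cutOff ψ R x (β, i))) -
        k2 k * (cut ψ R x : ℂ)‖ ≤ Q * (1 + Sq x) := by
    refine (norm_sub_le _ _).trans ?_
    have g1 : ‖k2 k * (cut ψ R x : ℂ)‖ ≤ ‖k2 k‖ := by
      rw [norm_mul, Complex.norm_real, Real.norm_eq_abs, abs_of_nonneg (cut_abs ψ h0 h1 R x).1]
      exact mul_le_of_le_one_right (norm_nonneg _) (cut_abs ψ h0 h1 R x).2
    have g2 : ∀ β i, ‖Xfac ψ R (-2 * b * ((x β).1 i : ℂ) + e β i) b ((x β).1 i) (cutOff ψ R x (β, i))‖ ≤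
        (P * (2 + 2 * M) + (P + 1) * (2 * M ^ 2 + 2 * M)) + (P + 1) * (8 * M ^ 2) * (x β).1 i ^ 2 := by
      intro β i
      refine (Xfac_bound ψ P h0 h1 hP hP1 hP2 R hR _ _ _ _ (cutOff_abs ψ h0 h1 R x _).1
        (cutOff_abs ψ h0 h1 R x _).2).trans ?_
      have := term_bound b (e β i) M hb1 (he β i) ((x β).1 i)
      have : P * (2 + 2 * ‖b‖) ≤ P * (2 + 2 * M) := by gcongr
      nlinarith [term_bound b (e β i) M hb1 (he β i) ((x β).1 i)]
    have g3 : ‖∑ β, ∑ i, Xfac ψ R (-2 * b * ((x β).1 i : ℂ) + e β i) b ((x β).1 i) (cutOff ψ R x (β, i))‖ ≤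
        N * (m * (P * (2 + 2 * M) + (P + 1) * (2 * M ^ 2 + 2 * M))) + (P + 1) * (8 * M ^ 2) * Sq x := by
      refine (norm_sum_le_of_le _ fun β _ => norm_sum_le_of_le _ fun i _ => g2 β i).trans ?_
      simp only [Finset.sum_add_distrib, Finset.sum_const, Finset.card_univ, Fintype.card_fin, nsmul_eq_mul,
        ← Finset.mul_sum]
      unfold Sq
      apply le_of_eq
      ring
    have hS := Sq_nonneg x
    rw [hQ]
    have p1 : 0 ≤ (N * (m * (P * (2 + 2 * M) + (P + 1) * (2 * M ^ 2 + 2 * M))) + ‖k2 k‖) * Sq x := by positivity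
    have p2 : 0 ≤ (P + 1) * (8 * M ^ 2) := by positivity
    nlinarith
  calc ‖Efun b e k x‖ * _ ≤ ‖Efun b e k x‖ * (Q * (1 + Sq x)) := by gcongr
    _ = Q * ((1 + Sq x) * ‖Efun b e k x‖) := by ring
    _ ≤ Q * (C * gau (b.re / 4) x) := by
        exact mul_le_mul_of_nonneg_left (h3 b e le_rfl hb1 he x).1 hQ0
    _ = _ := by ring

lemma lap_cont (ψ : ℝ → ℝ) (hψ : ContDiff ℝ (⊤ : ℕ∞) ψ) (R : ℝ) (b : ℂ) (e : Fin N → Fin m → ℂ) (k : Fin N → Fin n → ℤ) :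
    Continuous (lap m n N (phi ψ R b e k)) := by
  have h : lap m n N (phi ψ R b e k) = _ := funext fun x => lap_phi ψ hψ R b e k x
  rw [h]
  have c0 : Continuous ψ := hψ.continuous
  have c1 : Continuous (deriv ψ) := hψ.continuous_deriv (by norm_cast)
  have hcd1 : ContDiff ℝ 1 (deriv ψ) := by
    have : ContDiff ℝ (1 + 1) ψ := hψ.of_le (by norm_cast)
    exact (contDiff_succ_iff_deriv.1 this).2.2
  have c2 : Continuous (deriv (deriv ψ)) := hcd1.continuous_deriv le_rfl
  refine (Efun_cont b e k).mul ?_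
  unfold Xfac cutOff cut
  fun_prop

lemma lap_lim (ψ : ℝ → ℝ) (hψ : ContDiff ℝ (⊤ : ℕ∞) ψ) (hψ0 : ψ 0 = 1)
    (b : ℂ) (e : Fin N → Fin m → ℂ) (k : Fin N → Fin n → ℤ) (x : Cfg m n N) :
    Filter.Tendsto (fun R : ℕ => lap m n N (phi ψ (R + 1) b e k) x) Filter.atTop (nhds (Efac b e k x * Efun b e k x)) ∧
    Filter.Tendsto (fun R : ℕ => phi ψ (R + 1) b e k x) Filter.atTop (nhds (Efun b e k x)) := by
  have c0 : Continuous ψ := hψ.continuous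
  have c1 : Continuous (deriv ψ) := hψ.continuous_deriv (by norm_cast)
  have hcd1 : ContDiff ℝ 1 (deriv ψ) := by
    have : ContDiff ℝ (1 + 1) ψ := hψ.of_le (by norm_cast)
    exact (contDiff_succ_iff_deriv.1 this).2.2
  have c2 : Continuous (deriv (deriv ψ)) := hcd1.continuous_deriv le_rfl
  have hi : Filter.Tendsto (fun R : ℕ => ((R:ℝ) + 1)⁻¹) Filter.atTop (nhds 0) := by
    simpa using tendsto_one_div_add_atTop_nhds_zero_nat (𝕜 := ℝ)
  -- everything is a continuous function of s = 1/R
  have key : ∀ f : ℝ → ℂ, Continuous f → Filter.Tendsto (fun R : ℕ => f ((R:ℝ) + 1)⁻¹) Filter.atTop (nhds (f 0)) :=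
    fun f hf => (hf.tendsto 0).comp hi
  constructor
  · have := key (fun s => Efun b e k x * ((∑ β, ∑ i, (
        (((∏ p ∈ Finset.univ.erase (β, i), ψ ((x p.1).1 p.2 * s)) * (deriv (deriv ψ) ((x β).1 i * s) * s ^ 2) : ℝ) : ℂ) +
        2 * (-2 * b * ((x β).1 i : ℂ) + e β i) * (((∏ p ∈ Finset.univ.erase (β, i), ψ ((x p.1).1 p.2 * s)) * (deriv ψ ((x β).1 i * s) * s) : ℝ) : ℂ) +
        ((-2 * b * ((x β).1 i : ℂ) + e β i) ^ 2 - 2 * b) * ((ψ ((x β).1 i * s) * (∏ p ∈ Finset.univ.erase (β, i), ψ ((x p.1).1 p.2 * s)) : ℝ) : ℂ))) -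
        k2 k * ((∏ p : Fin N × Fin m, ψ ((x p.1).1 p.2 * s) : ℝ) : ℂ))) (by fun_prop)
    simp only [mul_zero, hψ0, Finset.prod_const_one, one_mul, ne_eq, OfNat.ofNat_ne_zero, not_false_eq_true, zero_pow,
      Complex.ofReal_zero, Complex.ofReal_one, mul_one, zero_add] at this
    rw [mul_comm (Efac b e k x)]
    unfold Efac
    refine this.congr fun R => ?_
    rw [lap_phi ψ hψ]
    unfold Xfac cutOff cut
    simp only [div_eq_mul_inv, inv_pow]
  · have := key (fun s => ((∏ p : Fin N × Fin m, ψ ((x p.1).1 p.2 * s) : ℝ) : ℂ) * Efun b e k x) (by fun_prop)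
    simp only [mul_zero, hψ0, Finset.prod_const_one, Complex.ofReal_one, one_mul] at this
    exact this

lemma weak_E {U : ℝ → L2 m n N →L[ℂ] L2 m n N} (hU : IsPropagator m n N 0 U) (b : ℂ) (hb : 0 < b.re)
    (e : Fin N → Fin m → ℂ) (k : Fin N → Fin n → ℤ) (u : L2 m n N) (t : ℝ) :
    HasDerivAt (fun s => pr (Efun_memLp b hb e k).toLp (U s u))
      (Complex.I * pr (EfacE_memLp b hb e k).toLp (U t u)) t := by
  obtain ⟨ψ, P, hψ, hψ0, h0, h1, h2, hP, hP1, hP2⟩ := exists_cutoff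
  obtain ⟨M, hM, hb1, he⟩ := exists_M b e
  obtain ⟨C, hC⟩ := lap_bound ψ hψ P h0 h1 hP hP1 hP2 b hb e k
  have hR : ∀ R : ℕ, (1:ℝ) ≤ R + 1 := fun R => by
    have : (0:ℝ) ≤ R := Nat.cast_nonneg R
    linarith
  have hpb : ∀ (R : ℕ) x, ‖phi ψ (R + 1) b e k x‖ ≤ ‖Efun b e k x‖ := fun R x => by
    unfold phi
    rw [norm_mul, Complex.norm_real, Real.norm_eq_abs, abs_of_nonneg (cut_abs ψ h0 h1 _ x).1]
    exact mul_le_of_le_one_left (norm_nonneg _) (cut_abs ψ h0 h1 _ x).2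
  have hpc : ∀ R : ℕ, Continuous (phi ψ (R + 1) b e k : Cfg m n N → ℂ) := fun R => by
    have c0 : Continuous ψ := hψ.continuous
    unfold phi cut
    exact Continuous.mul (by fun_prop) (Efun_cont b e k)
  have hm1 : ∀ R : ℕ, MemLp (phi ψ (R + 1) b e k : Cfg m n N → ℂ) 2 := fun R =>
    (Efun_memLp b hb e k).mono (hpc R).aestronglyMeasurable (Filter.Eventually.of_forall (hpb R))
  have hm2 : ∀ R : ℕ, MemLp (lap m n N (phi ψ (R + 1) b e k)) 2 := fun R =>
    memLp_of_gau (lap_cont ψ hψ _ b e k).aestronglyMeasurable C (b.re / 4) (by linarith) (hC _ (hR R))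
  have T1 : Filter.Tendsto (fun R => (hm1 R).toLp) Filter.atTop (nhds (Efun_memLp b hb e k).toLp) :=
    L2_dct _ _ (fun x => ‖Efun b e k x‖) _ _ (Efun_memLp b hb e k).norm
      (Filter.Eventually.of_forall fun R => Filter.Eventually.of_forall (hpb R))
      (Filter.Eventually.of_forall fun x => le_rfl)
      (Filter.Eventually.of_forall fun x => (lap_lim ψ hψ hψ0 b e k x).2)
  have T2 : Filter.Tendsto (fun R => (hm2 R).toLp) Filter.atTop (nhds (EfacE_memLp b hb e k).toLp) :=
    L2_dct _ _ (fun x => C * gau (b.re / 4) x) _ _ ((gau_memLp _ (by linarith)).const_mul C)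
      (Filter.Eventually.of_forall fun R => Filter.Eventually.of_forall (hC _ (hR R)))
      (Filter.Eventually.of_forall fun x => le_of_tendsto ((lap_lim ψ hψ hψ0 b e k x).1.norm)
        (Filter.Eventually.of_forall fun R => hC _ (hR R) x))
      (Filter.Eventually.of_forall fun x => (lap_lim ψ hψ hψ0 b e k x).1)
  have hpt : ∀ (g : ℕ → L2 m n N) (g0 : L2 m n N), Filter.Tendsto g Filter.atTop (nhds g0) →
      TendstoUniformly (fun R s => pr (g R) (U s u)) (fun s => pr g0 (U s u)) Filter.atTop := by
    intro g g0 hg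
    rw [Metric.tendstoUniformly_iff]
    intro ε hε
    have hg' := tendsto_iff_norm_sub_tendsto_zero.1 hg
    have := (hg'.mul_const ‖u‖)
    rw [zero_mul] at this
    filter_upwards [this.eventually (gt_mem_nhds hε)] with R hRε s
    rw [dist_comm, dist_eq_norm, ← pr_sub_left]
    refine (pr_le _ _).trans_lt ?_
    rwa [hU.unitary]
  refine hasDerivAt_of_tendstoUniformly (l := Filter.atTop) (f := fun (R : ℕ) s => pr (hm1 R).toLp (U s u))
    (f' := fun (R : ℕ) s => Complex.I * pr (hm2 R).toLp (U s u))
    (g' := fun s => Complex.I * pr (EfacE_memLp b hb e k).toLp (U s u)) ?_ ?_ ?_ t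
  · have h := hpt _ _ T2
    rw [Metric.tendstoUniformly_iff] at h ⊢
    intro ε hε
    filter_upwards [h ε hε] with R hR s
    have := hR s
    rw [dist_eq_norm] at this ⊢
    rw [← mul_sub, norm_mul]
    simpa using this
  · filter_upwards with R s
    have h := hU.weak u _ (phi_test ψ hψ h2 ((R:ℝ) + 1) (by have := hR R; linarith) b e k) s
    simp only [pr_toLp]
    simpa using h
  · intro s
    exact (hpt _ _ T1).tendsto_at s

end ManyBodyWaveguide

namespace ManyBodyWaveguide

variable {m n N : ℕ}

instance scTorus1 : SecondCountableTopology (AddCircle (1:ℝ)) := inferInstance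

lemma borel_cfg (m n N : ℕ) : BorelSpace (Cfg m n N) := inferInstance

/-- Characters of the configuration space. -/
def chi (c : Fin N → Fin m → ℝ) (k : Fin N → Fin n → ℤ) (x : Cfg m n N) : ℂ :=
  Efun 0 (fun β i => Complex.I * c β i) k x

lemma chi_cont (c : Fin N → Fin m → ℝ) (k : Fin N → Fin n → ℤ) : Continuous (chi c k) := Efun_cont _ _ _

lemma chi_eq (c : Fin N → Fin m → ℝ) (k : Fin N → Fin n → ℤ) (x : Cfg m n N) :
    chi c k x = Complex.exp (((∑ β, ∑ i, c β i * (x β).1 i : ℝ) : ℂ) * Complex.I) * ph k x := by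
  unfold chi Efun
  congr 2
  push_cast
  simp only [Finset.sum_mul]
  refine Finset.sum_congr rfl fun β _ => Finset.sum_congr rfl fun i _ => ?_
  ring

lemma chi_norm (c : Fin N → Fin m → ℝ) (k : Fin N → Fin n → ℤ) (x : Cfg m n N) : ‖chi c k x‖ = 1 := by
  rw [chi_eq, norm_mul, ph_norm, Complex.norm_exp_ofReal_mul_I, one_mul]

lemma ph_zero (x : Cfg m n N) : ph 0 x = 1 := by
  unfold ph; simp

lemma ph_add (k l : Fin N → Fin n → ℤ) (x : Cfg m n N) : ph (k + l) x = ph k x * ph l x := by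
  unfold ph
  simp only [Pi.add_apply, fourier_add, Finset.prod_mul_distrib]

lemma ph_star (k : Fin N → Fin n → ℤ) (x : Cfg m n N) : star (ph k x) = ph (-k) x := by
  unfold ph
  simp only [Pi.neg_apply, fourier_neg, star_prod]
  rfl

lemma chi_zero (x : Cfg m n N) : chi 0 0 x = 1 := by
  rw [chi_eq, ph_zero]; simp

lemma chi_add (c c' : Fin N → Fin m → ℝ) (k l : Fin N → Fin n → ℤ) (x : Cfg m n N) :
    chi (c + c') (k + l) x = chi c k x * chi c' l x := by
  rw [chi_eq, chi_eq, chi_eq, ph_add, mul_mul_mul_comm, ← Complex.exp_add, ← add_mul, ← Complex.ofReal_add]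
  congr 4
  simp only [Pi.add_apply, add_mul, Finset.sum_add_distrib]

lemma chi_star (c : Fin N → Fin m → ℝ) (k : Fin N → Fin n → ℤ) (x : Cfg m n N) :
    star (chi c k x) = chi (-c) (-k) x := by
  rw [chi_eq, chi_eq, star_mul', ph_star]
  congr 1
  rw [Complex.star_def, ← Complex.exp_conj]
  simp

def chiB (c : Fin N → Fin m → ℝ) (k : Fin N → Fin n → ℤ) : BoundedContinuousFunction (Cfg m n N) ℂ :=
  BoundedContinuousFunction.ofNormedAddCommGroup (chi c k) (chi_cont c k) 1 (fun x => (chi_norm c k x).le)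

def chiMon (m n N : ℕ) : Submonoid (BoundedContinuousFunction (Cfg m n N) ℂ) where
  carrier := {g | ∃ c k, g = chiB c k}
  one_mem' := ⟨0, 0, by ext x; exact (chi_zero x).symm⟩
  mul_mem' := by
    rintro _ _ ⟨c, k, rfl⟩ ⟨c', l, rfl⟩
    exact ⟨c + c', k + l, by ext x; exact (chi_add c c' k l x).symm⟩

lemma chi_sep (x x' : Cfg m n N) (h : ∀ c k, chi c k x = chi c k x') : x = x' := by
  funext β
  refine Prod.ext (funext fun i => ?_) (funext fun j => ?_)
  · by_contra hne
    have hne' : (x β).1 i - (x' β).1 i ≠ 0 := sub_ne_zero.2 hne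
    set s : ℝ := Real.pi / ((x β).1 i - (x' β).1 i)
    have h1 := h (Pi.single β (Pi.single i s)) 0
    rw [chi_eq, chi_eq, ph_zero, ph_zero, mul_one, mul_one] at h1
    have hs : ∀ y : Cfg m n N, (∑ β', ∑ i', (Pi.single β (Pi.single i s) : Fin N → Fin m → ℝ) β' i' * (y β').1 i') = s * (y β).1 i := by
      intro y
      rw [Finset.sum_eq_single β, Finset.sum_eq_single i]
      · simp
      · intro i' _ hi; simp [hi]
      · simp
      · intro β' _ hβ; simp [hβ]
      · simp
    rw [hs, hs] at h1
    have h2 : Complex.exp (((s * (x β).1 i : ℝ) : ℂ) * Complex.I - ((s * (x' β).1 i : ℝ) : ℂ) * Complex.I) = 1 := by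
      rw [Complex.exp_sub, h1, div_self (Complex.exp_ne_zero _)]
    rw [← sub_mul, ← Complex.ofReal_sub, ← mul_sub, div_mul_cancel₀ _ hne', Complex.exp_pi_mul_I] at h2
    norm_num at h2
  · have h1 := h 0 (Pi.single β (Pi.single j 1))
    rw [chi_eq, chi_eq] at h1
    have hs : ∀ y : Cfg m n N, ph (Pi.single β (Pi.single j 1)) y = fourier 1 ((y β).2 j) := by
      intro y
      unfold ph
      rw [Finset.prod_eq_single β, Finset.prod_eq_single j]
      · simp
      · intro i' _ hi; simp [hi]
      · simp
      · intro β' _ hβ; simp [hβ]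
      · simp
    rw [hs, hs] at h1
    simp only [Pi.zero_apply, zero_mul, Finset.sum_const_zero, Complex.ofReal_zero, Complex.exp_zero, one_mul,
      fourier_one] at h1
    exact AddCircle.injective_toCircle one_ne_zero (Subtype.ext h1)

def chiAlg (m n N : ℕ) : StarSubalgebra ℂ (BoundedContinuousFunction (Cfg m n N) ℂ) where
  toSubalgebra := Algebra.adjoin ℂ (chiMon m n N : Set (BoundedContinuousFunction (Cfg m n N) ℂ))
  star_mem' := by
    intro a ha
    change a ∈ Algebra.adjoin ℂ _ at ha
    induction ha using Algebra.adjoin_induction with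
    | mem x hx =>
      obtain ⟨c, k, rfl⟩ := hx
      apply Algebra.subset_adjoin
      exact ⟨-c, -k, by ext x; exact chi_star c k x⟩
    | algebraMap r =>
      have : star (algebraMap ℂ (BoundedContinuousFunction (Cfg m n N) ℂ) r) = algebraMap ℂ _ (star r) := by
        ext x; simp
      rw [this]
      exact Subalgebra.algebraMap_mem _ _
    | add x y hx hy h1 h2 => rw [star_add]; exact Subalgebra.add_mem _ h1 h2
    | mul x y hx hy h1 h2 => rw [star_mul]; exact Subalgebra.mul_mem _ h2 h1

lemma meas_eq_of_chi (P P' : Measure (Cfg m n N)) [IsFiniteMeasure P] [IsFiniteMeasure P']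
    (h : ∀ c k, ∫ x, chi c k x ∂P = ∫ x, chi c k x ∂P') : P = P' := by
  have p0 : PolishSpace (Torus n) := inferInstance
  have p1 : PolishSpace (Wg m n) := inferInstance
  have p3 : BorelSpace (Cfg m n N) := borel_cfg m n N
  have p2 : PolishSpace (Cfg m n N) := { }
  refine ext_of_forall_mem_subalgebra_integral_eq_of_polish (A := chiAlg m n N) ?_ ?_
  · intro x x' hne
    by_contra hcon
    push Not at hcon
    apply hne
    apply chi_sep
    intro c k
    refine hcon (chi c k) ⟨(chiB c k).toContinuousMap, ?_, rfl⟩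
    refine ⟨chiB c k, ?_, rfl⟩
    exact Algebra.subset_adjoin ⟨c, k, rfl⟩
  · intro g hg
    have hg' : g ∈ Subalgebra.toSubmodule (Algebra.adjoin ℂ (chiMon m n N : Set (BoundedContinuousFunction (Cfg m n N) ℂ))) := hg
    rw [Algebra.adjoin_eq_span, Submonoid.closure_eq] at hg'
    induction hg' using Submodule.span_induction with
    | mem x hx =>
      obtain ⟨c, k, rfl⟩ := hx
      exact h c k
    | zero => simp
    | add x y hx hy h1 h2 =>
      have e1 := h1 (by
        change x ∈ Subalgebra.toSubmodule (Algebra.adjoin ℂ (chiMon m n N : Set (BoundedContinuousFunction (Cfg m n N) ℂ)))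
        rwa [Algebra.adjoin_eq_span, Submonoid.closure_eq])
      have e2 := h2 (by
        change y ∈ Subalgebra.toSubmodule (Algebra.adjoin ℂ (chiMon m n N : Set (BoundedContinuousFunction (Cfg m n N) ℂ)))
        rwa [Algebra.adjoin_eq_span, Submonoid.closure_eq])
      simp only [BoundedContinuousFunction.coe_add, Pi.add_apply]
      rw [integral_add (x.integrable P) (y.integrable P), integral_add (x.integrable P') (y.integrable P'), e1, e2]
    | smul r x hx h1 =>
      have e1 := h1 (by
        change x ∈ Subalgebra.toSubmodule (Algebra.adjoin ℂ (chiMon m n N : Set (BoundedContinuousFunction (Cfg m n N) ℂ)))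
        rwa [Algebra.adjoin_eq_span, Submonoid.closure_eq])
      simp only [BoundedContinuousFunction.coe_smul]
      rw [integral_smul, integral_smul, e1]

lemma zero_of_chi_real (f : Cfg m n N → ℝ) (hf : Integrable f) (h : ∀ c k, ∫ x, (f x : ℂ) * chi c k x = 0) :
    f =ᵐ[volume] 0 := by
  have hfm : AEMeasurable f := hf.1.aemeasurable
  have hfn : AEMeasurable (fun x => -f x) := hfm.neg
  have i1 : IsFiniteMeasure ((volume : Measure (Cfg m n N)).withDensity (fun x => ENNReal.ofReal (f x))) :=
    isFiniteMeasure_withDensity_ofReal hf.2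
  have i2 : IsFiniteMeasure ((volume : Measure (Cfg m n N)).withDensity (fun x => ENNReal.ofReal (-f x))) :=
    isFiniteMeasure_withDensity_ofReal hf.neg.2
  have hPP := meas_eq_of_chi ((volume : Measure (Cfg m n N)).withDensity (fun x => ENNReal.ofReal (f x)))
    ((volume : Measure (Cfg m n N)).withDensity (fun x => ENNReal.ofReal (-f x))) (by
      intro c k
      rw [integral_withDensity_eq_integral_toReal_smul₀ hfm.ennreal_ofReal (by simp),
        integral_withDensity_eq_integral_toReal_smul₀ hfn.ennreal_ofReal (by simp)]
      rw [← sub_eq_zero, ← integral_sub, ← h c k]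
      · refine integral_congr_ae (Filter.Eventually.of_forall fun x => ?_)
        simp only [ENNReal.toReal_ofReal', Complex.real_smul]
        rcases le_total 0 (f x) with h0 | h0
        · rw [max_eq_left h0, max_eq_right (by linarith)]; simp
        · rw [max_eq_right h0, max_eq_left (by linarith)]; simp
      · simp only [ENNReal.toReal_ofReal', Complex.real_smul]
        exact (hf.pos_part.ofReal (𝕜 := ℂ)).mul_bdd (c := 1) (chi_cont c k).aestronglyMeasurable
          (Filter.Eventually.of_forall fun x => (chi_norm c k x).le)
      · simp only [ENNReal.toReal_ofReal', Complex.real_smul]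
        exact (hf.neg_part.ofReal (𝕜 := ℂ)).mul_bdd (c := 1) (chi_cont c k).aestronglyMeasurable
          (Filter.Eventually.of_forall fun x => (chi_norm c k x).le))
  rw [withDensity_eq_iff hfm.ennreal_ofReal hfn.ennreal_ofReal] at hPP
  · filter_upwards [hPP] with x hx
    rcases le_total 0 (f x) with h0 | h0
    · rw [ENNReal.ofReal_of_nonpos (by linarith : -f x ≤ 0)] at hx
      exact le_antisymm (ENNReal.ofReal_eq_zero.1 hx) h0
    · rw [ENNReal.ofReal_of_nonpos h0] at hx
      have := ENNReal.ofReal_eq_zero.1 hx.symm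
      simp only [Pi.zero_apply]
      linarith
  · exact (hf.lintegral_lt_top).ne

lemma zero_of_chi (f : Cfg m n N → ℂ) (hf : Integrable f) (h : ∀ c k, ∫ x, f x * chi c k x = 0) :
    f =ᵐ[volume] 0 := by
  have hi : ∀ c k, Integrable fun x => f x * chi c k x := fun c k => hf.mul_bdd (c := 1) (chi_cont c k).aestronglyMeasurable
          (Filter.Eventually.of_forall fun x => (chi_norm c k x).le)
  have hi' : ∀ c k, Integrable fun x => star (f x) * chi c k x := fun c k =>
      (Complex.conjLIE.toContinuousLinearEquiv.toContinuousLinearMap.integrable_comp hf).mul_bdd (c := 1) (chi_cont c k).aestronglyMeasurable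
          (Filter.Eventually.of_forall fun x => (chi_norm c k x).le)
  have h' : ∀ c k, ∫ x, star (f x) * chi c k x = 0 := by
    intro c k
    have := h (-c) (-k)
    have h2 := congrArg star this
    rw [Complex.star_def, ← integral_conj] at h2
    simp only [map_zero] at h2
    rw [← h2]
    refine integral_congr_ae (Filter.Eventually.of_forall fun x => ?_)
    simp only [map_mul]
    rw [← chi_star]
    simp
  have hre := zero_of_chi_real (fun x => (f x).re) hf.re (by
    intro c k
    have e : ∀ x, (((f x).re : ℝ) : ℂ) * chi c k x = (1/2 : ℂ) * (f x * chi c k x + star (f x) * chi c k x) := by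
      intro x
      rw [Complex.re_eq_add_conj, Complex.star_def]; ring
    simp_rw [e]
    rw [integral_const_mul, integral_add (hi c k) (hi' c k), h, h']; simp)
  have him := zero_of_chi_real (fun x => (f x).im) hf.im (by
    intro c k
    have e : ∀ x, (((f x).im : ℝ) : ℂ) * chi c k x = (1/(2*Complex.I) : ℂ) * (f x * chi c k x - star (f x) * chi c k x) := by
      intro x
      rw [Complex.im_eq_sub_conj, Complex.star_def]; ring
    simp_rw [e]
    rw [integral_const_mul, integral_sub (hi c k) (hi' c k), h, h']; simp)
  filter_upwards [hre, him] with x h1 h2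
  exact Complex.ext h1 h2

end ManyBodyWaveguide

namespace ManyBodyWaveguide

variable {m n N : ℕ}

lemma re_pos_ofReal {a : ℝ} (ha : 0 < a) : 0 < ((a:ℂ)).re := by simpa using ha

lemma Efun_gau (a : ℝ) (c : Fin N → Fin m → ℝ) (k : Fin N → Fin n → ℤ) (x : Cfg m n N) :
    Efun (a:ℂ) (fun β i => Complex.I * c β i) k x = (gau a x : ℂ) * chi c k x := by
  unfold chi Efun gau Sq
  rw [← mul_assoc, Complex.ofReal_exp, ← Complex.exp_add]
  congr 2
  push_cast
  rw [Finset.mul_sum, ← Finset.sum_add_distrib]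
  refine Finset.sum_congr rfl fun β _ => ?_
  rw [Finset.mul_sum, ← Finset.sum_add_distrib]
  refine Finset.sum_congr rfl fun i _ => ?_
  ring

/-- The basic Gaussian wave packets. -/
def G0 (a : ℝ) (ha : 0 < a) (c : Fin N → Fin m → ℝ) (k : Fin N → Fin n → ℤ) : L2 m n N :=
  (Efun_memLp (a:ℂ) (re_pos_ofReal ha) (fun β i => Complex.I * c β i) k).toLp

/-- Span of the basic Gaussian wave packets. -/
def Sp (m n N : ℕ) (a : ℝ) (ha : 0 < a) : Submodule ℂ (L2 m n N) :=
  Submodule.span ℂ (Set.range fun p : (Fin N → Fin m → ℝ) × (Fin N → Fin n → ℤ) => G0 a ha p.1 p.2)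

lemma Sp_dense (a : ℝ) (ha : 0 < a) : (Sp m n N a ha).topologicalClosure = ⊤ := by
  rw [Submodule.topologicalClosure_eq_top_iff, Submodule.eq_bot_iff]
  intro v hv
  have h1 : ∀ c k, inner ℂ (G0 a ha c k) v = 0 := fun c k =>
    (Submodule.mem_orthogonal _ _).1 hv _ (Submodule.subset_span ⟨(c, k), rfl⟩)
  have hIntg : Integrable (fun x => (gau a x : ℂ) * v x) := by
    have := MemLp.integrable_mul (p := 2) (q := 2) ((gau_memLp (m := m) (n := n) (N := N) a ha).ofReal (K := ℂ)) (Lp.memLp v)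
    exact this
  have h2 := zero_of_chi (fun x => (gau a x : ℂ) * v x) hIntg (by
    intro c k
    have h3 := h1 (-c) (-k)
    rw [L2.inner_def] at h3
    rw [← h3]
    refine integral_congr_ae ?_
    filter_upwards [(Efun_memLp (a:ℂ) (re_pos_ofReal ha) (fun β i => Complex.I * (-c) β i) (-k)).coeFn_toLp] with x hx
    unfold G0
    rw [hx, Efun_gau, RCLike.inner_apply, map_mul, Complex.conj_ofReal, ← Complex.star_def, chi_star, neg_neg, neg_neg]
    ring)
  apply Lp.ext
  filter_upwards [h2, Lp.coeFn_zero ℂ 2 (volume : Measure (Cfg m n N))] with x hx h0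
  rw [h0]
  simp only [Pi.zero_apply, mul_eq_zero, Complex.ofReal_eq_zero] at hx ⊢
  exact hx.resolve_left (gau_pos a x).ne'

lemma wcont {U : ℝ → L2 m n N →L[ℂ] L2 m n N} (hU : IsPropagator m n N 0 U)
    (g u : L2 m n N) : Continuous fun s => pr g (U s u) := by
  have hsp : ∀ g ∈ Sp m n N 1 one_pos, Continuous fun s => pr g (U s u) := by
    intro g hg
    unfold Sp at hg
    induction hg using Submodule.span_induction with
    | mem x hx =>
      obtain ⟨p, rfl⟩ := hx
      exact continuous_iff_continuousAt.2 fun t => (weak_E hU _ (re_pos_ofReal one_pos) _ _ u t).continuousAt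
    | zero =>
      have : ∀ v : L2 m n N, pr (0 : L2 m n N) v = 0 := fun v => by
        have := pr_sub_left (0 : L2 m n N) 0 v
        simpa using this
      simp only [this]; exact continuous_const
    | add x y hx hy h1 h2 => simp only [pr_add_left]; exact h1.add h2
    | smul r x hx h1 => simp only [pr_smul_left]; exact continuous_const.mul h1
  have hg : g ∈ (Sp m n N 1 one_pos).topologicalClosure := by rw [Sp_dense]; trivial
  rw [← SetLike.mem_coe, Submodule.topologicalClosure_coe, Metric.mem_closure_iff] at hg
  refine continuous_of_uniform_approx_of_continuous fun w hw => ?_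
  obtain ⟨ε, hε, hw'⟩ := Metric.mem_uniformity_dist.1 hw
  obtain ⟨g', hg', hd⟩ := hg (ε / (‖u‖ + 1)) (by positivity)
  refine ⟨_, hsp g' hg', fun s => hw' ?_⟩
  rw [dist_eq_norm, ← pr_sub_left]
  refine (pr_le _ _).trans_lt ?_
  rw [hU.unitary, ← dist_eq_norm]
  calc dist g g' * ‖u‖ ≤ dist g g' * (‖u‖ + 1) := by gcongr; linarith
    _ < ε / (‖u‖ + 1) * (‖u‖ + 1) := by gcongr
    _ = ε := by field_simp

lemma scont {U : ℝ → L2 m n N →L[ℂ] L2 m n N} (hU : IsPropagator m n N 0 U)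
    (u : L2 m n N) : Continuous fun s => U s u := by
  rw [continuous_iff_continuousAt]
  intro t
  rw [ContinuousAt, tendsto_iff_norm_sub_tendsto_zero]
  have h1 : ∀ s, ‖U s u - U t u‖ = Real.sqrt (2 * ‖u‖ ^ 2 - 2 * (pr (star (U t u)) (U s u)).re) := by
    intro s
    rw [eq_comm, Real.sqrt_eq_iff_mul_self_eq (by
      rw [← inner_eq_pr]
      have := re_inner_le_norm (𝕜 := ℂ) (U t u) (U s u)
      rw [hU.unitary, hU.unitary] at this
      simp only [RCLike.re_to_complex] at this
      nlinarith) (norm_nonneg _), ← sq, norm_sub_rev, @norm_sub_sq ℂ, hU.unitary, hU.unitary, ← inner_eq_pr]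
    simp only [RCLike.re_to_complex]; ring
  simp_rw [h1]
  have h2 : Continuous fun s => Real.sqrt (2 * ‖u‖ ^ 2 - 2 * (pr (star (U t u)) (U s u)).re) := by
    have := wcont hU (star (U t u)) u
    fun_prop
  have h3 := h2.tendsto t
  rw [← h1 t, sub_self, norm_zero] at h3
  exact h3

end ManyBodyWaveguide

namespace ManyBodyWaveguide

variable {m n N : ℕ}

def dd (a t : ℝ) : ℂ := 1 + 4 * a * t * Complex.I

lemma dd_re (a t : ℝ) : (dd a t).re = 1 := by unfold dd; simp
lemma dd_im (a t : ℝ) : (dd a t).im = 4 * a * t := by unfold dd; simp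
lemma dd_ne (a t : ℝ) : dd a t ≠ 0 := fun h => by
  have := dd_re a t
  rw [h] at this; simp at this
lemma dd_slit (a t : ℝ) : dd a t ∈ Complex.slitPlane := by
  left; rw [dd_re]; exact one_pos
lemma dd_normSq (a t : ℝ) : Complex.normSq (dd a t) = 1 + 16 * a ^ 2 * t ^ 2 := by
  rw [Complex.normSq_apply, dd_re, dd_im]; ring
lemma dd_norm_ge (a t : ℝ) : 1 ≤ ‖dd a t‖ := by
  have := Complex.abs_re_le_norm (dd a t)
  rw [dd_re] at this; simpa using this
lemma div_dd_re (a t : ℝ) : ((a:ℂ) / dd a t).re = a / (1 + 16 * a ^ 2 * t ^ 2) := by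
  rw [Complex.div_re, dd_normSq, dd_re]; simp
lemma div_dd_re_pos {a : ℝ} (ha : 0 < a) (t : ℝ) : 0 < ((a:ℂ) / dd a t).re := by
  rw [div_dd_re]; positivity

lemma dd_deriv (a t : ℝ) : HasDerivAt (dd a) (4 * a * Complex.I) t := by
  have h0 : HasDerivAt (fun ε : ℝ => (ε : ℂ)) 1 t := by
    simpa using (hasDerivAt_id t).ofReal_comp
  have := ((h0.const_mul (4 * a : ℂ)).mul_const Complex.I).const_add 1
  rw [mul_one] at this
  exact this

def bt (a t : ℝ) : ℂ := a / dd a t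
def et (a : ℝ) (c : Fin N → Fin m → ℝ) (t : ℝ) (β : Fin N) (i : Fin m) : ℂ := Complex.I * c β i / dd a t
def cexpo (a : ℝ) (c : Fin N → Fin m → ℝ) (k : Fin N → Fin n → ℤ) (t : ℝ) : ℂ :=
  -((N:ℂ) * (m:ℂ) / 2) * Complex.log (dd a t) - Complex.I * k2 k * t - ∑ β, ∑ i, Complex.I * t * (c β i : ℂ) ^ 2 / dd a t
def cf (a : ℝ) (c : Fin N → Fin m → ℝ) (k : Fin N → Fin n → ℤ) (t : ℝ) : ℂ := Complex.exp (cexpo a c k t)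

/-- The evolved Gaussian. -/
def GF (a : ℝ) (c : Fin N → Fin m → ℝ) (k : Fin N → Fin n → ℤ) (t : ℝ) (x : Cfg m n N) : ℂ :=
  cf a c k t * Efun (bt a t) (et a c t) k x

def GFd (a : ℝ) (c : Fin N → Fin m → ℝ) (k : Fin N → Fin n → ℤ) (t : ℝ) (x : Cfg m n N) : ℂ :=
  (Complex.I * cf a c k t) * (Efac (bt a t) (et a c t) k x * Efun (bt a t) (et a c t) k x)

lemma bt_re_pos {a : ℝ} (ha : 0 < a) (t : ℝ) : 0 < (bt a t).re := div_dd_re_pos ha t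

lemma GF_memLp {a : ℝ} (ha : 0 < a) (c : Fin N → Fin m → ℝ) (k : Fin N → Fin n → ℤ) (t : ℝ) : MemLp (GF a c k t) 2 :=
  (Efun_memLp _ (bt_re_pos ha t) _ k).const_mul _

lemma GFd_memLp {a : ℝ} (ha : 0 < a) (c : Fin N → Fin m → ℝ) (k : Fin N → Fin n → ℤ) (t : ℝ) : MemLp (GFd a c k t) 2 :=
  (EfacE_memLp _ (bt_re_pos ha t) _ k).const_mul _

lemma GF_deriv (a : ℝ) (c : Fin N → Fin m → ℝ) (k : Fin N → Fin n → ℤ) (x : Cfg m n N) (t : ℝ) :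
    HasDerivAt (fun t => GF a c k t x) (GFd a c k t x) t := by
  have hd := dd_deriv a t
  have hne := dd_ne a t
  have h0 : HasDerivAt (fun ε : ℝ => (ε : ℂ)) 1 t := by
    simpa using (hasDerivAt_id t).ofReal_comp
  have hlog : HasDerivAt (fun t => Complex.log (dd a t)) (4 * a * Complex.I / dd a t) t := hd.clog_real (dd_slit a t)
  have hinv : HasDerivAt (fun t => (dd a t)⁻¹) (-(4 * a * Complex.I) / dd a t ^ 2) t := hd.fun_inv hne
  have hW : ∀ y c' : ℝ, HasDerivAt (fun t : ℝ => (-bt a t * (y:ℂ) ^ 2 + Complex.I * c' / dd a t * y) - Complex.I * t * (c':ℂ) ^ 2 / dd a t)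
      (Complex.I * ((-2 * bt a t * (y:ℂ) + Complex.I * c' / dd a t) ^ 2 - 2 * bt a t) + (2 * a * Complex.I / dd a t)) t := by
    intro y c'
    have h1 := ((hinv.const_mul (-(a:ℂ) * (y:ℂ) ^ 2 + Complex.I * c' * y))).sub ((h0.mul hinv).const_mul (Complex.I * (c':ℂ) ^ 2))
    refine (h1.congr_deriv ?_).congr_of_eventuallyEq (Filter.Eventually.of_forall fun t => ?_)
    · unfold bt
      field_simp
      have hD : dd a t = 1 + 4 * a * t * Complex.I := rfl
      have I2 : Complex.I ^ 2 = -1 := Complex.I_sq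
      rw [hD]
      linear_combination (-(c':ℂ) ^ 2) * I2
    · simp only [bt, Pi.mul_apply, Pi.sub_apply, div_eq_mul_inv]
      ring
  have hsum : HasDerivAt (fun t : ℝ => ∑ β, ∑ i, ((-bt a t * ((x β).1 i:ℂ) ^ 2 + Complex.I * c β i / dd a t * ((x β).1 i : ℂ)) - Complex.I * t * (c β i:ℂ) ^ 2 / dd a t))
      (∑ β, ∑ i, (Complex.I * ((-2 * bt a t * ((x β).1 i:ℂ) + Complex.I * c β i / dd a t) ^ 2 - 2 * bt a t) + (2 * a * Complex.I / dd a t))) t :=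
    HasDerivAt.fun_sum fun β _ => HasDerivAt.fun_sum fun i _ => hW _ _
  have hall := (((hlog.const_mul (-((N:ℂ) * (m:ℂ) / 2))).sub (h0.const_mul (Complex.I * k2 k))).add hsum).cexp.mul_const (ph k x)
  refine (hall.congr_deriv ?_).congr_of_eventuallyEq (Filter.Eventually.of_forall fun t => ?_)
  · have hexp : Complex.exp (cexpo a c k t) * (Complex.exp (∑ β, ∑ i, (-bt a t * ((x β).1 i : ℂ) ^ 2 + et a c t β i * ((x β).1 i : ℂ)))) =
        Complex.exp (-((N:ℂ) * (m:ℂ) / 2) * Complex.log (dd a t) - Complex.I * k2 k * t + ∑ β, ∑ i, ((-bt a t * ((x β).1 i:ℂ) ^ 2 + Complex.I * c β i / dd a t * ((x β).1 i : ℂ)) - Complex.I * t * (c β i:ℂ) ^ 2 / dd a t)) := by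
      rw [← Complex.exp_add]
      congr 1
      simp only [cexpo, et, Finset.sum_sub_distrib]
      ring
    simp only [GFd, cf, Efun]
    have hs2 : (∑ β : Fin N, ∑ i : Fin m, (Complex.I * ((-2 * bt a t * ((x β).1 i:ℂ) + Complex.I * c β i / dd a t) ^ 2 - 2 * bt a t) + (2 * a * Complex.I / dd a t))) =
        Complex.I * (Efac (bt a t) (et a c t) k x + k2 k) + N * (m * (2 * a * Complex.I / dd a t)) := by
      simp only [Finset.sum_add_distrib, ← Finset.mul_sum, Efac, et, sub_add_cancel]
      simp only [Finset.sum_const, Finset.card_univ, Fintype.card_fin, nsmul_eq_mul]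
    rw [hs2]
    simp only [Pi.add_apply, Pi.sub_apply]
    rw [← hexp]
    ring
  · simp only [GF, cf, cexpo, Efun, et]
    rw [← mul_assoc, ← Complex.exp_add]
    congr 2
    simp only [Pi.add_apply, Pi.sub_apply, Finset.sum_sub_distrib]
    ring

lemma dd_cont (a : ℝ) : Continuous (dd a) := by unfold dd; fun_prop

lemma cf_cont (a : ℝ) (c : Fin N → Fin m → ℝ) (k : Fin N → Fin n → ℤ) : Continuous (cf a c k) := by
  unfold cf cexpo
  have h1 : Continuous fun t => Complex.log (dd a t) := (dd_cont a).clog (dd_slit a)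
  have h2 : ∀ β i, Continuous fun t : ℝ => Complex.I * t * (c β i : ℂ) ^ 2 / dd a t := fun β i =>
    Continuous.div (by fun_prop) (dd_cont a) (dd_ne a)
  have h3 : Continuous fun t : ℝ => ∑ β, ∑ i, Complex.I * t * (c β i : ℂ) ^ 2 / dd a t :=
    continuous_finsetSum _ fun β _ => continuous_finsetSum _ fun i _ => h2 β i
  fun_prop

lemma GFd_bound {a : ℝ} (ha : 0 < a) (c : Fin N → Fin m → ℝ) (k : Fin N → Fin n → ℤ) (t : ℝ) :
    ∃ C r : ℝ, 0 < r ∧ ∀ s ∈ Set.Icc (t - 1) (t + 1), ∀ x : Cfg m n N, ‖GFd a c k s x‖ ≤ C * gau r x := by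
  obtain ⟨M, hM, hb, he⟩ := exists_M (a:ℂ) (fun (β : Fin N) (i : Fin m) => Complex.I * (c β i : ℂ))
  set r : ℝ := a / (1 + 16 * a ^ 2 * (|t| + 1) ^ 2) with hr
  have hr0 : 0 < r := by positivity
  obtain ⟨C, hC, h3⟩ := EfacE_bound (m := m) k r M hr0
  obtain ⟨B, hB⟩ := (isCompact_Icc (a := t - 1) (b := t + 1)).exists_bound_of_continuousOn (cf_cont a c k).continuousOn
  refine ⟨B * C, r / 4, by linarith, fun s hs x => ?_⟩
  have hsabs : |s| ≤ |t| + 1 := by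
    have : |s - t| ≤ 1 := abs_le.2 ⟨by linarith [hs.1], by linarith [hs.2]⟩
    have h2 := abs_add_le (s - t) t
    rw [sub_add_cancel] at h2; linarith
  have e1 : r ≤ (bt a s).re := by
    unfold bt
    rw [div_dd_re, hr, ← sq_abs s]
    gcongr
  have e2 : ‖bt a s‖ ≤ M := by
    unfold bt
    rw [norm_div]
    exact (div_le_self (norm_nonneg _) (dd_norm_ge a s)).trans hb
  have e3 : ∀ β i, ‖et a c s β i‖ ≤ M := fun β i => by
    unfold et
    rw [norm_div]
    exact (div_le_self (norm_nonneg _) (dd_norm_ge a s)).trans (he β i)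
  have hB0 : 0 ≤ B := (norm_nonneg _).trans (hB s hs)
  unfold GFd
  rw [norm_mul, norm_mul, Complex.norm_I, one_mul, mul_assoc]
  gcongr
  · exact hB s hs
  · exact (h3 _ _ e1 e2 e3 x).2

/-- The evolved Gaussian as an `L²` curve. -/
def GLt {a : ℝ} (ha : 0 < a) (c : Fin N → Fin m → ℝ) (k : Fin N → Fin n → ℤ) (t : ℝ) : L2 m n N := (GF_memLp ha c k t).toLp

lemma GL_deriv {a : ℝ} (ha : 0 < a) (c : Fin N → Fin m → ℝ) (k : Fin N → Fin n → ℤ) (t : ℝ) :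
    HasDerivAt (GLt ha c k) ((GFd_memLp ha c k t).toLp) t := by
  rw [hasDerivAt_iff_tendsto_slope_zero]
  obtain ⟨C, r, hr, hC⟩ := GFd_bound ha c k t
  have hmem : ∀ h : ℝ, MemLp (fun x => ((h⁻¹ : ℝ) : ℂ) * (GF a c k (t + h) x - GF a c k t x)) 2 := fun h =>
    ((GF_memLp ha c k (t + h)).sub (GF_memLp ha c k t)).const_mul _
  have hT : Filter.Tendsto (fun h => (hmem h).toLp) (nhdsWithin 0 {0}ᶜ) (nhds (GFd_memLp ha c k t).toLp) := by
    refine L2_dct _ _ (fun x => C * gau r x) _ _ ((gau_memLp r hr).const_mul C) ?_ ?_ ?_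
    · have : ∀ᶠ h : ℝ in nhdsWithin 0 {0}ᶜ, h ∈ Set.Icc (-1:ℝ) 1 :=
        (mem_nhdsWithin_of_mem_nhds (Icc_mem_nhds (by norm_num) (by norm_num)))
      filter_upwards [this, self_mem_nhdsWithin] with h hh hne
      refine Filter.Eventually.of_forall fun x => ?_
      have hne' : h ≠ 0 := hne
      have := Convex.norm_image_sub_le_of_norm_hasDerivWithin_le (f := fun s => GF a c k s x) (s := Set.Icc (t - 1) (t + 1))
        (fun s hs => (GF_deriv a c k x s).hasDerivWithinAt) (fun s hs => hC s hs x) (convex_Icc _ _)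
        (x := t) (y := t + h) ⟨by linarith, by linarith⟩ ⟨by linarith [hh.1], by linarith [hh.2]⟩
      rw [norm_mul, Complex.norm_real, norm_inv]
      rw [add_sub_cancel_left] at this
      have hp : 0 < ‖h‖ := norm_pos_iff.2 hne'
      rw [inv_mul_le_iff₀ hp, mul_comm]
      exact this
    · exact Filter.Eventually.of_forall fun x => hC t ⟨by linarith, by linarith⟩ x
    · refine Filter.Eventually.of_forall fun x => ?_
      have := (hasDerivAt_iff_tendsto_slope_zero.1 (GF_deriv a c k x t))
      simpa only [Complex.real_smul] using this
  refine hT.congr fun h => ?_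
  have : GLt ha c k (t + h) - GLt ha c k t = ((GF_memLp ha c k (t + h)).sub (GF_memLp ha c k t)).toLp := rfl
  rw [this]
  rfl

lemma tendsto_pr {ι X : Type*} [MeasurableSpace X] {μ : Measure X} {l : Filter ι} {g v : ι → Lp ℂ 2 μ} {g0 v0 : Lp ℂ 2 μ}
    (hg : Filter.Tendsto g l (nhds g0)) (hv : Filter.Tendsto v l (nhds v0)) :
    Filter.Tendsto (fun i => pr (g i) (v i)) l (nhds (pr g0 v0)) := by
  rw [tendsto_iff_norm_sub_tendsto_zero]
  have h1 := (tendsto_iff_norm_sub_tendsto_zero.1 hg).mul hv.norm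
  have h2 := (tendsto_iff_norm_sub_tendsto_zero.1 hv).const_mul ‖g0‖
  have h3 := h1.add h2
  simp only [zero_mul, mul_zero, add_zero] at h3
  refine squeeze_zero (fun _ => norm_nonneg _) (fun i => ?_) h3
  have : pr (g i) (v i) - pr g0 v0 = pr (g i - g0) (v i) + pr g0 (v i - v0) := by
    rw [pr_sub_left, pr_sub_right]; ring
  rw [this]
  exact (norm_add_le _ _).trans (add_le_add (pr_le _ _) (pr_le _ _))

lemma pr_zero_left {X : Type*} [MeasurableSpace X] {μ : Measure X} (v : Lp ℂ 2 μ) : pr (0 : Lp ℂ 2 μ) v = 0 := by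
  have := pr_sub_left (0 : Lp ℂ 2 μ) 0 v
  simpa using this

lemma hasDerivAt_pr {V : ℝ → L2 m n N} (hV : Continuous V) {g : ℝ → L2 m n N} {g' : L2 m n N} {D : ℂ} {s : ℝ}
    (hg : HasDerivAt g g' s) (hD : HasDerivAt (fun r => pr (g s) (V r)) D s) :
    HasDerivAt (fun r => pr (g r) (V r)) (pr g' (V s) + D) s := by
  have h1 : HasDerivAt (fun r => pr (g r - g s) (V r)) (pr g' (V s)) s := by
    rw [hasDerivAt_iff_tendsto_slope_zero] at hg ⊢
    have hV2 : Filter.Tendsto (fun h => V (s + h)) (nhdsWithin 0 {0}ᶜ) (nhds (V s)) := by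
      have : Continuous fun h => V (s + h) := hV.comp (continuous_const.add continuous_id)
      have h2 := this.tendsto 0
      rw [add_zero] at h2
      exact h2.mono_left nhdsWithin_le_nhds
    refine (tendsto_pr hg hV2).congr fun h => ?_
    rw [sub_self, pr_zero_left, sub_zero]
    have : h⁻¹ • (g (s + h) - g s) = ((h⁻¹ : ℝ) : ℂ) • (g (s + h) - g s) := rfl
    rw [this, pr_smul_left, Complex.real_smul]
  refine (h1.add hD).congr_of_eventuallyEq (Filter.Eventually.of_forall fun r => ?_)
  simp only [Pi.add_apply, pr_sub_left]
  ring

lemma GL_zero {a : ℝ} (ha : 0 < a) (c : Fin N → Fin m → ℝ) (k : Fin N → Fin n → ℤ) : GLt ha c k 0 = G0 a ha c k := by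
  unfold GLt G0
  congr 1
  funext x
  have hd : dd a 0 = 1 := by unfold dd; simp
  have he : et a c 0 = fun β i => Complex.I * (c β i : ℂ) := by
    funext β i
    simp only [et, hd, div_one]
  simp only [GF, cf, cexpo, bt, he, hd]
  simp

lemma evolve {U : ℝ → L2 m n N →L[ℂ] L2 m n N} (hU : IsPropagator m n N 0 U) {a : ℝ} (ha : 0 < a)
    (c : Fin N → Fin m → ℝ) (k : Fin N → Fin n → ℤ) (T : ℝ) (u : L2 m n N) :
    pr (G0 a ha c k) (U T u) = pr (GLt ha c k T) u := by
  have hconst : ∀ s, HasDerivAt (fun s => pr (GLt ha c k (T - s)) (U s u)) 0 s := by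
    intro s
    have h1 : HasDerivAt (fun s => GLt ha c k (T - s)) (-((GFd_memLp ha c k (T - s)).toLp)) s := by
      have := (GL_deriv ha c k (T - s)).scomp s ((hasDerivAt_id s).const_sub T)
      rw [neg_one_smul] at this
      exact this
    have h2 := (weak_E hU (bt a (T - s)) (bt_re_pos ha _) (et a c (T - s)) k u s).const_mul (cf a c k (T - s))
    have h3 := hasDerivAt_pr (scont hU u) h1 (h2.congr_of_eventuallyEq (Filter.Eventually.of_forall fun r => by
      simp only
      rw [← pr_smul_left]
      rfl))
    refine h3.congr_deriv ?_
    have e : (GFd_memLp ha c k (T - s)).toLp = (Complex.I * cf a c k (T - s)) • (EfacE_memLp _ (bt_re_pos ha (T - s)) (et a c (T - s)) k).toLp := rfl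
    rw [e, ← neg_smul, pr_smul_left]
    ring
  have h4 := is_const_of_deriv_eq_zero (f := fun s => pr (GLt ha c k (T - s)) (U s u))
    (fun s => (hconst s).differentiableAt) (fun s => (hconst s).deriv) T 0
  simp only [sub_self, sub_zero, GL_zero, hU.init] at h4
  simpa using h4

end ManyBodyWaveguide

namespace ManyBodyWaveguide

variable {m n N : ℕ}

abbrev Rest (m n N : ℕ) (α : Fin N) := Torus n × Hat m n N α

instance restSF (α : Fin N) : SigmaFinite (volume : Measure (Rest m n N α)) :=
  Measure.prod.instSigmaFinite (μ := (volume : Measure (Torus n))) (ν := (volume : Measure (Hat m n N α)))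

def gl (α : Fin N) (p : (Fin m → ℝ) × Rest m n N α) : Cfg m n N := glue m n N α (p.1, p.2.1) p.2.2

lemma gl_mp (α : Fin N) : MeasurePreserving (gl (m := m) (n := n) α) volume volume := by
  have h1 := (volume_preserving_piEquivPiSubtypeProd (fun _ : Fin N => Wg m n) (fun β => β = α)).symm
  have h2 := (volume_preserving_funUnique {β : Fin N // β = α} (Wg m n)).symm
  have h3 : MeasurePreserving (Prod.map (MeasurableEquiv.funUnique {β : Fin N // β = α} (Wg m n)).symm id) volume volume := h2.prod (MeasurePreserving.id (volume : Measure (Hat m n N α)))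
  have h3' := h3
  rw [Subsingleton.elim (Fintype.subtypeEq α) (Subtype.fintype (fun β => β = α))] at h3'
  have h4 := (volume_preserving_prodAssoc (α₁ := Fin m → ℝ) (β₁ := Torus n) (γ₁ := Hat m n N α)).symm
  have h5 := (h1.comp h3').comp h4
  have e : gl (m := m) (n := n) α = ((MeasurableEquiv.piEquivPiSubtypeProd (fun _ => Wg m n) fun β => β = α).symm ∘
        Prod.map (MeasurableEquiv.funUnique { β // β = α } (Wg m n)).symm id) ∘ MeasurableEquiv.prodAssoc.symm := by
    funext p
    funext β
    by_cases hβ : β = α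
    · simp [gl, glue, hβ, MeasurableEquiv.piEquivPiSubtypeProd, Equiv.piEquivPiSubtypeProd, MeasurableEquiv.prodAssoc, Equiv.prodAssoc]
    · simp [gl, glue, hβ, MeasurableEquiv.piEquivPiSubtypeProd, Equiv.piEquivPiSubtypeProd, MeasurableEquiv.prodAssoc, Equiv.prodAssoc]
  rw [e]
  exact h5

def nu (α : Fin N) (f : Cfg m n N → ℂ) (y : Fin m → ℝ) : ℝ≥0∞ :=
  eLpNorm (fun η : Rest m n N α => f (gl α (y, η))) 2 volume

lemma nu_eq (α : Fin N) (f : Cfg m n N → ℂ) (y : Fin m → ℝ) :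
    nu α f y = (∫⁻ η : Rest m n N α, ‖f (gl α (y, η))‖ₑ ^ 2) ^ (1/2 : ℝ) := by
  rw [nu, eLpNorm_eq_lintegral_rpow_enorm_toReal (by simp) (by simp)]
  simp

lemma nu_sq (α : Fin N) (f : Cfg m n N → ℂ) (y : Fin m → ℝ) :
    nu α f y ^ 2 = ∫⁻ η : Rest m n N α, ‖f (gl α (y, η))‖ₑ ^ 2 := by
  rw [nu_eq, ← ENNReal.rpow_natCast, ← ENNReal.rpow_mul]
  simp

lemma gl_meas (α : Fin N) : Measurable (gl (m := m) (n := n) α) := (gl_mp α).measurable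

lemma nu_measurable (α : Fin N) {f : Cfg m n N → ℂ} (hf : Measurable f) : Measurable (nu α f) := by
  have : nu α f = fun y => (∫⁻ η : Rest m n N α, ‖f (gl α (y, η))‖ₑ ^ 2) ^ (1/2 : ℝ) := by
    funext y; exact nu_eq α f y
  rw [this]
  have h2 : Measurable fun p : (Fin m → ℝ) × Rest m n N α => ‖f (gl α p)‖ₑ ^ 2 := ((hf.comp (gl_meas α)).enorm).pow_const 2
  exact (Measurable.lintegral_prod_right' h2).pow_const _

lemma lint_gl (α : Fin N) {f : Cfg m n N → ℝ≥0∞} (hf : Measurable f) :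
    ∫⁻ x, f x = ∫⁻ y : Fin m → ℝ, ∫⁻ η : Rest m n N α, f (gl α (y, η)) := by
  rw [← (gl_mp α).lintegral_comp hf]
  exact lintegral_prod _ ((hf.comp (gl_meas α)).aemeasurable)

lemma lint_nu_sq (α : Fin N) {f : Cfg m n N → ℂ} (hf : Measurable f) :
    ∫⁻ y, nu α f y ^ 2 = ∫⁻ x, ‖f x‖ₑ ^ 2 := by
  rw [lint_gl α (hf.enorm.pow_const 2)]
  simp_rw [nu_sq]

lemma enorm_L2_sq (f : L2 m n N) : ‖f‖ₑ ^ 2 = ∫⁻ x, ‖f x‖ₑ ^ 2 := by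
  rw [Lp.enorm_def, eLpNorm_eq_lintegral_rpow_enorm_toReal (by simp) (by simp), ← ENNReal.rpow_natCast, ← ENNReal.rpow_mul]
  simp

lemma L2_meas (f : L2 m n N) : Measurable (f : Cfg m n N → ℂ) := (Lp.stronglyMeasurable f).measurable

lemma lint_nu_L2 (α : Fin N) (f : L2 m n N) : ∫⁻ y, nu α f y ^ 2 = ‖f‖ₑ ^ 2 := by
  rw [lint_nu_sq α (L2_meas f), enorm_L2_sq]

lemma frozen_eq (α : Fin N) {f : Cfg m n N → ℂ} (hf : Measurable f) (y : Fin m → ℝ) :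
    eN 2 volume (fun z : Torus n => eLpNorm (fun h : Hat m n N α => f (glue m n N α (y, z) h)) 2 volume) = nu α f y := by
  rw [nu_eq, eN, if_neg (by simp)]
  have hm : Measurable fun η : Rest m n N α => ‖f (gl α (y, η))‖ₑ ^ 2 :=
    ((hf.comp ((gl_meas α).comp measurable_prodMk_left)).enorm).pow_const 2
  have h2 : ∫⁻ η : Rest m n N α, ‖f (gl α (y, η))‖ₑ ^ 2 = ∫⁻ z : Torus n, ∫⁻ h : Hat m n N α, ‖f (gl α (y, (z, h)))‖ₑ ^ 2 :=
    lintegral_prod _ hm.aemeasurable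
  rw [h2]
  simp only [ENNReal.toReal_ofNat, one_div]
  congr 1
  refine lintegral_congr fun z => ?_
  rw [eLpNorm_eq_lintegral_rpow_enorm_toReal (by simp) (by simp), ← ENNReal.rpow_mul]
  simp [gl]

lemma nu_congr (α : Fin N) {f g : Cfg m n N → ℂ} (h : f =ᵐ[volume] g) : nu α f =ᵐ[volume] nu α g := by
  have h1 : ∀ᵐ p : (Fin m → ℝ) × Rest m n N α, f (gl α p) = g (gl α p) := (gl_mp α).quasiMeasurePreserving.ae h
  have h2 := Measure.ae_ae_of_ae_prod h1
  filter_upwards [h2] with y hy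
  exact eLpNorm_congr_ae hy

lemma nu_mono (α : Fin N) {f g : Cfg m n N → ℂ} (h : ∀ x, ‖f x‖ ≤ ‖g x‖) (y) : nu α f y ≤ nu α g y :=
  eLpNorm_mono fun _ => h _

lemma lint_mul_le (α : Fin N) {f g : Cfg m n N → ℂ} (hf : Measurable f) (hg : Measurable g) :
    ∫⁻ x, ‖f x‖ₑ * ‖g x‖ₑ ≤ ∫⁻ y, nu α f y * nu α g y := by
  rw [lint_gl α (f := fun x => ‖f x‖ₑ * ‖g x‖ₑ) (hf.enorm.mul hg.enorm)]
  refine lintegral_mono fun y => ?_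
  have hf' : Measurable fun η : Rest m n N α => ‖f (gl α (y, η))‖ₑ := (hf.comp ((gl_meas α).comp measurable_prodMk_left)).enorm
  have hg' : Measurable fun η : Rest m n N α => ‖g (gl α (y, η))‖ₑ := (hg.comp ((gl_meas α).comp measurable_prodMk_left)).enorm
  have := ENNReal.lintegral_mul_le_Lp_mul_Lq volume (Real.HolderConjugate.two_two) hf'.aemeasurable hg'.aemeasurable
  rw [nu_eq, nu_eq]
  simpa using this

lemma enorm_pr_le (α : Fin N) (f u : L2 m n N) : ‖pr f u‖ₑ ≤ ∫⁻ y, nu α f y * nu α u y := by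
  rw [pr_eq]
  refine (enorm_integral_le_lintegral_enorm _).trans ?_
  simp_rw [enorm_mul]
  exact lint_mul_le α (L2_meas f) (L2_meas u)

end ManyBodyWaveguide

namespace ManyBodyWaveguide

variable {m n N : ℕ}

def PP (a : ℝ) (c : Fin m → ℝ) (t : ℝ) (y : Fin m → ℝ) : ℂ :=
  Complex.exp (∑ i, (-bt a t * (y i : ℂ) ^ 2 + Complex.I * c i / dd a t * (y i : ℂ) - Complex.I * t * (c i : ℂ) ^ 2 / dd a t))

lemma gl_same (α : Fin N) (y : Fin m → ℝ) (η : Rest m n N α) : (gl α (y, η) α).1 = y := by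
  simp [gl, glue]

lemma gl_ne (α : Fin N) (y y' : Fin m → ℝ) (η : Rest m n N α) {β : Fin N} (h : β ≠ α) : gl α (y, η) β = gl α (y', η) β := by
  simp [gl, glue, h]

lemma gl_snd (α : Fin N) (y y' : Fin m → ℝ) (η : Rest m n N α) (β : Fin N) : (gl α (y, η) β).2 = (gl α (y', η) β).2 := by
  by_cases h : β = α
  · simp [gl, glue, h]
  · rw [gl_ne α y y' η h]

lemma ph_gl (α : Fin N) (k : Fin N → Fin n → ℤ) (y y' : Fin m → ℝ) (η : Rest m n N α) : ph k (gl α (y, η)) = ph k (gl α (y', η)) := by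
  unfold ph
  refine Finset.prod_congr rfl fun β _ => Finset.prod_congr rfl fun j _ => ?_
  rw [gl_snd α y y' η β]

lemma GF_gl (α : Fin N) (a : ℝ) (c : Fin N → Fin m → ℝ) (k : Fin N → Fin n → ℤ) (t : ℝ) (y : Fin m → ℝ) (η : Rest m n N α) :
    GF a c k t (gl α (y, η)) = PP a (c α) t y * GF a (Function.update c α 0) k t (gl α (0, η)) := by
  unfold GF cf PP Efun
  rw [ph_gl α k y 0 η, ← mul_assoc, ← mul_assoc, ← mul_assoc, ← Complex.exp_add, ← Complex.exp_add, ← Complex.exp_add]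
  congr 2
  unfold cexpo
  have key : ∑ β, ((∑ i, (-bt a t * ((gl α (y, η) β).1 i : ℂ) ^ 2 + et a c t β i * ((gl α (y, η) β).1 i : ℂ)) - ∑ i, Complex.I * t * (c β i : ℂ) ^ 2 / dd a t)
      - (∑ i, (-bt a t * ((gl α (0, η) β).1 i : ℂ) ^ 2 + et a (Function.update c α 0) t β i * ((gl α (0, η) β).1 i : ℂ)) - ∑ i, Complex.I * t * ((Function.update c α 0) β i : ℂ) ^ 2 / dd a t))
      = ∑ i, (-bt a t * (y i : ℂ) ^ 2 + Complex.I * c α i / dd a t * (y i : ℂ) - Complex.I * t * (c α i : ℂ) ^ 2 / dd a t) := by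
    rw [Finset.sum_eq_single α]
    · simp [gl_same, et, Finset.sum_sub_distrib, Finset.sum_add_distrib]
    · intro β _ hβ
      rw [gl_ne α y 0 η hβ]
      simp [et, Function.update_of_ne hβ]
    · simp
  rw [← key]
  simp only [Finset.sum_sub_distrib]
  ring

lemma PP_zero (a : ℝ) (c : Fin m → ℝ) (y : Fin m → ℝ) :
    PP a c 0 y = Complex.exp (-(a:ℂ) * ∑ i, (y i : ℂ) ^ 2 + ∑ i, Complex.I * c i * (y i : ℂ)) := by
  unfold PP bt
  have hd : dd a 0 = 1 := by unfold dd; simp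
  simp [hd, Finset.sum_add_distrib, Finset.mul_sum]

def kb (a t : ℝ) : ℂ := a - Complex.I / (4 * t)

lemma kb_eq {a t : ℝ} (ht : t ≠ 0) : kb a t = dd a t / (4 * t * Complex.I) := by
  have ht' : (t:ℂ) ≠ 0 := by exact_mod_cast ht
  unfold kb dd
  field_simp
  linear_combination -Complex.I_sq

lemma kb_re (a t : ℝ) : (kb a t).re = a := by
  have : Complex.I / (4 * (t:ℂ)) = ((1/(4*t) : ℝ) : ℂ) * Complex.I := by
    push_cast; ring
  unfold kb
  rw [this]; simp

lemma kb_norm {a t : ℝ} (ht : t ≠ 0) : ‖kb a t‖ = ‖dd a t‖ / (4 * |t|) := by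
  rw [kb_eq ht]; simp

def ker (t : ℝ) (y v : Fin m → ℝ) : ℂ := Complex.exp (((∑ i, (y i - v i) ^ 2 / (4 * t) : ℝ) : ℂ) * Complex.I)

lemma ker_norm (t : ℝ) (y v : Fin m → ℝ) : ‖ker t y v‖ = 1 := Complex.norm_exp_ofReal_mul_I _

lemma PP_kernel {a t : ℝ} (ha : 0 < a) (ht : t ≠ 0) (c y : Fin m → ℝ) :
    ∫ v, ker t y v * PP a c 0 v = (Real.pi / kb a t) ^ ((m:ℂ) / 2) * PP a c t y := by
  have h := GaussianFourier.integral_cexp_neg_mul_sum_add (b := kb a t) (ι := Fin m) (by rw [kb_re]; exact ha) (fun i => Complex.I * c i - Complex.I * y i / (2 * t))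
  have ht' : (t:ℂ) ≠ 0 := by exact_mod_cast ht
  have hdd := dd_ne a t
  have e1 : ∀ v, ker t y v * PP a c 0 v = Complex.exp (∑ i, Complex.I * (y i : ℂ) ^ 2 / (4 * t)) *
      Complex.exp (-kb a t * ∑ i, (v i : ℂ) ^ 2 + ∑ i, (Complex.I * c i - Complex.I * y i / (2 * t)) * v i) := by
    intro v
    rw [PP_zero, ker, ← Complex.exp_add, ← Complex.exp_add]
    congr 1
    push_cast
    rw [Finset.sum_mul, Finset.mul_sum, Finset.mul_sum, ← Finset.sum_add_distrib, ← Finset.sum_add_distrib, ← Finset.sum_add_distrib, ← Finset.sum_add_distrib]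
    refine Finset.sum_congr rfl fun i _ => ?_
    unfold kb
    field_simp
    ring
  simp_rw [e1]
  rw [integral_const_mul, h, Fintype.card_fin, mul_left_comm, ← Complex.exp_add]
  congr 2
  rw [Finset.sum_div, ← Finset.sum_add_distrib]
  refine Finset.sum_congr rfl fun i _ => ?_
  rw [kb_eq ht]
  unfold bt
  field_simp
  have hD : dd a t = 1 + 4 * a * t * Complex.I := rfl
  rw [hD]
  have I2 := Complex.I_sq
  linear_combination (16 * (a:ℂ) * t * (y i : ℂ) ^ 2 + 4 * Complex.I * ((t:ℂ) * c i * 2 - y i) ^ 2) * I2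

lemma PP_kernel_int {a t : ℝ} (ha : 0 < a) (ht : t ≠ 0) (c y : Fin m → ℝ) :
    Integrable fun v => ker t y v * PP a c 0 v := by
  by_contra h
  have h1 := PP_kernel ha ht c y
  rw [integral_undef h] at h1
  have h2 : (Real.pi / kb a t : ℂ) ≠ 0 := by
    refine div_ne_zero (by exact_mod_cast Real.pi_ne_zero) fun h => ?_
    have := kb_re a t
    rw [h] at this; simp at this; linarith
  have h3 : ((Real.pi / kb a t : ℂ) ^ ((m:ℂ)/2)) ≠ 0 := by
    rw [Complex.cpow_def_of_ne_zero h2]; exact Complex.exp_ne_zero _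
  exact mul_ne_zero h3 (Complex.exp_ne_zero _) h1.symm

lemma kc_norm {a t : ℝ} (ht : t ≠ 0) : ‖(Real.pi / kb a t : ℂ) ^ ((m:ℂ)/2)‖ = (4 * Real.pi * |t| / ‖dd a t‖) ^ ((m:ℝ)/2) := by
  have : ((m:ℂ)/2) = (((m:ℝ)/2 : ℝ) : ℂ) := by push_cast; rfl
  rw [this, Complex.norm_cpow_real, norm_div, kb_norm ht]
  congr 1
  have : 0 < ‖dd a t‖ := norm_pos_iff.2 (dd_ne a t)
  simp [abs_of_pos Real.pi_pos]
  field_simp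

lemma gauss_lint {β : ℝ} (hβ : 0 < β) : ∫⁻ v : Fin m → ℝ, ENNReal.ofReal (Real.exp (-β * ∑ i, v i ^ 2)) = ENNReal.ofReal ((Real.pi / β) ^ ((m:ℝ)/2)) := by
  have h := GaussianFourier.integral_cexp_neg_mul_sum_add (b := (β:ℂ)) (ι := Fin m) (by simpa using hβ) 0
  have e : ∀ v : Fin m → ℝ, Complex.exp (-(β:ℂ) * ∑ i, (v i : ℂ) ^ 2 + ∑ i, (0 : Fin m → ℂ) i * v i) = ((Real.exp (-β * ∑ i, v i ^ 2) : ℝ) : ℂ) := by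
    intro v
    push_cast
    simp
  have e2 : (Real.pi / β : ℂ) ^ (Fintype.card (Fin m) / 2 : ℂ) * Complex.exp ((∑ i, (0 : Fin m → ℂ) i ^ 2) / (4 * β)) = (((Real.pi / β) ^ ((m:ℝ)/2) : ℝ) : ℂ) := by
    rw [Complex.ofReal_cpow (by positivity)]
    push_cast
    simp
  simp_rw [e] at h
  rw [e2, integral_complex_ofReal] at h
  have h' := Complex.ofReal_injective h
  have hpos : 0 < (Real.pi / β) ^ ((m:ℝ)/2) := by positivity
  have hIntg : Integrable fun v : Fin m → ℝ => Real.exp (-β * ∑ i, v i ^ 2) := by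
    by_contra hc
    rw [integral_undef hc] at h'
    linarith
  rw [← h', ofReal_integral_eq_lintegral_ofReal hIntg (Filter.Eventually.of_forall fun v => (Real.exp_pos _).le)]

lemma PP_norm0 {a : ℝ} (t : ℝ) (y : Fin m → ℝ) : ‖PP a 0 t y‖ₑ ^ 2 = ENNReal.ofReal (Real.exp (-(2 * (bt a t).re) * ∑ i, y i ^ 2)) := by
  rw [← ofReal_norm, ← ENNReal.ofReal_pow (norm_nonneg _), PP, Complex.norm_exp, ← Real.exp_nat_mul]
  congr 2
  have : ∑ i, (-bt a t * (y i : ℂ) ^ 2 + Complex.I * ((0 : Fin m → ℝ) i : ℂ) / dd a t * (y i : ℂ) - Complex.I * t * ((0 : Fin m → ℝ) i : ℂ) ^ 2 / dd a t) = -bt a t * ((∑ i, y i ^ 2 : ℝ) : ℂ) := by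
    push_cast
    rw [Finset.mul_sum]
    simp
  rw [this, Complex.re_mul_ofReal]
  simp; ring

lemma lint_PP {a : ℝ} (ha : 0 < a) (t : ℝ) : ∫⁻ y : Fin m → ℝ, ‖PP a 0 t y‖ₑ ^ 2 = ENNReal.ofReal ((Real.pi * ‖dd a t‖ ^ 2 / (2 * a)) ^ ((m:ℝ)/2)) := by
  simp_rw [PP_norm0]
  rw [gauss_lint (by have := bt_re_pos ha t; linarith)]
  congr 2
  unfold bt
  rw [div_dd_re, ← dd_normSq, Complex.normSq_eq_norm_sq]
  have : 0 < ‖dd a t‖ := norm_pos_iff.2 (dd_ne a t)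
  field_simp

end ManyBodyWaveguide

namespace ManyBodyWaveguide

variable {m n N : ℕ}

section
variable {ι : Type*} (s : Finset ι) (c : ι → Fin N → Fin m → ℝ) (k : ι → Fin N → Fin n → ℤ)

/-- sums of evolved Gaussians. -/
def WF (a : ℝ) (b : ι → ℂ) (t : ℝ) (x : Cfg m n N) : ℂ := ∑ j ∈ s, b j * GF a (c j) (k j) t x

def c0 (α : Fin N) (j : ι) : Fin N → Fin m → ℝ := Function.update (c j) α 0

def EE (α : Fin N) (a : ℝ) (t : ℝ) (d : ι → ℂ) : ℝ≥0∞ :=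
  eLpNorm (fun η : Rest m n N α => ∑ j ∈ s, d j * GF a (c0 c α j) (k j) t (gl α (0, η))) 2 volume

lemma nu_WF (α : Fin N) (a : ℝ) (b : ι → ℂ) (t : ℝ) (y : Fin m → ℝ) :
    nu α (WF s c k a b t) y = EE s c k α a t (fun j => b j * PP a (c j α) t y) := by
  unfold nu EE WF
  congr 1
  funext η
  refine Finset.sum_congr rfl fun j _ => ?_
  rw [GF_gl, mul_assoc]; rfl

lemma GF_meas (a : ℝ) (c : Fin N → Fin m → ℝ) (k : Fin N → Fin n → ℤ) (t : ℝ) : Measurable (GF a c k t) :=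
  measurable_const.mul (Efun_cont _ _ _).measurable

lemma WF_meas (a : ℝ) (b : ι → ℂ) (t : ℝ) : Measurable (WF s c k a b t) :=
  Finset.measurable_fun_sum _ fun j _ => measurable_const.mul (GF_meas _ _ _ _)

def WL {a : ℝ} (ha : 0 < a) (b : ι → ℂ) (t : ℝ) : L2 m n N := ∑ j ∈ s, b j • GLt ha (c j) (k j) t

lemma WL_coe {a : ℝ} (ha : 0 < a) (b : ι → ℂ) (t : ℝ) : (WL s c k ha b t : Cfg m n N → ℂ) =ᵐ[volume] WF s c k a b t := by
  classical
  unfold WL WF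
  induction s using Finset.induction_on with
  | empty =>
    simp only [Finset.sum_empty]
    exact Lp.coeFn_zero ℂ 2 (volume : Measure (Cfg m n N))
  | insert i s hi ih =>
    simp only [Finset.sum_insert hi]
    filter_upwards [ih, Lp.coeFn_add (b i • GLt ha (c i) (k i) t) (∑ j ∈ s, b j • GLt ha (c j) (k j) t),
      Lp.coeFn_smul (b i) (GLt ha (c i) (k i) t), (GF_memLp ha (c i) (k i) t).coeFn_toLp] with x h1 h2 h3 h4
    rw [h2, Pi.add_apply, h3, h1, Pi.smul_apply, smul_eq_mul]
    congr 2

lemma norm_WL0 (α : Fin N) {a : ℝ} (ha : 0 < a) (d : ι → ℂ) (t : ℝ) :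
    ‖WL s (c0 c α) k ha d t‖ₑ ^ 2 = ENNReal.ofReal ((Real.pi * ‖dd a t‖ ^ 2 / (2 * a)) ^ ((m:ℝ)/2)) * EE s c k α a t d ^ 2 := by
  rw [← lint_nu_L2 α, ← lint_PP ha t, ← lintegral_mul_const]
  · refine lintegral_congr_ae ?_
    filter_upwards [nu_congr α (WL_coe s (c0 c α) k ha d t)] with y hy
    rw [hy, ← mul_pow]
    congr 1
    unfold nu WF EE
    have : (fun η : Rest m n N α => ∑ j ∈ s, d j * GF a (c0 c α j) (k j) t (gl α (y, η))) =
        PP a 0 t y • fun η : Rest m n N α => ∑ j ∈ s, d j * GF a (c0 c α j) (k j) t (gl α (0, η)) := by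
      funext η
      rw [Pi.smul_apply, smul_eq_mul, Finset.mul_sum]
      refine Finset.sum_congr rfl fun j _ => ?_
      rw [GF_gl, c0, Function.update_self, Function.update_idem]; ring
    rw [this, eLpNorm_const_smul]
  · unfold PP
    fun_prop

lemma pr_sum_left (b : ι → ℂ) (g : ι → L2 m n N) (u : L2 m n N) : pr (∑ j ∈ s, b j • g j) u = ∑ j ∈ s, b j * pr (g j) u := by
  classical
  induction s using Finset.induction_on with
  | empty => simp [pr_zero_left]
  | insert i s hi ih => rw [Finset.sum_insert hi, Finset.sum_insert hi, pr_add_left, pr_smul_left, ih]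

lemma WL_evolve {U : ℝ → L2 m n N →L[ℂ] L2 m n N} (hU : IsPropagator m n N 0 U) {a : ℝ} (ha : 0 < a) (b : ι → ℂ) (t : ℝ) (u : L2 m n N) :
    pr (WL s c k ha b 0) (U t u) = pr (WL s c k ha b t) u := by
  unfold WL
  rw [pr_sum_left, pr_sum_left]
  refine Finset.sum_congr rfl fun j _ => ?_
  rw [GL_zero, evolve hU]

lemma WL_norm_le {U : ℝ → L2 m n N →L[ℂ] L2 m n N} (hU : IsPropagator m n N 0 U) {a : ℝ} (ha : 0 < a) (b : ι → ℂ) (t : ℝ) :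
    ‖WL s c k ha b t‖ ≤ ‖WL s c k ha b 0‖ := by
  refine norm_le_of_pr _ _ (norm_nonneg _) fun v => ?_
  rw [← WL_evolve s c k hU]
  refine (pr_le _ _).trans ?_
  rw [hU.unitary]

lemma WL_int {a : ℝ} (ha : 0 < a) {t : ℝ} (ht : t ≠ 0) (α : Fin N) (b : ι → ℂ) (y : Fin m → ℝ) (e : ι → Fin N → Fin m → ℝ) :
    ∫ v, WL s e k ha (fun j => b j * (ker t y v * PP a (c j α) 0 v)) t =
      ((Real.pi / kb a t : ℂ) ^ ((m:ℂ)/2)) • WL s e k ha (fun j => b j * PP a (c j α) t y) t := by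
  unfold WL
  rw [integral_finsetSum, Finset.smul_sum]
  · refine Finset.sum_congr rfl fun j _ => ?_
    rw [integral_smul_const, integral_const_mul, PP_kernel ha ht, smul_smul]
    congr 1; ring
  · intro j _
    exact ((PP_kernel_int ha ht (c j α) y).const_mul (b j)).smul_const _

lemma disp_EE {U : ℝ → L2 m n N →L[ℂ] L2 m n N} (hU : IsPropagator m n N 0 U) {a : ℝ} (ha : 0 < a) {t : ℝ} (ht : t ≠ 0) (α : Fin N) (b : ι → ℂ) (y : Fin m → ℝ) :
    nu α (WF s c k a b t) y ≤ ENNReal.ofReal ((4 * Real.pi * |t|) ^ (-((m:ℝ)/2))) * ∫⁻ v, nu α (WF s c k a b 0) v := by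
  simp_rw [nu_WF]
  have hd : 0 < ‖dd a t‖ := norm_pos_iff.2 (dd_ne a t)
  have ht' : 0 < |t| := abs_pos.2 ht
  have hpi := Real.pi_pos
  have hd0 : dd a 0 = 1 := by unfold dd; simp
  set A0 : ℝ := (Real.pi / (2 * a)) ^ ((m:ℝ)/4) with hA0
  have hA0p : 0 < A0 := by positivity
  set Dm : ℝ := ‖dd a t‖ ^ ((m:ℝ)/2) with hDm
  have hDp : 0 < Dm := by positivity
  have hsqA : A0 ^ 2 = (Real.pi / (2 * a)) ^ ((m:ℝ)/2) := by
    rw [hA0, ← Real.rpow_natCast, ← Real.rpow_mul (by positivity)]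
    congr 1; push_cast; ring
  have hsqD : Dm ^ 2 = (‖dd a t‖ ^ 2) ^ ((m:ℝ)/2) := by
    rw [hDm, ← Real.rpow_natCast, ← Real.rpow_natCast, ← Real.rpow_mul hd.le, ← Real.rpow_mul hd.le]
    congr 1; push_cast; ring
  have n0 : ∀ d, ‖WL s (c0 c α) k ha d 0‖ₑ = ENNReal.ofReal A0 * EE s c k α a 0 d := by
    intro d
    refine (ENNReal.pow_right_strictMono (n := 2) (by norm_num)).injective ?_
    beta_reduce
    rw [norm_WL0, mul_pow, ← ENNReal.ofReal_pow hA0p.le]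
    congr 2
    rw [hsqA, hd0]
    simp
  have n1 : ∀ d, ‖WL s (c0 c α) k ha d t‖ₑ = ENNReal.ofReal (A0 * Dm) * EE s c k α a t d := by
    intro d
    refine (ENNReal.pow_right_strictMono (n := 2) (by norm_num)).injective ?_
    beta_reduce
    rw [norm_WL0, mul_pow, ← ENNReal.ofReal_pow (by positivity)]
    congr 2
    rw [mul_pow, hsqA, hsqD, mul_div_right_comm, Real.mul_rpow (by positivity) (by positivity)]
  have h1 := congrArg (fun z => ‖z‖ₑ) (WL_int s c k ha ht α b y (c0 c α))
  simp only [enorm_smul] at h1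
  have h2 : ‖(Real.pi / kb a t : ℂ) ^ ((m:ℂ)/2)‖ₑ = ENNReal.ofReal ((4 * Real.pi * |t|) ^ ((m:ℝ)/2) / Dm) := by
    rw [← ofReal_norm, kc_norm ht, Real.div_rpow (by positivity) (by positivity)]
  have h3 : ‖∫ v, WL s (c0 c α) k ha (fun j => b j * (ker t y v * PP a (c j α) 0 v)) t‖ₑ ≤ ENNReal.ofReal A0 * ∫⁻ v, EE s c k α a 0 (fun j => b j * PP a (c j α) 0 v) := by
    rw [← lintegral_const_mul' _ _ ENNReal.ofReal_ne_top]
    refine (enorm_integral_le_lintegral_enorm _).trans (lintegral_mono fun v => ?_)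
    have e : WL s (c0 c α) k ha (fun j => b j * (ker t y v * PP a (c j α) 0 v)) t = ker t y v • WL s (c0 c α) k ha (fun j => b j * PP a (c j α) 0 v) t := by
      unfold WL
      rw [Finset.smul_sum]
      refine Finset.sum_congr rfl fun j _ => ?_
      rw [smul_smul]; congr 1; ring
    simp only
    rw [e, enorm_smul, ← ofReal_norm (ker t y v), ker_norm, ENNReal.ofReal_one, one_mul, ← n0]
    exact enorm_le_iff_norm_le.2 (WL_norm_le s _ k hU ha _ t)
  rw [h1, h2, n1, ← mul_assoc, ← ENNReal.ofReal_mul (by positivity)] at h3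
  have h4 : (4 * Real.pi * |t|) ^ ((m:ℝ)/2) / Dm * (A0 * Dm) = A0 * (4 * Real.pi * |t|) ^ ((m:ℝ)/2) := by field_simp
  rw [h4, ENNReal.ofReal_mul hA0p.le, mul_assoc] at h3
  have h5 := (ENNReal.mul_le_mul_iff_right (by simpa using hA0p) ENNReal.ofReal_ne_top).1 h3
  rw [Real.rpow_neg (by positivity), ENNReal.ofReal_inv_of_pos (by positivity), ← ENNReal.div_eq_inv_mul]
  rw [ENNReal.le_div_iff_mul_le (by left; simp; positivity) (by left; simp), mul_comm]
  exact h5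

end

end ManyBodyWaveguide

namespace ManyBodyWaveguide

variable {m n N : ℕ}

def n1 (α : Fin N) (f : Cfg m n N → ℂ) : ℝ≥0∞ := ∫⁻ y, nu α f y

lemma n1_congr (α : Fin N) {f g : Cfg m n N → ℂ} (h : f =ᵐ[volume] g) : n1 α f = n1 α g := lintegral_congr_ae (nu_congr α h)

lemma nu_add (α : Fin N) {f g : Cfg m n N → ℂ} (hf : Measurable f) (hg : Measurable g) (y) : nu α (fun x => f x + g x) y ≤ nu α f y + nu α g y := by
  unfold nu
  exact eLpNorm_add_le (hf.comp ((gl_meas α).comp measurable_prodMk_left)).aestronglyMeasurable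
    (hg.comp ((gl_meas α).comp measurable_prodMk_left)).aestronglyMeasurable (by norm_num)

lemma n1_add (α : Fin N) {f g : Cfg m n N → ℂ} (hf : Measurable f) (hg : Measurable g) : n1 α (fun x => f x + g x) ≤ n1 α f + n1 α g := by
  unfold n1
  rw [← lintegral_add_left (nu_measurable α hf)]
  exact lintegral_mono fun y => nu_add α hf hg y

/-- bounded multipliers -/
def bm (φ : Cfg m n N → ℝ) (hφ : Measurable φ) (h1 : ∀ x, |φ x| ≤ 1) (f : L2 m n N) : L2 m n N :=
  MemLp.toLp (fun x => (φ x : ℂ) * f x) (((Lp.memLp f).mono ((Complex.measurable_ofReal.comp hφ).mul (L2_meas f)).aestronglyMeasurable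
    (Filter.Eventually.of_forall fun x => by
      rw [norm_mul, Complex.norm_real, Real.norm_eq_abs]
      exact mul_le_of_le_one_left (norm_nonneg _) (h1 x))))

lemma bm_coe (φ : Cfg m n N → ℝ) (hφ : Measurable φ) (h1 : ∀ x, |φ x| ≤ 1) (f : L2 m n N) :
    bm φ hφ h1 f =ᵐ[volume] fun x => (φ x : ℂ) * f x := MemLp.coeFn_toLp _

lemma bm_sub (φ : Cfg m n N → ℝ) (hφ : Measurable φ) (h1 : ∀ x, |φ x| ≤ 1) (f g : L2 m n N) :
    bm φ hφ h1 (f - g) = bm φ hφ h1 f - bm φ hφ h1 g := by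
  apply Lp.ext
  filter_upwards [bm_coe φ hφ h1 f, bm_coe φ hφ h1 g, bm_coe φ hφ h1 (f - g), Lp.coeFn_sub f g, Lp.coeFn_sub (bm φ hφ h1 f) (bm φ hφ h1 g)] with x e1 e2 e3 e4 e5
  rw [e5, e3, e4, Pi.sub_apply, Pi.sub_apply, e1, e2, mul_sub]

lemma bm_norm (φ : Cfg m n N → ℝ) (hφ : Measurable φ) (h1 : ∀ x, |φ x| ≤ 1) (f : L2 m n N) : ‖bm φ hφ h1 f‖ ≤ ‖f‖ := by
  refine Lp.norm_le_norm_of_ae_le ?_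
  filter_upwards [bm_coe φ hφ h1 f] with x hx
  rw [hx, norm_mul, Complex.norm_real, Real.norm_eq_abs]
  exact mul_le_of_le_one_left (norm_nonneg _) (h1 x)

lemma gau_le_one {a : ℝ} (ha : 0 ≤ a) (x : Cfg m n N) : |gau a x| ≤ 1 := by
  rw [abs_of_pos (gau_pos a x)]
  unfold gau
  rw [Real.exp_le_one_iff]
  have := Sq_nonneg x
  nlinarith

def mG (a : ℝ) (ha : 0 < a) (f : L2 m n N) : L2 m n N := bm (gau a) (gau_cont a).measurable (gau_le_one ha.le) f

section
variable {ι : Type*} (s : Finset ι) (c : ι → Fin N → Fin m → ℝ) (k : ι → Fin N → Fin n → ℤ)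

lemma GF_zero (a : ℝ) (c : Fin N → Fin m → ℝ) (k : Fin N → Fin n → ℤ) (x : Cfg m n N) : GF a c k 0 x = (gau a x : ℂ) * chi c k x := by
  rw [← Efun_gau]
  have hd : dd a 0 = 1 := by unfold dd; simp
  have he : et a c 0 = fun β i => Complex.I * (c β i : ℂ) := by
    funext β i
    simp only [et, hd, div_one]
  simp only [GF, cf, cexpo, bt, he, hd]
  simp

lemma mG_WL {a : ℝ} (ha : 0 < a) (ha2 : 0 < 2 * a) (b : ι → ℂ) : mG a ha (WL s c k ha b 0) = WL s c k ha2 b 0 := by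
  apply Lp.ext
  filter_upwards [bm_coe (gau a) (gau_cont a).measurable (gau_le_one ha.le) (WL s c k ha b 0), WL_coe s c k ha b 0, WL_coe s c k ha2 b 0] with x h1 h2 h3
  unfold mG
  rw [h1, h2, h3]
  unfold WF
  rw [Finset.mul_sum]
  refine Finset.sum_congr rfl fun j _ => ?_
  rw [GF_zero, GF_zero, two_mul, ← gau_mul]
  push_cast; ring

lemma disp1 {U : ℝ → L2 m n N →L[ℂ] L2 m n N} (hU : IsPropagator m n N 0 U) {a : ℝ} (ha : 0 < a) {t : ℝ} (ht : t ≠ 0) (α : Fin N) (b : ι → ℂ) (u : L2 m n N) :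
    ‖pr (WL s c k ha b 0) (U t u)‖ₑ ≤ ENNReal.ofReal ((4 * Real.pi * |t|) ^ (-((m:ℝ)/2))) * n1 α (WL s c k ha b 0) * n1 α u := by
  rw [WL_evolve s c k hU]
  refine (enorm_pr_le α _ _).trans ?_
  rw [n1_congr α (WL_coe s c k ha b 0)]
  unfold n1
  rw [← lintegral_const_mul _ (nu_measurable α (L2_meas u))]
  refine lintegral_mono_ae ?_
  filter_upwards [nu_congr α (WL_coe s c k ha b t)] with y hy
  rw [hy]
  gcongr
  exact disp_EE s c k hU ha ht α b y
end

lemma Sp_form {a : ℝ} (ha : 0 < a) {g : L2 m n N} (hg : g ∈ Sp m n N a ha) :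
    ∃ (s : Finset ((Fin N → Fin m → ℝ) × (Fin N → Fin n → ℤ))) (b : (Fin N → Fin m → ℝ) × (Fin N → Fin n → ℤ) → ℂ), g = WL s Prod.fst Prod.snd ha b 0 := by
  unfold Sp at hg
  obtain ⟨c, hc⟩ := (Finsupp.mem_span_range_iff_exists_finsupp).1 hg
  refine ⟨c.support, c, ?_⟩
  rw [← hc]
  unfold WL
  simp only [GL_zero]
  rfl

lemma n1_mG (α : Fin N) {a : ℝ} (ha : 0 < a) : ∃ B : ℝ≥0∞, B ≠ ∞ ∧ ∀ h : L2 m n N, n1 α (mG a ha h) ≤ B * ‖h‖ₑ := by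
  refine ⟨(∫⁻ y : Fin m → ℝ, ENNReal.ofReal (Real.exp (-a * ∑ i, y i ^ 2)) ^ (2:ℝ)) ^ (1/2:ℝ), ?_, fun h => ?_⟩
  · refine ENNReal.rpow_ne_top_of_nonneg (by norm_num) ?_
    have : ∀ y : Fin m → ℝ, ENNReal.ofReal (Real.exp (-a * ∑ i, y i ^ 2)) ^ (2:ℝ) = ENNReal.ofReal (Real.exp (-(2 * a) * ∑ i, y i ^ 2)) := by
      intro y
      rw [ENNReal.ofReal_rpow_of_pos (Real.exp_pos _), ← Real.exp_mul]
      congr 2; ring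
    simp_rw [this]
    rw [gauss_lint (by linarith)]
    exact ENNReal.ofReal_ne_top
  · have h2 : ‖h‖ₑ = (∫⁻ y, nu α h y ^ (2:ℝ)) ^ (1/2:ℝ) := by
      have := lint_nu_L2 α h
      simp_rw [← ENNReal.rpow_natCast] at this
      push_cast at this
      rw [this, ← ENNReal.rpow_mul]; simp
    rw [h2]
    have hm : Measurable fun y : Fin m → ℝ => ENNReal.ofReal (Real.exp (-a * ∑ i, y i ^ 2)) := by fun_prop
    refine le_trans ?_ (ENNReal.lintegral_mul_le_Lp_mul_Lq volume (Real.HolderConjugate.two_two) hm.aemeasurable (nu_measurable α (L2_meas h)).aemeasurable)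
    unfold n1
    refine lintegral_mono_ae ?_
    filter_upwards [nu_congr α (bm_coe (gau a) (gau_cont a).measurable (gau_le_one ha.le) h)] with y hy
    unfold mG
    rw [hy, Pi.mul_apply]
    have e : ENNReal.ofReal (Real.exp (-a * ∑ i, y i ^ 2)) = ‖((Real.exp (-a * ∑ i, y i ^ 2) : ℝ) : ℂ)‖ₑ := by
      rw [← ofReal_norm, Complex.norm_real, Real.norm_eq_abs, abs_of_pos (Real.exp_pos _)]
    unfold nu
    rw [e, ← eLpNorm_const_smul]
    refine eLpNorm_mono fun η => ?_
    rw [Pi.smul_apply, smul_eq_mul, norm_mul, norm_mul]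
    gcongr
    rw [Complex.norm_real, Complex.norm_real, Real.norm_eq_abs, Real.norm_eq_abs, abs_of_pos (gau_pos _ _), abs_of_pos (Real.exp_pos _)]
    unfold gau Sq
    apply Real.exp_le_exp.2
    have : ∑ i, y i ^ 2 ≤ ∑ β, ∑ i, (gl α (y, η) β).1 i ^ 2 := by
      have := Finset.single_le_sum (f := fun β => ∑ i, (gl α (y, η) β).1 i ^ 2) (fun β _ => by positivity) (Finset.mem_univ α)
      simpa [gl_same] using this
    nlinarith

lemma disp2 {U : ℝ → L2 m n N →L[ℂ] L2 m n N} (hU : IsPropagator m n N 0 U) {a : ℝ} (ha : 0 < a) {t : ℝ} (ht : t ≠ 0) (α : Fin N) (f u : L2 m n N) (hu : n1 α u ≠ ∞) :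
    ‖pr (mG a ha f) (U t u)‖ₑ ≤ ENNReal.ofReal ((4 * Real.pi * |t|) ^ (-((m:ℝ)/2))) * n1 α (mG a ha f) * n1 α u := by
  have hf : f ∈ (Sp m n N a ha).topologicalClosure := by rw [Sp_dense]; trivial
  obtain ⟨g, hg, hgl⟩ := mem_closure_iff_seq_limit.1 (show f ∈ closure (Sp m n N a ha : Set (L2 m n N)) from hf)
  obtain ⟨B, hB, hBn⟩ := n1_mG (m := m) (n := n) α ha
  have ha2 : 0 < 2 * a := by linarith
  set K := ENNReal.ofReal ((4 * Real.pi * |t|) ^ (-((m:ℝ)/2))) with hK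
  have hs : Filter.Tendsto (fun j => ‖g j - f‖ₑ) Filter.atTop (nhds 0) := by
    have := (hgl.sub_const f).enorm
    simpa using this
  have h1 : Filter.Tendsto (fun j => mG a ha (g j)) Filter.atTop (nhds (mG a ha f)) := by
    rw [tendsto_iff_norm_sub_tendsto_zero] at hgl ⊢
    refine squeeze_zero (fun _ => norm_nonneg _) (fun j => ?_) hgl
    unfold mG
    rw [← bm_sub]
    exact bm_norm _ _ _ _
  have h2 := (tendsto_pr h1 (tendsto_const_nhds (x := U t u))).enorm
  have h3 : Filter.Tendsto (fun j => K * (n1 α (mG a ha f) + B * ‖g j - f‖ₑ) * n1 α u) Filter.atTop (nhds (K * (n1 α (mG a ha f) + B * 0) * n1 α u)) := by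
    refine ENNReal.Tendsto.mul_const (ENNReal.Tendsto.const_mul (tendsto_const_nhds.add (ENNReal.Tendsto.const_mul hs (Or.inr hB))) (Or.inr ENNReal.ofReal_ne_top)) (Or.inr hu)
  rw [mul_zero, add_zero] at h3
  refine le_of_tendsto_of_tendsto' h2 h3 fun j => ?_
  obtain ⟨s, b, hsb⟩ := Sp_form ha (hg j)
  have h4 : mG a ha (g j) = WL s Prod.fst Prod.snd ha2 b 0 := by rw [hsb, mG_WL]
  have h5 := disp1 s Prod.fst Prod.snd hU ha2 ht α b u
  rw [← h4] at h5
  refine h5.trans ?_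
  gcongr
  have h6 : n1 α (mG a ha (g j)) ≤ n1 α (mG a ha f) + n1 α (mG a ha (g j - f)) := by
    refine le_trans (le_of_eq (n1_congr α ?_)) (n1_add α (L2_meas (mG a ha f)) (L2_meas (mG a ha (g j - f))))
    have e : mG a ha (g j) = mG a ha f + mG a ha (g j - f) := by
      unfold mG; rw [bm_sub]; abel
    rw [e]
    filter_upwards [Lp.coeFn_add (mG a ha f) (mG a ha (g j - f))] with x hx
    rw [hx]; rfl
  exact h6.trans (by gcongr; exact hBn _)

lemma disp3 {U : ℝ → L2 m n N →L[ℂ] L2 m n N} (hU : IsPropagator m n N 0 U) {t : ℝ} (ht : t ≠ 0) (α : Fin N) (f u : L2 m n N) (hu : n1 α u ≠ ∞) :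
    ‖pr f (U t u)‖ₑ ≤ ENNReal.ofReal ((4 * Real.pi * |t|) ^ (-((m:ℝ)/2))) * n1 α f * n1 α u := by
  have hpos : ∀ j : ℕ, 0 < 1 / ((j:ℝ) + 1) := fun j => by positivity
  have hl : Filter.Tendsto (fun j : ℕ => pr (mG (1 / ((j:ℝ) + 1)) (hpos j) f) (U t u)) Filter.atTop (nhds (pr f (U t u))) := by
    simp_rw [pr_eq]
    refine tendsto_integral_of_dominated_convergence (fun x => ‖f x * U t u x‖) (fun j => ((L2_meas _).mul (L2_meas _)).aestronglyMeasurable) ?_ ?_ ?_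
    · exact ((Lp.memLp f).integrable_mul (Lp.memLp (U t u))).norm
    · intro j
      filter_upwards [bm_coe (gau (1 / ((j:ℝ) + 1))) (gau_cont _).measurable (gau_le_one (hpos j).le) f] with x hx
      unfold mG
      rw [hx, mul_assoc, norm_mul, Complex.norm_real, Real.norm_eq_abs]
      exact mul_le_of_le_one_left (norm_nonneg _) (gau_le_one (hpos j).le x)
    · have : ∀ᵐ x : Cfg m n N, ∀ j : ℕ, mG (1 / ((j:ℝ) + 1)) (hpos j) f x = (gau (1 / ((j:ℝ) + 1)) x : ℂ) * f x :=
        ae_all_iff.2 fun j => bm_coe (gau (1 / ((j:ℝ) + 1))) (gau_cont _).measurable (gau_le_one (hpos j).le) f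
      filter_upwards [this] with x hx
      simp_rw [hx]
      have h1 : Filter.Tendsto (fun j : ℕ => gau (1 / ((j:ℝ) + 1)) x) Filter.atTop (nhds 1) := by
        have h2 := tendsto_one_div_add_atTop_nhds_zero_nat (𝕜 := ℝ)
        have h3 := (Real.continuous_exp.tendsto _).comp ((h2.neg).mul_const (Sq x))
        simpa [gau, Function.comp_def] using h3
      have h4 := (((Complex.continuous_ofReal.tendsto 1).comp h1).mul_const (f x)).mul_const (U t u x)
      simpa [Function.comp_def] using h4
  refine le_of_tendsto' hl.enorm fun j => ?_
  refine (disp2 hU (hpos j) ht α f u hu).trans ?_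
  gcongr
  unfold mG
  rw [n1_congr α (bm_coe (gau (1 / ((j:ℝ) + 1))) (gau_cont _).measurable (gau_le_one (hpos j).le) f)]
  refine lintegral_mono fun y => nu_mono α (fun x => ?_) y
  rw [norm_mul, Complex.norm_real, Real.norm_eq_abs]
  exact mul_le_of_le_one_left (norm_nonneg _) (gau_le_one (hpos j).le x)

/-- The dispersive estimate with frozen variables. -/
lemma disp {U : ℝ → L2 m n N →L[ℂ] L2 m n N} (hU : IsPropagator m n N 0 U) {t : ℝ} (ht : t ≠ 0) (α : Fin N) (f u : L2 m n N) (hu : n1 α u ≠ ∞) :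
    ‖inner ℂ f (U t u)‖ₑ ≤ ENNReal.ofReal (|t| ^ (-((m:ℝ)/2))) * n1 α f * n1 α u := by
  rw [inner_eq_pr]
  refine (disp3 hU ht α (star f) u hu).trans ?_
  have e : n1 α (star f : L2 m n N) = n1 α f := by
    rw [n1_congr α (Lp.coeFn_star f)]
    unfold n1 nu
    refine lintegral_congr fun y => ?_
    refine eLpNorm_congr_norm_ae (Filter.Eventually.of_forall fun η => ?_)
    simp
  rw [e]
  gcongr ENNReal.ofReal ?_ * _ * _
  refine Real.rpow_le_rpow_of_nonpos (abs_pos.2 ht) ?_ (by have : (0:ℝ) ≤ m := by positivity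
                                                           linarith)
  have := Real.pi_gt_three
  nlinarith [abs_nonneg t]

end ManyBodyWaveguide

namespace ManyBodyWaveguide

variable {m n N : ℕ}

section
variable {X : Type*} [MeasurableSpace X] {μ : Measure X}

lemma meas_rearr_le (f : X → ℝ≥0∞) (t : ℝ≥0∞) : μ {x | rearr μ f t < f x} ≤ t := by
  have hne : ({lam : ℝ≥0∞ | μ {x | lam < f x} ≤ t}).Nonempty := ⟨∞, by simp⟩
  obtain ⟨u, hu, hul, hmem⟩ := exists_seq_tendsto_sInf hne (OrderBot.bddBelow _)
  have e : {x | rearr μ f t < f x} = ⋃ j, {x | u j < f x} := by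
    ext x
    simp only [Set.mem_ofPred_eq, Set.mem_iUnion]
    constructor
    · intro h
      exact ((tendsto_order.1 hul).2 _ h).exists
    · rintro ⟨j, hj⟩
      exact lt_of_le_of_lt (sInf_le (hmem j)) hj
  have hmono : Monotone fun j => {x | u j < f x} := fun i j hij x hx => lt_of_le_of_lt (hu hij) hx
  rw [e, hmono.measure_iUnion]
  exact iSup_le fun j => hmem j

lemma rearr_le_iff {f : X → ℝ≥0∞} {t lam : ℝ≥0∞} : rearr μ f t ≤ lam ↔ μ {x | lam < f x} ≤ t := by
  constructor
  · intro h
    exact (measure_mono fun x hx => lt_of_le_of_lt h hx).trans (meas_rearr_le f t)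
  · intro h
    exact sInf_le h

lemma rearr_anti (f : X → ℝ≥0∞) : Antitone (rearr μ f) := fun s t hst =>
  rearr_le_iff.2 ((meas_rearr_le f s).trans hst)

lemma rearr_cheb {f : X → ℝ≥0∞} (hf : Measurable f) (t : ℝ≥0∞) (ht : t ≠ 0) (ht' : t ≠ ∞) :
    rearr μ f t ≤ ((∫⁻ x, f x ^ 2 ∂μ) / t) ^ (1/2:ℝ) := by
  set I := ∫⁻ x, f x ^ 2 ∂μ with hI
  set l := (I / t) ^ (1/2:ℝ) with hl
  have hl2 : l ^ 2 = I / t := by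
    rw [hl, ← ENNReal.rpow_natCast, ← ENNReal.rpow_mul]; simp
  rw [rearr_le_iff]
  by_cases h0 : l = 0
  · have : I = 0 := by
      rw [h0] at hl2
      have h3 := hl2.symm
      rw [zero_pow two_ne_zero, ENNReal.div_eq_zero_iff] at h3
      exact h3.resolve_right ht'
    rw [hI, lintegral_eq_zero_iff (hf.pow_const 2)] at this
    have h4 : μ {x | l < f x} = 0 := by
      refine measure_mono_null (fun x hx => ?_) this
      intro h
      have h5 : f x = 0 := by simpa using h
      have h6 : l < f x := hx
      rw [h5] at h6
      exact not_lt_bot h6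
    rw [h4]; exact zero_le
  by_cases h1 : l = ∞
  · rw [h1]; simp
  have hc := mul_meas_ge_le_lintegral₀ (μ := μ) (hf.pow_const 2).aemeasurable (l ^ 2)
  have hs : μ {x | l < f x} ≤ μ {x | l ^ 2 ≤ f x ^ 2} := measure_mono fun x hx => by
    have h6 : l < f x := hx
    show l ^ 2 ≤ f x ^ 2
    gcongr
  have h7 : I = l ^ 2 * t := by rw [hl2, ENNReal.div_mul_cancel ht ht']
  rw [← hI, h7] at hc
  refine hs.trans ((ENNReal.mul_le_mul_iff_right (pow_ne_zero 2 h0) (ENNReal.pow_ne_top h1)).1 hc)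
end

end ManyBodyWaveguide

namespace ManyBodyWaveguide

variable {m n N : ℕ}

lemma ae_y (α : Fin N) {P : (Fin m → ℝ) → Prop} (h : ∀ᵐ y, P y) : ∀ᵐ x : Cfg m n N, P (x α).1 := by
  have h1 : Measure.QuasiMeasurePreserving (fun x : Cfg m n N => x α) volume volume :=
    Measure.quasiMeasurePreserving_eval (fun _ => (volume : Measure (Wg m n))) α
  have h2 : Measure.QuasiMeasurePreserving (fun x : Wg m n => x.1) volume volume :=
    Measure.quasiMeasurePreserving_fst
  exact (h2.comp h1).ae h

lemma nu_scale (α : Fin N) (c : (Fin m → ℝ) → ℝ) (f : Cfg m n N → ℂ) (y) :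
    nu α (fun x => (c (x α).1 : ℂ) * f x) y = ENNReal.ofReal |c y| * nu α f y := by
  have e : ENNReal.ofReal |c y| = ‖(c y : ℂ)‖ₑ := by
    rw [← ofReal_norm, Complex.norm_real, Real.norm_eq_abs]
  unfold nu
  rw [e, ← eLpNorm_const_smul]
  congr 1
  funext η
  beta_reduce
  rw [gl_same, Pi.smul_apply, smul_eq_mul]

lemma nu_ae_fin (α : Fin N) (f : L2 m n N) : ∀ᵐ y, nu α f y ≠ ∞ := by
  have h := lint_nu_L2 α f
  have h1 : ∫⁻ y, nu α f y ^ 2 ≠ ∞ := by rw [h]; exact ENNReal.pow_ne_top enorm_ne_top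
  have h2 := ae_lt_top ((nu_measurable α (L2_meas f)).pow_const 2) h1
  filter_upwards [h2] with y hy h3
  rw [h3] at hy
  simp at hy

lemma zero_of_nu (α : Fin N) (f : L2 m n N) : ∀ᵐ x : Cfg m n N, nu α f (x α).1 = 0 → f x = 0 := by
  have hm := nu_measurable α (L2_meas f)
  have hxa : Measurable fun x : Cfg m n N => (x α).1 := measurable_fst.comp (measurable_pi_apply α)
  set S : Set (Fin m → ℝ) := {y | nu α f y = 0}
  have hS : MeasurableSet S := hm (measurableSet_singleton 0)
  have hI : Measurable fun x : Cfg m n N => S.indicator (fun _ => (1:ℝ≥0∞)) (x α).1 * ‖f x‖ₑ ^ 2 :=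
    ((measurable_const.indicator hS).comp hxa).mul ((L2_meas f).enorm.pow_const 2)
  have h1 := lint_gl α hI
  have h2 : ∫⁻ x : Cfg m n N, S.indicator (fun _ => (1:ℝ≥0∞)) (x α).1 * ‖f x‖ₑ ^ 2 = 0 := by
    rw [h1]
    simp_rw [gl_same]
    have : ∀ y : Fin m → ℝ, ∫⁻ η : Rest m n N α, S.indicator (fun _ => (1:ℝ≥0∞)) y * ‖f (gl α (y, η))‖ₑ ^ 2 = 0 := by
      intro y
      have hmm : Measurable fun η : Rest m n N α => ‖f (gl α (y, η))‖ₑ ^ 2 :=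
        ((L2_meas f).comp ((gl_meas α).comp measurable_prodMk_left)).enorm.pow_const 2
      rw [lintegral_const_mul _ hmm, ← nu_sq]
      by_cases hy : y ∈ S
      · have : nu α f y = 0 := hy
        rw [this]; simp
      · rw [Set.indicator_of_notMem hy]; simp
    simp [this]
  rw [lintegral_eq_zero_iff hI] at h2
  filter_upwards [h2] with x hx h0
  have h4 : (x α).1 ∈ S := h0
  rw [Set.indicator_of_mem h4] at hx
  simpa using hx

def cl (l : ℝ≥0) (v : ℝ) : ℝ := (l:ℝ) / max (l:ℝ) v

lemma cl_nonneg (l : ℝ≥0) (v : ℝ) : 0 ≤ cl l v := div_nonneg l.2 (le_max_of_le_left l.2)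
lemma cl_le_one (l : ℝ≥0) (v : ℝ) : cl l v ≤ 1 := div_le_one_of_le₀ (le_max_left _ _) (le_max_of_le_left l.2)
lemma cl_abs (l : ℝ≥0) (v : ℝ) : |cl l v| ≤ 1 := by rw [abs_of_nonneg (cl_nonneg l v)]; exact cl_le_one l v

lemma cl_mul {l : ℝ≥0} {v : ℝ} (hv : 0 ≤ v) : cl l v * v = min (l:ℝ) v := by
  unfold cl
  rcases le_total v l with h | h
  · rw [max_eq_left h, min_eq_right h]
    rcases eq_or_ne (l:ℝ) 0 with h0 | h0
    · rw [h0] at h ⊢; simp; linarith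
    · rw [div_self h0, one_mul]
  · rw [max_eq_right h, min_eq_left h]
    rcases eq_or_ne v 0 with h0 | h0
    · subst h0
      have := l.2
      simp; exact le_antisymm h this |>.symm ▸ rfl
    · rw [div_mul_cancel₀ _ h0]

lemma cl_anti (l : ℝ≥0) {p q : ℝ} (hp : 0 ≤ p) (hpq : p ≤ q) : cl l q ≤ cl l p := by
  unfold cl
  rcases eq_or_ne (l:ℝ) 0 with h0 | h0
  · rw [h0]; simp
  have hl : 0 < (l:ℝ) := lt_of_le_of_ne l.2 (Ne.symm h0)
  exact div_le_div_of_nonneg_left hl.le (lt_max_of_lt_left hl) (max_le_max le_rfl hpq)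

lemma cl_lip (l : ℝ≥0) {p q : ℝ} (hp : 0 ≤ p) (hpq : p ≤ q) : (cl l p - cl l q) * p ≤ q - p := by
  have h1 := cl_mul (l := l) hp
  have h2 := cl_mul (l := l) (hp.trans hpq)
  have h3 := cl_le_one l q
  have h4 : min (l:ℝ) p ≤ min (l:ℝ) q := min_le_min le_rfl hpq
  nlinarith

lemma cl_measurable (l : ℝ≥0) : Measurable (cl l) := by
  unfold cl
  exact measurable_const.div (measurable_const.max measurable_id)

lemma xa_meas (α : Fin N) : Measurable fun x : Cfg m n N => (x α).1 := measurable_fst.comp (measurable_pi_apply α)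

def nr (α : Fin N) (f : L2 m n N) (y : Fin m → ℝ) : ℝ := (nu α f y).toReal

lemma nr_meas (α : Fin N) (f : L2 m n N) : Measurable (nr α f) := (nu_measurable α (L2_meas f)).ennreal_toReal

def clip (α : Fin N) (l : ℝ≥0) (f : L2 m n N) : L2 m n N :=
  bm (fun x => cl l (nr α f (x α).1)) ((cl_measurable l).comp ((nr_meas α f).comp (xa_meas α))) (fun _ => cl_abs _ _) f

lemma clip_coe (α : Fin N) (l : ℝ≥0) (f : L2 m n N) : clip α l f =ᵐ[volume] fun x => (cl l (nr α f (x α).1) : ℂ) * f x := bm_coe _ _ _ _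

lemma clip_norm (α : Fin N) (l : ℝ≥0) (f : L2 m n N) : ‖clip α l f‖ ≤ ‖f‖ := bm_norm _ _ _ _

lemma scaled_meas (α : Fin N) {c : (Fin m → ℝ) → ℝ} (hc : Measurable c) (f : L2 m n N) :
    Measurable fun x : Cfg m n N => (c (x α).1 : ℂ) * f x :=
  (Complex.measurable_ofReal.comp (hc.comp (xa_meas α))).mul (L2_meas f)

lemma nu_lip (α : Fin N) (l : ℝ≥0) (f g : L2 m n N) (y) (hf : nu α f y ≠ ∞) (hg : nu α g y ≠ ∞) (hpq : nu α f y ≤ nu α g y) :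
    nu α (fun x => (cl l (nr α f (x α).1) : ℂ) * f x - (cl l (nr α g (x α).1) : ℂ) * g x) y ≤ 2 * nu α (fun x => f x - g x) y := by
  set F : Cfg m n N → ℂ := fun x => f x - g x with hF
  have hFm : Measurable F := (L2_meas f).sub (L2_meas g)
  have e : (fun x => (cl l (nr α f (x α).1) : ℂ) * f x - (cl l (nr α g (x α).1) : ℂ) * g x) =
      fun x => (cl l (nr α g (x α).1) : ℂ) * F x + (((fun y => cl l (nr α f y) - cl l (nr α g y)) (x α).1 : ℝ) : ℂ) * f x := by
    funext x; simp only [hF]; push_cast; ring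
  have cm : ∀ f : L2 m n N, Measurable fun y => cl l (nr α f y) := fun f => (cl_measurable l).comp (nr_meas α f)
  rw [e]
  refine (nu_add α (f := fun x => (cl l (nr α g (x α).1) : ℂ) * F x) ((Complex.measurable_ofReal.comp ((cm g).comp (xa_meas α))).mul hFm)
    (scaled_meas α (c := fun y => cl l (nr α f y) - cl l (nr α g y)) ((cm f).sub (cm g)) f) y).trans ?_
  rw [nu_scale α (fun y => cl l (nr α g y)), nu_scale α (fun y => cl l (nr α f y) - cl l (nr α g y)), two_mul]
  have hp : (0:ℝ) ≤ nr α f y := ENNReal.toReal_nonneg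
  have hpq' : nr α f y ≤ nr α g y := ENNReal.toReal_mono hg hpq
  gcongr
  · refine mul_le_of_le_one_left zero_le ?_
    rw [ENNReal.ofReal_le_one]; exact cl_abs _ _
  · have h1 := cl_lip l hp hpq'
    have h2 : nu α f y = ENNReal.ofReal (nr α f y) := (ENNReal.ofReal_toReal hf).symm
    have h3 := cl_anti l hp hpq'
    rw [h2, ← ENNReal.ofReal_mul (abs_nonneg _), abs_of_nonneg (by linarith)]
    refine (ENNReal.ofReal_le_ofReal h1).trans ?_
    have h4 : nu α g y ≤ nu α F y + nu α f y := by
      have h5 := nu_add α (f := fun x => (-1:ℝ) * F x) (g := f) (measurable_const.mul hFm) (L2_meas f) y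
      have h6 := nu_scale α (fun _ => (-1:ℝ)) F y
      have e2 : (fun x => ((-1:ℝ):ℂ) * F x + f x) = (g : Cfg m n N → ℂ) := by
        funext x; simp [hF]
      rw [e2] at h5
      rw [h6] at h5
      simpa using h5
    rw [ENNReal.ofReal_sub _ hp, nr, nr, ENNReal.ofReal_toReal hf, ENNReal.ofReal_toReal hg]
    exact tsub_le_iff_right.2 h4

lemma L2_le_of_nu (α : Fin N) (f g : L2 m n N) (c : ℝ≥0∞) (h : ∀ᵐ y, nu α f y ≤ c * nu α g y) : ‖f‖ₑ ≤ c * ‖g‖ₑ := by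
  have : ‖f‖ₑ ^ 2 ≤ (c * ‖g‖ₑ) ^ 2 := by
    rw [mul_pow, ← lint_nu_L2 α, ← lint_nu_L2 α g, ← lintegral_const_mul _ ((nu_measurable α (L2_meas g)).pow_const 2)]
    refine lintegral_mono_ae ?_
    filter_upwards [h] with y hy
    rw [← mul_pow]; gcongr
  exact (ENNReal.pow_right_strictMono two_ne_zero).le_iff_le.1 this

lemma nu_sub_comm (α : Fin N) (f g : Cfg m n N → ℂ) (y) : nu α (fun x => f x - g x) y = nu α (fun x => g x - f x) y :=
  le_antisymm (nu_mono α (fun _ => (norm_sub_rev _ _).le) y) (nu_mono α (fun _ => (norm_sub_rev _ _).le) y)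

lemma clip_lip (α : Fin N) (l : ℝ≥0) (f g : L2 m n N) : ‖clip α l f - clip α l g‖ ≤ 2 * ‖f - g‖ := by
  have h : ‖clip α l f - clip α l g‖ₑ ≤ 2 * ‖f - g‖ₑ := by
    refine L2_le_of_nu α _ _ 2 ?_
    have e1 : (clip α l f - clip α l g : L2 m n N) =ᵐ[volume] fun x => (cl l (nr α f (x α).1) : ℂ) * f x - (cl l (nr α g (x α).1) : ℂ) * g x := by
      filter_upwards [clip_coe α l f, clip_coe α l g, Lp.coeFn_sub (clip α l f) (clip α l g)] with x h1 h2 h3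
      rw [h3, Pi.sub_apply, h1, h2]
    have e2 : (f - g : L2 m n N) =ᵐ[volume] fun x => f x - g x := Lp.coeFn_sub f g
    filter_upwards [nu_congr α e1, nu_congr α e2, nu_ae_fin α f, nu_ae_fin α g] with y h1 h2 h3 h4
    rw [h1, h2]
    rcases le_total (nu α f y) (nu α g y) with h | h
    · exact nu_lip α l f g y h3 h4 h
    · have := nu_lip α l g f y h4 h3 h
      rw [nu_sub_comm α g f] at this
      rw [nu_sub_comm]
      exact this
  rw [← toReal_enorm, ← toReal_enorm (f - g)]
  have := ENNReal.toReal_mono (by finiteness) h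
  simpa using this

end ManyBodyWaveguide

namespace ManyBodyWaveguide

variable {m n N : ℕ}

lemma clip_tendsto {ι : Type*} {L : Filter ι} [L.IsCountablyGenerated] (α : Fin N) (f : L2 m n N) (l : ι → ℝ≥0) (φ : (Fin m → ℝ) → ℝ)
    (hφ : Measurable φ) (h1 : ∀ y, |φ y| ≤ 1)
    (h : ∀ᵐ y, nu α f y ≠ 0 → Filter.Tendsto (fun i => cl (l i) (nr α f y)) L (nhds (φ y))) :
    Filter.Tendsto (fun i => clip α (l i) f) L (nhds (bm (fun x => φ (x α).1) (hφ.comp (xa_meas α)) (fun _ => h1 _) f)) := by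
  unfold clip bm
  refine L2_dct _ _ (fun x => ‖f x‖) _ _ (Lp.memLp f).norm ?_ ?_ ?_
  · refine Filter.Eventually.of_forall fun i => Filter.Eventually.of_forall fun x => ?_
    rw [norm_mul, Complex.norm_real, Real.norm_eq_abs]
    exact mul_le_of_le_one_left (norm_nonneg _) (cl_abs _ _)
  · refine Filter.Eventually.of_forall fun x => ?_
    rw [norm_mul, Complex.norm_real, Real.norm_eq_abs]
    exact mul_le_of_le_one_left (norm_nonneg _) (h1 _)
  · filter_upwards [ae_y α h, zero_of_nu α f] with x hx hz
    by_cases h0 : nu α f (x α).1 = 0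
    · rw [hz h0]; simp only [mul_zero]; exact tendsto_const_nhds
    · exact ((Complex.continuous_ofReal.tendsto _).comp (hx h0)).mul_const _

lemma clip_cont_l (α : Fin N) (f : L2 m n N) : Continuous fun l : ℝ≥0 => clip α l f := by
  rw [continuous_iff_continuousAt]
  intro l0
  refine clip_tendsto α f (fun l => l) (fun y => cl l0 (nr α f y)) ((cl_measurable l0).comp (nr_meas α f)) (fun _ => cl_abs _ _) ?_
  filter_upwards [nu_ae_fin α f] with y hy h0
  have hp : 0 < nr α f y := ENNReal.toReal_pos h0 hy
  unfold cl
  have hc : Continuous fun l : ℝ≥0 => (l:ℝ) / max (l:ℝ) (nr α f y) :=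
    NNReal.continuous_coe.div (NNReal.continuous_coe.max continuous_const) fun l => (lt_max_of_lt_right hp).ne'
  exact hc.tendsto l0

lemma clip_cont (α : Fin N) : Continuous fun p : ℝ≥0 × L2 m n N => clip α p.1 p.2 := by
  refine continuous_prod_of_continuous_lipschitzWith' (fun p : ℝ≥0 × L2 m n N => clip α p.1 p.2) 2 (fun l => ?_) (fun f => clip_cont_l α f)
  refine LipschitzWith.of_dist_le_mul fun f g => ?_
  rw [dist_eq_norm, dist_eq_norm]
  exact clip_lip α l f g

def rk (α : Fin N) (k : ℤ) (f : L2 m n N) : ℝ≥0∞ := rearr volume (nu α f) ((2:ℝ≥0∞) ^ (k:ℝ))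

lemma two_pow_ne_top (x : ℝ) : (2:ℝ≥0∞) ^ x ≠ ∞ := by
  simp
lemma two_pow_ne_zero (x : ℝ) : (2:ℝ≥0∞) ^ x ≠ 0 := by
  simp

lemma rk_ne_top (α : Fin N) (k : ℤ) (f : L2 m n N) : rk α k f ≠ ∞ := by
  refine ne_top_of_le_ne_top ?_ (rearr_cheb (nu_measurable α (L2_meas f)) _ (two_pow_ne_zero _) (two_pow_ne_top _))
  rw [lint_nu_L2]
  refine ENNReal.rpow_ne_top_of_nonneg (by norm_num) ?_
  exact ENNReal.div_ne_top (ENNReal.pow_ne_top enorm_ne_top) (two_pow_ne_zero _)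

lemma rk_lsc (α : Fin N) (k : ℤ) : LowerSemicontinuous (rk (m := m) (n := n) α k) := by
  rw [lowerSemicontinuous_iff_isClosed_preimage]
  intro lam
  refine IsSeqClosed.isClosed ?_
  intro u f hu hlim
  have hu' : ∀ j, rk α k (u j) ≤ lam := hu
  show rk α k f ≤ lam
  by_cases hlam : lam = ∞
  · rw [hlam]; exact le_top
  refine ENNReal.le_of_forall_pos_le_add fun ε hε _ => ?_
  unfold rk at hu' ⊢
  rw [rearr_le_iff]
  simp_rw [rearr_le_iff] at hu'
  have hb : ∀ j, volume {y | lam + ε < nu α f y} ≤ (2:ℝ≥0∞) ^ (k:ℝ) + ‖f - u j‖ₑ ^ 2 / (ε:ℝ≥0∞) ^ 2 := by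
    intro j
    have hs : ∀ᵐ y, y ∈ {y | lam + ε < nu α f y} → y ∈ {y | lam < nu α (u j) y} ∪ {y | (ε:ℝ≥0∞) ^ 2 ≤ nu α (f - u j : L2 m n N) y ^ 2} := by
      have e2 : (f - u j : L2 m n N) =ᵐ[volume] fun x => f x - u j x := Lp.coeFn_sub f (u j)
      filter_upwards [nu_congr α e2] with y hy h
      have h' : lam + ε < nu α f y := h
      by_contra hc
      have hc' : ¬ (lam < nu α (u j) y ∨ (ε:ℝ≥0∞) ^ 2 ≤ nu α (f - u j : L2 m n N) y ^ 2) := hc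
      push Not at hc'
      obtain ⟨hc1, hc2⟩ := hc'
      have hc3 : nu α (f - u j : L2 m n N) y < ε := (ENNReal.pow_right_strictMono two_ne_zero).lt_iff_lt.1 hc2
      have h5 := nu_add α (f := fun x => f x - u j x) (g := u j) ((L2_meas f).sub (L2_meas _)) (L2_meas (u j)) y
      simp only [sub_add_cancel] at h5
      rw [← hy] at h5
      have : nu α f y ≤ ε + lam := h5.trans (add_le_add hc3.le hc1)
      rw [add_comm] at this
      exact absurd h' (not_lt.2 this)
    refine (measure_mono_ae hs).trans ((measure_union_le _ _).trans (add_le_add (hu' j) ?_))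
    rw [← lint_nu_L2 α]
    exact meas_ge_le_lintegral_div ((nu_measurable α (L2_meas _)).pow_const 2).aemeasurable (by simpa using hε.ne') (by simp)
  have ht : Filter.Tendsto (fun j => (2:ℝ≥0∞) ^ (k:ℝ) + ‖f - u j‖ₑ ^ 2 / (ε:ℝ≥0∞) ^ 2) Filter.atTop (nhds ((2:ℝ≥0∞) ^ (k:ℝ) + 0)) := by
    refine tendsto_const_nhds.add ?_
    have h1 : Filter.Tendsto (fun j => ‖f - u j‖ₑ) Filter.atTop (nhds 0) := by
      have := (tendsto_const_nhds (x := f)).sub hlim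
      rw [sub_self] at this
      simpa using this.enorm
    have h2 := ENNReal.Tendsto.div_const (ENNReal.Tendsto.pow (n := 2) h1) (b := (ε:ℝ≥0∞) ^ 2) (Or.inr (by simpa using hε.ne'))
    simpa using h2
  rw [add_zero] at ht
  exact ge_of_tendsto' ht hb

def TT (α : Fin N) (k : ℤ) (f : L2 m n N) : L2 m n N :=
  clip α (rk α k f).toNNReal f - clip α (rk α (k+1) f).toNNReal f

lemma rk_meas {F : ℝ → L2 m n N} (hF : StronglyMeasurable F) (α : Fin N) (k : ℤ) : Measurable fun s => rk α k (F s) := by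
  let _i : MeasurableSpace (L2 m n N) := borel _
  have _j : BorelSpace (L2 m n N) := ⟨rfl⟩
  exact (rk_lsc α k).measurable.comp hF.measurable

lemma TT_meas {F : ℝ → L2 m n N} (hF : StronglyMeasurable F) (α : Fin N) (k : ℤ) : StronglyMeasurable fun s => TT α k (F s) := by
  have h : ∀ k, StronglyMeasurable fun s => clip α (rk α k (F s)).toNNReal (F s) := fun k =>
    (clip_cont α).comp_stronglyMeasurable (g := fun p : ℝ≥0 × L2 m n N => clip α p.1 p.2)
      ((rk_meas hF α k).ennreal_toNNReal.stronglyMeasurable.prodMk hF)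
  exact (h k).sub (h (k+1))

lemma TT_norm (α : Fin N) (k : ℤ) (f : L2 m n N) : ‖TT α k f‖ ≤ 2 * ‖f‖ := by
  unfold TT
  refine (norm_sub_le _ _).trans ?_
  have := clip_norm α (rk α k f).toNNReal f
  have := clip_norm α (rk α (k+1) f).toNNReal f
  linarith

def wk (α : Fin N) (k : ℤ) (f : L2 m n N) : ℝ≥0∞ := (2:ℝ≥0∞) ^ (((k:ℝ)+1)/2) * rk α k f

lemma rk_anti (α : Fin N) {k l : ℤ} (h : k ≤ l) (f : L2 m n N) : rk α l f ≤ rk α k f :=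
  rearr_anti _ (ENNReal.rpow_le_rpow_of_exponent_le (by norm_num) (by exact_mod_cast h))

lemma nu_TT (α : Fin N) (k : ℤ) (f : L2 m n N) : ∀ᵐ y, nu α (TT α k f) y ≤ {y | rk α (k+1) f < nu α f y}.indicator (fun _ => rk α k f) y := by
  set a := (rk α k f).toNNReal with ha
  set b := (rk α (k+1) f).toNNReal with hb
  have ha' : (a:ℝ≥0∞) = rk α k f := ENNReal.coe_toNNReal (rk_ne_top α k f)
  have hb' : (b:ℝ≥0∞) = rk α (k+1) f := ENNReal.coe_toNNReal (rk_ne_top α (k+1) f)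
  have hba : b ≤ a := ENNReal.toNNReal_mono (rk_ne_top α k f) (rk_anti α (by omega) f)
  have hba' : (b:ℝ) ≤ a := by exact_mod_cast hba
  have e : TT α k f =ᵐ[volume] fun x => (((fun y => cl a (nr α f y) - cl b (nr α f y)) (x α).1 : ℝ) : ℂ) * f x := by
    unfold TT
    filter_upwards [clip_coe α a f, clip_coe α b f, Lp.coeFn_sub (clip α a f) (clip α b f)] with x h1 h2 h3
    rw [h3, Pi.sub_apply, h1, h2]; push_cast; ring
  filter_upwards [nu_congr α e, nu_ae_fin α f] with y h1 h2
  rw [h1, nu_scale α (fun y => cl a (nr α f y) - cl b (nr α f y))]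
  beta_reduce
  set v := nr α f y with hv
  have hv0 : 0 ≤ v := ENNReal.toReal_nonneg
  have hve : nu α f y = ENNReal.ofReal v := (ENNReal.ofReal_toReal h2).symm
  have e1 : ENNReal.ofReal |cl a v - cl b v| * nu α f y = ENNReal.ofReal |min (a:ℝ) v - min (b:ℝ) v| := by
    rw [hve, ← ENNReal.ofReal_mul (abs_nonneg _), ← cl_mul hv0, ← cl_mul hv0, ← sub_mul, abs_mul, abs_of_nonneg hv0]
  rw [e1]
  by_cases hy : rk α (k+1) f < nu α f y
  · rw [Set.indicator_of_mem (show y ∈ {y | rk α (k+1) f < nu α f y} from hy), ← ha', ← ENNReal.ofReal_coe_nnreal]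
    refine ENNReal.ofReal_le_ofReal ?_
    rw [abs_le]
    have h5 : min (b:ℝ) v ≤ min (a:ℝ) v := min_le_min hba' le_rfl
    have h6 : 0 ≤ min (b:ℝ) v := le_min b.2 hv0
    have h7 := min_le_left (a:ℝ) v
    constructor <;> linarith [a.2]
  · rw [Set.indicator_of_notMem (show y ∉ {y | rk α (k+1) f < nu α f y} from hy)]
    have h5 : v ≤ b := by
      rw [← hb', not_lt, hve, ← ENNReal.ofReal_coe_nnreal] at hy
      exact (ENNReal.ofReal_le_ofReal_iff b.2).1 hy
    rw [min_eq_right h5, min_eq_right (h5.trans hba')]; simp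

lemma ind_lint (α : Fin N) (k : ℤ) (f : L2 m n N) (c : ℝ≥0∞) : ∫⁻ y, {y | rk α (k+1) f < nu α f y}.indicator (fun _ => c) y ≤ c * (2:ℝ≥0∞) ^ ((k:ℝ)+1) := by
  rw [lintegral_indicator (measurableSet_lt measurable_const (nu_measurable α (L2_meas f))), setLIntegral_const]
  gcongr
  have := meas_rearr_le (μ := volume) (nu α f) ((2:ℝ≥0∞) ^ (((k+1 : ℤ)):ℝ))
  push_cast at this
  unfold rk
  push_cast
  exact this

lemma two_half (x : ℝ) : (2:ℝ≥0∞) ^ x = (2:ℝ≥0∞) ^ (x/2) * (2:ℝ≥0∞) ^ (x/2) := by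
  rw [← ENNReal.rpow_add _ _ (by norm_num) (by norm_num)]; congr 1; ring

lemma TT_n1 (α : Fin N) (k : ℤ) (f : L2 m n N) : n1 α (TT α k f) ≤ (2:ℝ≥0∞) ^ (((k:ℝ)+1)/2) * wk α k f := by
  refine (lintegral_mono_ae (nu_TT α k f)).trans ((ind_lint α k f _).trans (le_of_eq ?_))
  rw [wk, ← mul_assoc, ← two_half, mul_comm]

lemma TT_L2 (α : Fin N) (k : ℤ) (f : L2 m n N) : ‖TT α k f‖ₑ ≤ wk α k f := by
  refine (ENNReal.pow_right_strictMono two_ne_zero).le_iff_le.1 ?_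
  rw [← lint_nu_L2 α]
  have : ∀ᵐ y, nu α (TT α k f) y ^ 2 ≤ {y | rk α (k+1) f < nu α f y}.indicator (fun _ => rk α k f ^ 2) y := by
    filter_upwards [nu_TT α k f] with y hy
    refine (pow_le_pow_left' hy 2).trans (le_of_eq ?_)
    by_cases h : y ∈ {y | rk α (k+1) f < nu α f y}
    · rw [Set.indicator_of_mem h, Set.indicator_of_mem h]
    · rw [Set.indicator_of_notMem h, Set.indicator_of_notMem h]; simp
  refine (lintegral_mono_ae this).trans ((ind_lint α k f _).trans (le_of_eq ?_))
  rw [wk, mul_pow, sq ((2:ℝ≥0∞) ^ _), ← two_half, mul_comm]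

end ManyBodyWaveguide

namespace ManyBodyWaveguide

variable {m n N : ℕ}

lemma cl_lim {L : Filter ℕ} {a : ℕ → ℝ≥0∞} {c v : ℝ≥0∞} (ha : ∀ j, a j ≠ ∞) (hv : v ≠ 0) (hv' : v ≠ ∞)
    (h : Filter.Tendsto a L (nhds c)) :
    Filter.Tendsto (fun j => cl (a j).toNNReal v.toReal) L (nhds ((min c v).toReal / v.toReal)) := by
  have hp : 0 < v.toReal := ENNReal.toReal_pos hv hv'
  have e : ∀ j, cl (a j).toNNReal v.toReal = (min (a j) v).toReal / v.toReal := by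
    intro j
    rw [eq_div_iff hp.ne', cl_mul hp.le, ENNReal.toReal_min (ha j) hv']
    rfl
  simp_rw [e]
  have h1 : Filter.Tendsto (fun j => min (a j) v) L (nhds (min c v)) := h.min tendsto_const_nhds
  have h2 := (ENNReal.tendsto_toReal (ne_top_of_le_ne_top hv' (min_le_right c v))).comp h1
  exact h2.div_const _

lemma bm_one (f : L2 m n N) (φ : Cfg m n N → ℝ) (hφ : Measurable φ) (h1 : ∀ x, |φ x| ≤ 1) (h : ∀ x, φ x = 1) : bm φ hφ h1 f = f := by
  apply Lp.ext
  filter_upwards [bm_coe φ hφ h1 f] with x hx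
  rw [hx, h]; simp

lemma bm_zero (f : L2 m n N) (φ : Cfg m n N → ℝ) (hφ : Measurable φ) (h1 : ∀ x, |φ x| ≤ 1) (h : ∀ x, φ x = 0) : bm φ hφ h1 f = 0 := by
  apply Lp.ext
  filter_upwards [bm_coe φ hφ h1 f, Lp.coeFn_zero ℂ 2 (volume : Measure (Cfg m n N))] with x hx h2
  rw [hx, h, h2]; simp

lemma two_pow_neg_tendsto : Filter.Tendsto (fun j : ℕ => (2:ℝ≥0∞) ^ (((-(j:ℤ) : ℤ)):ℝ)) Filter.atTop (nhds 0) := by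
  have : ∀ j : ℕ, (2:ℝ≥0∞) ^ (((-(j:ℤ) : ℤ)):ℝ) = ((2:ℝ≥0∞)⁻¹) ^ j := by
    intro j
    push_cast
    rw [ENNReal.rpow_neg, ENNReal.rpow_natCast, ENNReal.inv_pow]
  simp_rw [this]
  exact ENNReal.tendsto_pow_atTop_nhds_zero_of_lt_one (by simp [ENNReal.inv_lt_one])

lemma clip_neg (α : Fin N) (f : L2 m n N) : Filter.Tendsto (fun j : ℕ => clip α (rk α (-(j:ℤ)) f).toNNReal f) Filter.atTop (nhds f) := by
  have h := clip_tendsto (L := Filter.atTop) α f (fun j : ℕ => (rk α (-(j:ℤ)) f).toNNReal) (fun _ => 1) measurable_const (fun _ => by simp) ?_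
  · rw [bm_one] at h
    · exact h
    · intro x; rfl
  set S := ⨆ j : ℕ, rk α (-(j:ℤ)) f with hS
  have hmono : Monotone fun j : ℕ => rk α (-(j:ℤ)) f := fun i j hij => rk_anti α (by omega) f
  have hlim : Filter.Tendsto (fun j : ℕ => rk α (-(j:ℤ)) f) Filter.atTop (nhds S) := tendsto_atTop_iSup hmono
  have h0 : volume {y | S < nu α f y} = 0 := by
    refine le_antisymm (ge_of_tendsto' two_pow_neg_tendsto fun j => ?_) zero_le
    refine (measure_mono ?_).trans (meas_rearr_le (nu α f) _)
    intro y hy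
    exact lt_of_le_of_lt (le_iSup (fun j : ℕ => rk α (-(j:ℤ)) f) j) hy
  have h1 : ∀ᵐ y, nu α f y ≤ S := by
    have : ∀ᵐ y, ¬ (S < nu α f y) := measure_eq_zero_iff_ae_notMem.1 h0
    filter_upwards [this] with y hy using not_lt.1 hy
  filter_upwards [h1, nu_ae_fin α f] with y h1 h2 h3
  have h4 := cl_lim (fun j => rk_ne_top α _ f) h3 h2 hlim
  rw [min_eq_right h1, div_self (ENNReal.toReal_pos h3 h2).ne'] at h4
  exact h4

lemma clip_pos (α : Fin N) (f : L2 m n N) : Filter.Tendsto (fun j : ℕ => clip α (rk α (j:ℤ) f).toNNReal f) Filter.atTop (nhds 0) := by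
  have h := clip_tendsto (L := Filter.atTop) α f (fun j : ℕ => (rk α (j:ℤ) f).toNNReal) (fun _ => 0) measurable_const (fun _ => by simp) ?_
  · rw [bm_zero] at h
    · exact h
    · intro x; rfl
  have hlim : Filter.Tendsto (fun j : ℕ => rk α (j:ℤ) f) Filter.atTop (nhds 0) := by
    have h1 : ∀ j : ℕ, rk α (j:ℤ) f ≤ (‖f‖ₑ ^ 2 * (2:ℝ≥0∞) ^ (((-(j:ℤ) : ℤ)):ℝ)) ^ (1/2:ℝ) := by
      intro j
      have := rearr_cheb (μ := volume) (nu_measurable α (L2_meas f)) ((2:ℝ≥0∞) ^ ((j:ℤ):ℝ)) (two_pow_ne_zero _) (two_pow_ne_top _)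
      rw [lint_nu_L2, div_eq_mul_inv, ← ENNReal.rpow_neg] at this
      push_cast at this ⊢
      unfold rk
      push_cast
      exact this
    have h2 := ENNReal.Tendsto.const_mul (a := ‖f‖ₑ ^ 2) two_pow_neg_tendsto (Or.inr (ENNReal.pow_ne_top enorm_ne_top))
    have h3 := ((ENNReal.continuous_rpow_const (y := (1/2:ℝ))).tendsto _).comp h2
    have h4 : (‖f‖ₑ ^ 2 * 0) ^ (1/2:ℝ) = 0 := by simp
    rw [h4] at h3
    exact tendsto_of_tendsto_of_tendsto_of_le_of_le tendsto_const_nhds h3 (fun _ => zero_le) h1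
  filter_upwards [nu_ae_fin α f] with y h2 h3
  have h4 := cl_lim (fun j => rk_ne_top α _ f) h3 h2 hlim
  rw [min_eq_left zero_le, ENNReal.toReal_zero, zero_div] at h4
  exact h4

def KK (j : ℕ) : Finset ℤ := (Finset.range (2*j)).map ⟨fun i : ℕ => (i:ℤ) - j, fun a b h => by simpa using h⟩

lemma TT_sum (α : Fin N) (f : L2 m n N) (j : ℕ) : ∑ k ∈ KK j, TT α k f = clip α (rk α (-(j:ℤ)) f).toNNReal f - clip α (rk α (j:ℤ) f).toNNReal f := by
  unfold KK
  rw [Finset.sum_map]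
  have := Finset.sum_range_sub' (fun i : ℕ => clip α (rk α ((i:ℤ) - j) f).toNNReal f) (2*j)
  have e1 : (((2*j : ℕ) : ℤ) - j) = j := by push_cast; ring
  have e2 : (((0 : ℕ) : ℤ) - j) = -j := by push_cast; ring
  rw [e1, e2] at this
  rw [← this]
  refine Finset.sum_congr rfl fun i _ => ?_
  unfold TT
  have e3 : ((i:ℤ) - j + 1) = ((i+1 : ℕ) : ℤ) - j := by push_cast; ring
  show clip α (rk α ((i:ℤ) - j) f).toNNReal f - clip α (rk α ((i:ℤ) - j + 1) f).toNNReal f = _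
  rw [e3]

lemma TT_sum_tendsto (α : Fin N) (f : L2 m n N) : Filter.Tendsto (fun j => ∑ k ∈ KK j, TT α k f) Filter.atTop (nhds f) := by
  simp_rw [TT_sum]
  simpa using (clip_neg α f).sub (clip_pos α f)

lemma TT_sum_norm (α : Fin N) (f : L2 m n N) (j : ℕ) : ‖∑ k ∈ KK j, TT α k f‖ ≤ 2 * ‖f‖ := by
  rw [TT_sum]
  refine (norm_sub_le _ _).trans ?_
  linarith [clip_norm α (rk α (-(j:ℤ)) f).toNNReal f, clip_norm α (rk α (j:ℤ) f).toNNReal f]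

def lz (α : Fin N) (e : ℝ) (f : L2 m n N) : ℝ≥0∞ :=
  ∫⁻ t in Set.Ioi (0:ℝ), (ENNReal.ofReal t ^ e * rearr volume (nu α f) (ENNReal.ofReal t)) ^ (2:ℝ) / ENNReal.ofReal t

lemma lorentz_eq (α : Fin N) (r : ℝ≥0∞) (f : L2 m n N) : lorentz r 2 volume (nu α f) = (lz α (1 / r.toReal) f) ^ (1/2:ℝ) := by
  rw [lorentz, if_neg (by simp)]
  simp [lz]

lemma rearr_fin (α : Fin N) (f : L2 m n N) {t : ℝ≥0∞} (ht : t ≠ 0) (ht' : t ≠ ∞) : rearr volume (nu α f) t ≠ ∞ := by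
  refine ne_top_of_le_ne_top ?_ (rearr_cheb (nu_measurable α (L2_meas f)) t ht ht')
  rw [lint_nu_L2]
  refine ENNReal.rpow_ne_top_of_nonneg (by norm_num) ?_
  exact ENNReal.div_ne_top (ENNReal.pow_ne_top enorm_ne_top) ht

lemma norm_lz (α : Fin N) (f : L2 m n N) : ‖f‖ₑ ^ 2 ≤ lz α (1/2) f := by
  set ρ : ℝ → ℝ≥0∞ := fun t => rearr volume (nu α f) (ENNReal.ofReal t) with hρ
  have hρa : Antitone ρ := fun s t hst => rearr_anti _ (ENNReal.ofReal_le_ofReal hst)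
  have hρm : Measurable ρ := hρa.measurable
  have hfin := nu_ae_fin α f
  have hfin2 : ∀ᵐ t ∂(volume.restrict (Set.Ioi (0:ℝ))), ρ t ≠ ∞ := by
    refine (ae_restrict_mem measurableSet_Ioi).mono fun t ht => rearr_fin α f (by simpa using ht) (by simp)
  have e1 : ‖f‖ₑ ^ 2 = ∫⁻ y, ENNReal.ofReal ((nu α f y).toReal ^ (2:ℝ)) := by
    rw [← lint_nu_L2 α]
    refine lintegral_congr_ae ?_
    filter_upwards [hfin] with y hy
    rw [← ENNReal.ofReal_rpow_of_nonneg ENNReal.toReal_nonneg (by norm_num), ENNReal.ofReal_toReal hy]; simp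
  have e2 : lz α (1/2) f = ∫⁻ t in Set.Ioi (0:ℝ), ENNReal.ofReal ((ρ t).toReal ^ (2:ℝ)) := by
    refine lintegral_congr_ae ?_
    filter_upwards [hfin2, ae_restrict_mem measurableSet_Ioi] with t ht h0
    have h0' : (0:ℝ) < t := h0
    rw [← ENNReal.ofReal_rpow_of_nonneg ENNReal.toReal_nonneg (by norm_num), ENNReal.ofReal_toReal ht, ENNReal.mul_rpow_of_nonneg _ _ (by norm_num), ← ENNReal.rpow_mul]
    have h1 : ENNReal.ofReal t ^ ((1:ℝ)/2*2) = ENNReal.ofReal t := by norm_num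
    rw [h1, mul_comm, mul_div_assoc, ENNReal.div_self (by simpa using h0') (by simp), mul_one]
  rw [e1, e2, lintegral_rpow_eq_lintegral_meas_lt_mul _ (Filter.Eventually.of_forall fun _ => ENNReal.toReal_nonneg) (nu_measurable α (L2_meas f)).ennreal_toReal.aemeasurable (by norm_num),
    lintegral_rpow_eq_lintegral_meas_lt_mul _ (Filter.Eventually.of_forall fun _ => ENNReal.toReal_nonneg) hρm.ennreal_toReal.aemeasurable (by norm_num)]
  refine mul_le_mul' le_rfl ?_
  refine setLIntegral_mono' measurableSet_Ioi fun s hs => ?_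
  have hs' : (0:ℝ) < s := hs
  gcongr
  have e3 : volume {a | s < (nu α f a).toReal} = volume {a | ENNReal.ofReal s < nu α f a} := by
    refine measure_congr ?_
    filter_upwards [hfin] with y hy
    exact propext (ENNReal.ofReal_lt_iff_lt_toReal hs'.le hy).symm
  rw [e3]
  refine le_of_forall_lt_imp_le_of_dense fun c hc => ?_
  have hct : c ≠ ∞ := ne_top_of_lt hc
  have e4 : c = volume.restrict (Set.Ioi (0:ℝ)) (Set.Ioc 0 c.toReal) := by
    rw [Measure.restrict_apply measurableSet_Ioc, Set.inter_eq_left.2 (fun t ht => ht.1), Real.volume_Ioc, sub_zero, ENNReal.ofReal_toReal hct]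
  rw [e4]
  refine measure_mono fun t ht => ?_
  have ht0 : 0 < t := ht.1
  have htc : ENNReal.ofReal t ≤ c := ENNReal.ofReal_le_of_le_toReal ht.2
  show s < (ρ t).toReal
  rw [← ENNReal.ofReal_lt_iff_lt_toReal hs'.le (rearr_fin α f (by simpa using ht0) (by simp))]
  by_contra hcon
  rw [not_lt] at hcon
  have := rearr_le_iff.1 hcon
  exact absurd (this.trans htc) (not_le.2 hc)

lemma sum_lz (α : Fin N) (f : L2 m n N) {e : ℝ} (he : 0 ≤ e) (he1 : e ≤ 1) (K : Finset ℤ) :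
    ∑ k ∈ K, ((2:ℝ≥0∞) ^ ((k:ℝ) * (e - 1/2)) * wk α k f) ^ 2 ≤ 16 * lz α e f := by
  set I : ℤ → Set ℝ := fun k => Set.Ioc ((2:ℝ) ^ ((k:ℝ) - 1)) ((2:ℝ) ^ (k:ℝ)) with hI
  have hd : Set.PairwiseDisjoint (K : Set ℤ) I := by
    have key : ∀ k l : ℤ, k < l → Disjoint (I k) (I l) := by
      intro k l hkl
      rw [Set.disjoint_left]
      intro x hx hx'
      have h1 : x ≤ (2:ℝ) ^ (k:ℝ) := hx.2
      have h2 : (2:ℝ) ^ ((l:ℝ) - 1) < x := hx'.1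
      have h3 : (2:ℝ) ^ (k:ℝ) ≤ (2:ℝ) ^ ((l:ℝ) - 1) := by
        refine Real.rpow_le_rpow_of_exponent_le (by norm_num) ?_
        have : k + 1 ≤ l := hkl
        have : ((k:ℝ) + 1) ≤ l := by exact_mod_cast this
        linarith
      linarith
    intro k _ l _ hkl
    rcases lt_or_gt_of_ne hkl with h | h
    · exact key k l h
    · exact (key l k h).symm
  have hsub : (⋃ k ∈ K, I k) ⊆ Set.Ioi (0:ℝ) := by
    intro x hx
    simp only [Set.mem_iUnion] at hx
    obtain ⟨k, _, hk⟩ := hx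
    exact lt_trans (Real.rpow_pos_of_pos (by norm_num) _) hk.1
  have h1 : ∑ k ∈ K, ∫⁻ t in I k, (ENNReal.ofReal t ^ e * rearr volume (nu α f) (ENNReal.ofReal t)) ^ (2:ℝ) / ENNReal.ofReal t ≤ lz α e f := by
    rw [← lintegral_biUnion_finset hd (fun _ _ => measurableSet_Ioc)]
    exact lintegral_mono_set hsub
  refine le_trans ?_ (mul_le_mul' le_rfl h1)
  rw [Finset.mul_sum]
  refine Finset.sum_le_sum fun k _ => ?_
  have o2 : ∀ x : ℝ, ENNReal.ofReal ((2:ℝ) ^ x) = (2:ℝ≥0∞) ^ x := by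
    intro x
    rw [← ENNReal.ofReal_rpow_of_pos (by norm_num)]; simp
  have h2 : ∫⁻ t in I k, ((2:ℝ≥0∞) ^ (((k:ℝ)-1) * e) * rk α k f) ^ (2:ℝ) / (2:ℝ≥0∞) ^ (k:ℝ) ≤ ∫⁻ t in I k, (ENNReal.ofReal t ^ e * rearr volume (nu α f) (ENNReal.ofReal t)) ^ (2:ℝ) / ENNReal.ofReal t := by
    refine setLIntegral_mono' measurableSet_Ioc fun t ht => ?_
    have ht1 : (2:ℝ≥0∞) ^ ((k:ℝ)-1) ≤ ENNReal.ofReal t := by rw [← o2]; exact ENNReal.ofReal_le_ofReal ht.1.le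
    have ht2 : ENNReal.ofReal t ≤ (2:ℝ≥0∞) ^ (k:ℝ) := by rw [← o2]; exact ENNReal.ofReal_le_ofReal ht.2
    rw [ENNReal.rpow_mul]
    gcongr
    exact rearr_anti _ ht2
  refine le_trans ?_ (mul_le_mul' le_rfl h2)
  rw [setLIntegral_const, hI, Real.volume_Ioc]
  have e5 : (2:ℝ) ^ (k:ℝ) - (2:ℝ) ^ ((k:ℝ) - 1) = (2:ℝ) ^ ((k:ℝ) - 1) := by
    rw [Real.rpow_sub_one (by norm_num)]; ring
  rw [e5, o2, wk, ← mul_assoc, mul_pow, ENNReal.mul_rpow_of_nonneg _ _ (by norm_num), ENNReal.div_eq_inv_mul, ← ENNReal.rpow_neg, ← ENNReal.rpow_mul,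
    ← ENNReal.rpow_add _ _ (by norm_num) (by norm_num), ← ENNReal.rpow_natCast, ← ENNReal.rpow_mul]
  have e6 : (16:ℝ≥0∞) = (2:ℝ≥0∞) ^ (4:ℝ) := by
    rw [show (4:ℝ) = ((4:ℕ):ℝ) by norm_num, ENNReal.rpow_natCast]; norm_num
  have e7 : rk α k f ^ (2:ℝ) = rk α k f ^ 2 := by simp
  rw [e6, e7]
  have e8 : (2:ℝ≥0∞) ^ (4:ℝ) * ((2:ℝ≥0∞) ^ (-(k:ℝ)) * ((2:ℝ≥0∞) ^ (((k:ℝ)-1) * e * 2) * rk α k f ^ 2) * (2:ℝ≥0∞) ^ ((k:ℝ)-1)) =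
      (2:ℝ≥0∞) ^ (4 + ((k:ℝ)-1) * e * 2 + (-(k:ℝ)) + ((k:ℝ)-1)) * rk α k f ^ 2 := by
    rw [ENNReal.rpow_add _ _ (by norm_num) (by norm_num), ENNReal.rpow_add _ _ (by norm_num) (by norm_num), ENNReal.rpow_add _ _ (by norm_num) (by norm_num)]
    ring
  rw [e8]
  gcongr
  · norm_num
  · push_cast
    nlinarith

end ManyBodyWaveguide

namespace ManyBodyWaveguide

variable {m n N : ℕ}

lemma U_joint {U : ℝ → L2 m n N →L[ℂ] L2 m n N} (hU : IsPropagator m n N 0 U) : Continuous fun p : ℝ × L2 m n N => U (-p.1) p.2 := by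
  refine continuous_prod_of_continuous_lipschitzWith' (fun p : ℝ × L2 m n N => U (-p.1) p.2) 1 (fun s => ?_) (fun f => (scont hU f).comp continuous_neg)
  refine LipschitzWith.of_dist_le_mul fun f g => ?_
  rw [dist_eq_norm, dist_eq_norm, ← map_sub, hU.unitary]
  simp

lemma U_sm {U : ℝ → L2 m n N →L[ℂ] L2 m n N} (hU : IsPropagator m n N 0 U) {G : ℝ → L2 m n N} (hG : StronglyMeasurable G) :
    StronglyMeasurable fun s => U (-s) (G s) :=
  (U_joint hU).comp_stronglyMeasurable (g := fun p : ℝ × L2 m n N => U (-p.1) p.2) (stronglyMeasurable_id.prodMk hG)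

lemma U_inner {U : ℝ → L2 m n N →L[ℂ] L2 m n N} (hU : IsPropagator m n N 0 U) (s t : ℝ) (a b : L2 m n N) :
    inner ℂ (U (-s) a) (U (-t) b) = inner ℂ a (U (s - t) b) := by
  have h1 : U (-t) b = U (-s) (U (s - t) b) := by
    have := hU.group (-s) (s - t)
    rw [show -s + (s - t) = -t by ring] at this
    rw [this]; rfl
  rw [h1]
  let I : L2 m n N →ₗᵢ[ℂ] L2 m n N := ⟨(U (-s)).toLinearMap, fun f => hU.unitary (-s) f⟩
  exact I.inner_map_map a _

lemma core_bd {U : ℝ → L2 m n N →L[ℂ] L2 m n N} (hU : IsPropagator m n N 0 U) (hm : 3 ≤ m) (α : Fin N) (k l : ℤ) (s t : ℝ) (f g : L2 m n N) :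
    ‖inner ℂ (U (-s) (TT α k f)) (U (-t) (TT α l g))‖ₑ ≤ 2 * kap (m:ℝ) (t - s) (k + l) * (wk α k f * wk α l g) := by
  rw [U_inner hU]
  have b1 : ‖inner ℂ (TT α k f) (U (s - t) (TT α l g))‖ₑ ≤ wk α k f * wk α l g := by
    have h1 : ‖inner ℂ (TT α k f) (U (s - t) (TT α l g))‖ₑ ≤ ‖TT α k f‖ₑ * ‖TT α l g‖ₑ := by
      rw [← ofReal_norm, ← ofReal_norm, ← ofReal_norm, ← ENNReal.ofReal_mul (norm_nonneg _)]
      refine ENNReal.ofReal_le_ofReal ((norm_inner_le_norm _ _).trans ?_)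
      rw [hU.unitary]
    exact h1.trans (mul_le_mul' (TT_L2 α k f) (TT_L2 α l g))
  have b1' : ‖inner ℂ (TT α k f) (U (s - t) (TT α l g))‖ₑ ≤ 2 * 1 * (wk α k f * wk α l g) := by
    refine b1.trans ?_
    rw [mul_one]
    exact le_mul_of_one_le_left zero_le (by norm_num)
  have hmneg : -((m:ℝ)/2) < 0 := by
    have : (3:ℝ) ≤ m := by exact_mod_cast hm
    linarith
  unfold kap
  rcases eq_or_ne s t with h | h
  · subst h
    have h2 : (2:ℝ≥0∞) ^ (((k:ℝ) + l) / 2) ≠ 0 := two_pow_ne_zero _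
    rw [sub_self, abs_zero, ENNReal.ofReal_zero, ENNReal.zero_rpow_of_neg hmneg, ENNReal.top_mul h2, min_eq_left le_top]
    rw [sub_self] at b1'
    exact b1'
  · rcases min_cases (1:ℝ≥0∞) (ENNReal.ofReal |t - s| ^ (-((m:ℝ) / 2)) * 2 ^ (((k:ℝ) + l) / 2)) with ⟨h1, _⟩ | ⟨h1, _⟩
    · rw [h1]; exact b1'
    · rw [h1]
      have hfin : wk α l g ≠ ∞ := ENNReal.mul_ne_top (two_pow_ne_top _) (rk_ne_top α l g)
      have hn1 : n1 α (TT α l g) ≠ ∞ := ne_top_of_le_ne_top (ENNReal.mul_ne_top (two_pow_ne_top _) hfin) (TT_n1 α l g)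
      have hd := disp hU (sub_ne_zero.2 h) α (TT α k f) (TT α l g) hn1
      refine hd.trans ?_
      have h3 : ENNReal.ofReal (|s - t| ^ (-((m:ℝ)/2))) = ENNReal.ofReal |t - s| ^ (-((m:ℝ) / 2)) := by
        rw [abs_sub_comm, ENNReal.ofReal_rpow_of_pos (abs_pos.2 (sub_ne_zero.2 h.symm))]
      rw [h3]
      refine (mul_le_mul' (mul_le_mul' le_rfl (TT_n1 α k f)) (TT_n1 α l g)).trans (le_of_eq ?_)
      have h4 : (2:ℝ≥0∞) ^ (((k:ℝ)+1)/2) * (2:ℝ≥0∞) ^ (((l:ℝ)+1)/2) = 2 * (2:ℝ≥0∞) ^ (((k:ℝ) + l) / 2) := by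
        nth_rewrite 3 [← ENNReal.rpow_one 2]
        rw [← ENNReal.rpow_add _ _ (by norm_num) (by norm_num), ← ENNReal.rpow_add _ _ (by norm_num) (by norm_num)]
        congr 1; ring
      calc ENNReal.ofReal |t - s| ^ (-((m:ℝ) / 2)) * ((2:ℝ≥0∞) ^ (((k:ℝ)+1)/2) * wk α k f) * ((2:ℝ≥0∞) ^ (((l:ℝ)+1)/2) * wk α l g)
          = ENNReal.ofReal |t - s| ^ (-((m:ℝ) / 2)) * ((2:ℝ≥0∞) ^ (((k:ℝ)+1)/2) * (2:ℝ≥0∞) ^ (((l:ℝ)+1)/2)) * (wk α k f * wk α l g) := by ring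
        _ = _ := by rw [h4]; ring

section
variable {U : ℝ → L2 m n N →L[ℂ] L2 m n N} (hU : IsPropagator m n N 0 U) {F : ℝ → L2 m n N} (hF : StronglyMeasurable F) (hFi : Integrable F)

lemma H_int {U : ℝ → L2 m n N →L[ℂ] L2 m n N} (hU : IsPropagator m n N 0 U) {F : ℝ → L2 m n N} (hF : StronglyMeasurable F) (hFi : Integrable F) (α : Fin N) (k : ℤ) : Integrable fun s => U (-s) (TT α k (F s)) := by
  refine Integrable.mono' (hFi.norm.const_mul 2) (U_sm hU (TT_meas hF α k)).aestronglyMeasurable (Filter.Eventually.of_forall fun s => ?_)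
  rw [hU.unitary]
  exact TT_norm α k (F s)

lemma core_lim {U : ℝ → L2 m n N →L[ℂ] L2 m n N} (hU : IsPropagator m n N 0 U) {F : ℝ → L2 m n N} (hF : StronglyMeasurable F) (hFi : Integrable F) (α : Fin N) (B : ℝ≥0∞)
    (h : ∀ j, ‖∑ k ∈ KK j, ∫ s, U (-s) (TT α k (F s))‖ₑ ^ 2 ≤ B) : ‖∫ s, U (-s) (F s)‖ₑ ^ 2 ≤ B := by
  have e : ∀ j, ∑ k ∈ KK j, ∫ s, U (-s) (TT α k (F s)) = ∫ s, U (-s) (∑ k ∈ KK j, TT α k (F s)) := by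
    intro j
    rw [← integral_finsetSum _ (fun k _ => H_int hU hF hFi α k)]
    simp_rw [map_sum]
  simp_rw [e] at h
  have hl : Filter.Tendsto (fun j => ∫ s, U (-s) (∑ k ∈ KK j, TT α k (F s))) Filter.atTop (nhds (∫ s, U (-s) (F s))) := by
    refine tendsto_integral_of_dominated_convergence (fun s => 2 * ‖F s‖) ?_ (hFi.norm.const_mul 2) ?_ ?_
    · intro j
      refine (U_sm hU ?_).aestronglyMeasurable
      exact Finset.stronglyMeasurable_fun_sum _ fun k _ => TT_meas hF α k
    · intro j
      refine Filter.Eventually.of_forall fun s => ?_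
      rw [hU.unitary]
      exact TT_sum_norm α (F s) j
    · refine Filter.Eventually.of_forall fun s => ?_
      exact ((U (-s)).continuous.tendsto _).comp (TT_sum_tendsto α (F s))
  exact le_of_tendsto' (ENNReal.Tendsto.pow (n := 2) hl.enorm) h

end

lemma wk_meas {F : ℝ → L2 m n N} (hF : StronglyMeasurable F) (α : Fin N) (k : ℤ) : Measurable fun s => wk α k (F s) :=
  (rk_meas hF α k).const_mul _

lemma core_nonend (hm : 3 ≤ m) (α : Fin N) (e : ℝ) (he : 1/2 < e) (he1 : (m:ℝ) * (e - 1/2) < 1) (q : ℝ) (hq : q = 2 / (2 - m * (e - 1/2))) :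
    ∃ C : ℝ≥0∞, C ≠ ∞ ∧ ∀ (U : ℝ → L2 m n N →L[ℂ] L2 m n N), IsPropagator m n N 0 U → ∀ F : ℝ → L2 m n N, StronglyMeasurable F → Integrable F →
      ‖∫ s, U (-s) (F s)‖ₑ ^ 2 ≤ C * (∫⁻ t, (lz α e (F t)) ^ (q / 2)) ^ (2 / q) := by
  have hm' : (3:ℝ) ≤ m := by exact_mod_cast hm
  have hq0 : 0 < q := by rw [hq]; exact div_pos (by norm_num) (by linarith)
  have hee : e ≤ 1 := by nlinarith
  obtain ⟨C, hC, h⟩ := strich_nonend (E := L2 m n N) (m:ℝ) hm' (e - 1/2) (by linarith) he1 2 (by simp)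
  refine ⟨C * ((16:ℝ≥0∞) ^ (q/2)) ^ (2/q), ENNReal.mul_ne_top hC (ENNReal.rpow_ne_top_of_nonneg (by positivity) (ENNReal.rpow_ne_top_of_nonneg (by positivity) (by simp))), fun U hU F hF hFi => ?_⟩
  refine core_lim hU hF hFi α _ fun j => ?_
  refine (h (KK j) (fun k s => U (-s) (TT α k (F s))) (fun k s => wk α k (F s)) (fun k => H_int hU hF hFi α k) (fun k => wk_meas hF α k)
    (fun k l s t => core_bd hU hm α k l s t _ _)).trans ?_
  rw [← hq, mul_assoc, ← ENNReal.mul_rpow_of_nonneg _ _ (by positivity), ← lintegral_const_mul' _ _ (ENNReal.rpow_ne_top_of_nonneg (by positivity) (by simp))]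
  gcongr with t
  rw [← ENNReal.mul_rpow_of_nonneg _ _ (by positivity)]
  gcongr
  exact sum_lz α (F t) (by linarith) hee (KK j)

lemma core_end (hm : 3 ≤ m) (α : Fin N) (e : ℝ) (he : e = 1/2 + 1/m) :
    ∃ C : ℝ≥0∞, C ≠ ∞ ∧ ∀ (U : ℝ → L2 m n N →L[ℂ] L2 m n N), IsPropagator m n N 0 U → ∀ F : ℝ → L2 m n N, StronglyMeasurable F → Integrable F →
      ‖∫ s, U (-s) (F s)‖ₑ ^ 2 ≤ C * ∫⁻ t, lz α e (F t) := by
  have hm' : (3:ℝ) ≤ m := by exact_mod_cast hm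
  have hmi : 1 / (m:ℝ) ≤ 1/2 := by
    rw [div_le_div_iff₀ (by linarith) (by norm_num)]; linarith
  have hmi0 : 0 < 1 / (m:ℝ) := by positivity
  obtain ⟨C, hC, h⟩ := strich_end (E := L2 m n N) (m:ℝ) hm' 2 (by simp) (by norm_num)
  refine ⟨C * 16, ENNReal.mul_ne_top hC (by simp), fun U hU F hF hFi => ?_⟩
  refine core_lim hU hF hFi α _ fun j => ?_
  refine (h (KK j) (fun k s => U (-s) (TT α k (F s))) (fun k s => wk α k (F s)) (fun k => H_int hU hF hFi α k) (fun k => wk_meas hF α k)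
    (fun k s => ?_) (fun k l s t => core_bd hU hm α k l s t _ _)).trans ?_
  · have : ‖U (-s) (TT α k (F s))‖ₑ = ‖TT α k (F s)‖ₑ := by rw [← ofReal_norm, ← ofReal_norm, hU.unitary]
    rw [this]
    exact TT_L2 α k (F s)
  rw [mul_assoc, ← lintegral_const_mul' 16 _ (by simp)]
  gcongr with t
  have := sum_lz α (F t) (e := e) (by rw [he]; linarith) (by rw [he]; linarith) (KK j)
  refine le_trans (le_of_eq ?_) this
  refine Finset.sum_congr rfl fun k _ => ?_
  rw [he, add_sub_cancel_left, mul_one_div]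

lemma core_triv (α : Fin N) {U : ℝ → L2 m n N →L[ℂ] L2 m n N} (hU : IsPropagator m n N 0 U) (F : ℝ → L2 m n N) :
    ‖∫ s, U (-s) (F s)‖ₑ ≤ ∫⁻ t, (lz α (1/2) (F t)) ^ (1/2:ℝ) := by
  refine (enorm_integral_le_lintegral_enorm _).trans (lintegral_mono fun s => ?_)
  have : ‖U (-s) (F s)‖ₑ = ‖F s‖ₑ := by rw [← ofReal_norm, ← ofReal_norm, hU.unitary]
  beta_reduce
  rw [this]
  have h1 := ENNReal.rpow_le_rpow (norm_lz α (F s)) (z := 1/2) (by norm_num)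
  refine le_trans (le_of_eq ?_) h1
  rw [← ENNReal.rpow_natCast, ← ENNReal.rpow_mul]; simp

lemma frozen_norm (α : Fin N) (q r : ℝ≥0∞) (hq : q ≠ ∞) (F : ℝ → L2 m n N) :
    frozenNormL q r 2 α (fun t x => (F t) x) = (∫⁻ t, ((lz α (1 / r.toReal) (F t)) ^ (1/2:ℝ)) ^ q.toReal) ^ (1 / q.toReal) := by
  unfold frozenNormL
  rw [eN, if_neg hq]
  congr 1
  refine lintegral_congr fun t => ?_
  rw [← lorentz_eq]
  congr 2
  funext y
  exact frozen_eq α (L2_meas (F t)) y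

end ManyBodyWaveguide

namespace ManyBodyWaveguide

variable {m n N : ℕ}

lemma wrap (α : Fin N) (qd rd : ℝ≥0∞) (hq : qd ≠ ∞) (C' : ℝ≥0∞) (hC' : C' ≠ ∞)
    (h : ∀ (U : ℝ → L2 m n N →L[ℂ] L2 m n N), IsPropagator m n N 0 U → ∀ F : ℝ → L2 m n N, StronglyMeasurable F → Integrable F →
      ‖∫ s, U (-s) (F s)‖ₑ ≤ C' * frozenNormL qd rd 2 α (fun t x => (F t) x)) :
    ∃ C : ℝ, 0 < C ∧
      ∀ U0 : ℝ → L2 m n N →L[ℂ] L2 m n N, IsPropagator m n N 0 U0 →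
        ∀ F : ℝ → L2 m n N, AEStronglyMeasurable F (volume : Measure ℝ) →
          (‖∫ s : ℝ, U0 (-s) (F s)‖₊ : ℝ≥0∞) ≤
            ENNReal.ofReal C * frozenNormL qd rd 2 α (fun t x => (F t) x) := by
  refine ⟨C'.toReal + 1, by positivity, fun U hU F hF => ?_⟩
  obtain ⟨G, hG, hFG⟩ := hF
  have e1 : ∫ s, U (-s) (F s) = ∫ s, U (-s) (G s) := by
    refine integral_congr_ae ?_
    filter_upwards [hFG] with s hs
    rw [hs]
  have e2 : frozenNormL qd rd 2 α (fun t x => (F t) x) = frozenNormL qd rd 2 α (fun t x => (G t) x) := by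
    rw [frozen_norm α qd rd hq, frozen_norm α qd rd hq]
    congr 1
    refine lintegral_congr_ae ?_
    filter_upwards [hFG] with s hs
    rw [hs]
  rw [e1, e2, ← enorm_eq_nnnorm]
  by_cases hi : Integrable fun s => U (-s) (G s)
  · have hGi : Integrable G := by
      rw [← integrable_norm_iff hG.aestronglyMeasurable]
      have := hi.norm
      simp_rw [hU.unitary] at this
      exact this
    refine (h U hU G hG hGi).trans ?_
    gcongr
    rw [ENNReal.le_ofReal_iff_toReal_le hC' (by positivity)]
    linarith
  · rw [integral_undef hi]; simp

lemma main_nonend (hm : 3 ≤ m) (α : Fin N) (qd rd : ℝ≥0∞) (hq : qd ≠ ∞) (c d : ℝ) (hc : qd.toReal = c) (hd : rd.toReal = d)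
    (h1 : 1/2 < 1/d) (h2 : (m:ℝ) * (1/d - 1/2) < 1) (h3 : c = 2 / (2 - m * (1/d - 1/2))) :
    ∃ C : ℝ, 0 < C ∧
      ∀ U0 : ℝ → L2 m n N →L[ℂ] L2 m n N, IsPropagator m n N 0 U0 →
        ∀ F : ℝ → L2 m n N, AEStronglyMeasurable F (volume : Measure ℝ) →
          (‖∫ s : ℝ, U0 (-s) (F s)‖₊ : ℝ≥0∞) ≤
            ENNReal.ofReal C * frozenNormL qd rd 2 α (fun t x => (F t) x) := by
  have hc0 : 0 < c := by rw [h3]; exact div_pos (by norm_num) (by linarith)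
  obtain ⟨C, hC, h⟩ := core_nonend (n := n) hm α (1/d) h1 h2 c h3
  refine wrap α qd rd hq (C ^ (1/2:ℝ)) (ENNReal.rpow_ne_top_of_nonneg (by norm_num) hC) fun U hU F hF hFi => ?_
  rw [frozen_norm α qd rd hq, hc, hd]
  have h4 := ENNReal.rpow_le_rpow (h U hU F hF hFi) (z := 1/2) (by norm_num)
  rw [← ENNReal.rpow_natCast, ← ENNReal.rpow_mul, ENNReal.mul_rpow_of_nonneg _ _ (by norm_num), ← ENNReal.rpow_mul] at h4
  have e1 : ((2:ℕ):ℝ) * (1/2) = 1 := by norm_num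
  have e2 : 2 / c * (1/2) = 1 / c := by field_simp
  rw [e1, e2, ENNReal.rpow_one] at h4
  refine h4.trans (le_of_eq ?_)
  congr 2
  refine lintegral_congr fun t => ?_
  rw [← ENNReal.rpow_mul]; congr 1; ring

lemma main_end (hm : 3 ≤ m) (α : Fin N) (qd rd : ℝ≥0∞) (hq : qd ≠ ∞) (d : ℝ) (hc : qd.toReal = 2) (hd : rd.toReal = d)
    (h1 : 1/d = 1/2 + 1/m) :
    ∃ C : ℝ, 0 < C ∧
      ∀ U0 : ℝ → L2 m n N →L[ℂ] L2 m n N, IsPropagator m n N 0 U0 →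
        ∀ F : ℝ → L2 m n N, AEStronglyMeasurable F (volume : Measure ℝ) →
          (‖∫ s : ℝ, U0 (-s) (F s)‖₊ : ℝ≥0∞) ≤
            ENNReal.ofReal C * frozenNormL qd rd 2 α (fun t x => (F t) x) := by
  obtain ⟨C, hC, h⟩ := core_end (n := n) hm α (1/d) h1
  refine wrap α qd rd hq (C ^ (1/2:ℝ)) (ENNReal.rpow_ne_top_of_nonneg (by norm_num) hC) fun U hU F hF hFi => ?_
  rw [frozen_norm α qd rd hq, hc, hd]
  have h4 := ENNReal.rpow_le_rpow (h U hU F hF hFi) (z := 1/2) (by norm_num)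
  rw [← ENNReal.rpow_natCast, ← ENNReal.rpow_mul, ENNReal.mul_rpow_of_nonneg _ _ (by norm_num)] at h4
  have e1 : ((2:ℕ):ℝ) * (1/2) = 1 := by norm_num
  rw [e1, ENNReal.rpow_one] at h4
  refine h4.trans (le_of_eq ?_)
  congr 2
  refine lintegral_congr fun t => ?_
  rw [← ENNReal.rpow_mul]; simp

lemma main_triv (α : Fin N) :
    ∃ C : ℝ, 0 < C ∧
      ∀ U0 : ℝ → L2 m n N →L[ℂ] L2 m n N, IsPropagator m n N 0 U0 →
        ∀ F : ℝ → L2 m n N, AEStronglyMeasurable F (volume : Measure ℝ) →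
          (‖∫ s : ℝ, U0 (-s) (F s)‖₊ : ℝ≥0∞) ≤
            ENNReal.ofReal C * frozenNormL 1 2 2 α (fun t x => (F t) x) := by
  refine ⟨1, one_pos, fun U hU F _ => ?_⟩
  rw [frozen_norm α 1 2 (by simp), ← enorm_eq_nnnorm]
  simpa using core_triv α hU F

lemma conj_two {x y : ℝ≥0∞} (h : 1 / x + 1 / y = 1) (hx : 2 ≤ x) (hx' : x ≠ ∞) : y ≠ ∞ ∧ 1 / x.toReal + 1 / y.toReal = 1 := by
  have hx0 : x ≠ 0 := by rintro rfl; simp at hx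
  have hy : y ≠ ∞ := by
    rintro rfl
    have h1 : 1 / x ≤ 1 / 2 := ENNReal.div_le_div_left hx 1
    simp only [one_div, ENNReal.inv_top, add_zero] at h h1
    rw [h] at h1
    have : (2:ℝ≥0∞)⁻¹ < 1 := ENNReal.inv_lt_one.2 (by norm_num)
    exact absurd h1 (not_le.2 this)
  have hy0 : y ≠ 0 := by
    rintro rfl
    simp at h
  refine ⟨hy, ?_⟩
  have h2 := congrArg ENNReal.toReal h
  rw [ENNReal.toReal_add (ENNReal.div_ne_top (by simp) hx0) (ENNReal.div_ne_top (by simp) hy0), ENNReal.toReal_div, ENNReal.toReal_div] at h2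
  simpa using h2

theorem strichartz_frozen_dual (m n N : ℕ) (hm : 3 ≤ m) (hn : 1 ≤ n)
    (hN : 1 ≤ N) (qt rt qd rd : ℝ≥0∞) (hqr : Admissible m qt rt)
    (hqd : 1 / qt + 1 / qd = 1) (hrd : 1 / rt + 1 / rd = 1) (α : Fin N) :
    ∃ C : ℝ, 0 < C ∧
      ∀ U0 : ℝ → L2 m n N →L[ℂ] L2 m n N, IsPropagator m n N 0 U0 →
        ∀ F : ℝ → L2 m n N, AEStronglyMeasurable F (volume : Measure ℝ) →
          (‖∫ s : ℝ, U0 (-s) (F s)‖₊ : ℝ≥0∞) ≤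
            ENNReal.ofReal C * frozenNormL qd rd 2 α (fun t x => (F t) x) := by
  obtain ⟨hq2, hr2, hsc, _⟩ := hqr
  have hm' : (3:ℝ) ≤ m := by exact_mod_cast hm
  have hq0 : qt ≠ 0 := by rintro rfl; simp at hq2
  have hr0 : rt ≠ 0 := by rintro rfl; simp at hr2
  have hrt : rt ≠ ∞ := by
    rintro rfl
    rw [ENNReal.div_top, add_zero] at hsc
    have h1 : 2 / qt ≤ 1 := by
      rw [ENNReal.div_le_iff hq0 (by
        rintro rfl
        rw [ENNReal.div_top] at hsc
        have h5 : (m:ℝ≥0∞) / 2 ≠ 0 := ENNReal.div_ne_zero.2 ⟨by exact_mod_cast (by omega : m ≠ 0), by simp⟩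
        exact h5 hsc.symm), one_mul]
      exact hq2
    rw [hsc, ENNReal.div_le_iff (by simp) (by simp), one_mul] at h1
    have : m ≤ 2 := by exact_mod_cast h1
    omega
  obtain ⟨hrdt, hr⟩ := conj_two hrd hr2 hrt
  have hb2 : (2:ℝ) ≤ rt.toReal := by
    have := ENNReal.toReal_mono hrt hr2
    simpa using this
  have hsc' : (2 / qt).toReal + (m:ℝ) / rt.toReal = m / 2 := by
    have h2 := congrArg ENNReal.toReal hsc
    rw [ENNReal.toReal_add (ENNReal.div_ne_top (by simp) hq0) (ENNReal.div_ne_top (by simp) hr0), ENNReal.toReal_div, ENNReal.toReal_div, ENNReal.toReal_div] at h2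
    rw [ENNReal.toReal_div]
    simpa using h2
  by_cases hqt : qt = ∞
  · subst hqt
    have hqd1 : qd = 1 := by
      simp only [one_div, ENNReal.inv_top, zero_add] at hqd
      simpa using hqd
    have hrt2 : rt.toReal = 2 := by
      rw [ENNReal.div_top, ENNReal.toReal_zero, zero_add] at hsc'
      field_simp at hsc'
      linarith
    have hrd2 : rd = 2 := by
      rw [hrt2] at hr
      have h3 : rd.toReal = 2 := by
        have h4 : 1 / rd.toReal = 1/2 := by linarith
        have h5 : rd.toReal ≠ 0 := by intro h; rw [h] at h4; norm_num at h4
        field_simp at h4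
        linarith
      rw [← ENNReal.ofReal_toReal hrdt, h3]; simp
    subst hqd1
    subst hrd2
    exact main_triv α
  · obtain ⟨hqdt, hq⟩ := conj_two hqd hq2 hqt
    have ha2 : (2:ℝ) ≤ qt.toReal := by
      have := ENNReal.toReal_mono hqt hq2
      simpa using this
    rw [ENNReal.toReal_div, ENNReal.toReal_ofNat] at hsc'
    set a := qt.toReal
    set b := rt.toReal
    have key : (m:ℝ) * (1 / rd.toReal - 1/2) = 2 / a := by
      have : 1 / rd.toReal = 1 - 1 / b := by linarith
      rw [this]
      have : (m:ℝ) / b = m * (1/b) := by ring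
      rw [this] at hsc'
      linarith
    have hc : qd.toReal = 2 / (2 - 2 / a) := by
      have h4 : 1 / qd.toReal = 1 - 1 / a := by linarith
      have h5 : 2 - 2 / a = 2 * (1 / qd.toReal) := by rw [h4]; ring
      rw [h5]
      field_simp
    have ha0 : 0 < 2 / a := by positivity
    rcases eq_or_lt_of_le ha2 with h | h
    · refine main_end hm α qd rd hqdt _ ?_ rfl ?_
      · rw [hc, ← h]; norm_num
      · rw [← h] at key
        have : 1 / (m:ℝ) = 1 / rd.toReal - 1/2 := by
          rw [div_eq_iff (by linarith)]; linarith
        linarith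
    · refine main_nonend hm α qd rd hqdt _ _ rfl rfl ?_ ?_ ?_
      · rw [← key] at ha0
        have := pos_of_mul_pos_right ha0 (by linarith)
        linarith
      · rw [key, div_lt_one (by linarith)]; exact h
      · rw [key]; exact hc

end ManyBodyWaveguide
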